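/- arXiv:1806.08656 — 5 statements merged into one kernel-verified Lean document; each statement's English description precedes it below -/
import Mathlib

section
/- For all n,d ∈ ℕ, sxdeg(C_{n,2d}) = 2: the SONC cone C_{n,2d} has an ((𝒮₊²)^m)-lift for some m ∈ ℕ (equivalently, a second-order cone extended formulation), and C_{n,2d} has no (ℝ₊^m)-lift for any m (it is not a polyhedron). -/
open MvPolynomial

/-- The cone of `m`-tuples of `k × k` real positive semidefinite matrices, `(𝒮₊ᵏ)^m`. -/
def PSDTuple (k m : ℕ) : Set (Fin m → Matrix (Fin k) (Fin k) ℝ) :=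
  {A | ∀ i, (A i).PosSemidef}

/-- The cone `𝒮₊ᵏ` of `k × k` real positive semidefinite matrices. -/
def PSDCone (k : ℕ) : Set (Matrix (Fin k) (Fin k) ℝ) :=
  {A | A.PosSemidef}

/-- `S ⊆ V` has a `K`-lift if `S = π(K ∩ H)` for an affine subspace `H` and a linear map `π`. -/
def HasLift {W V : Type*} [AddCommGroup W] [Module ℝ W] [AddCommGroup V] [Module ℝ V]
    (K : Set W) (S : Set V) : Prop :=
  ∃ (H : AffineSubspace ℝ W) (p : W →ₗ[ℝ] V), S = p '' (K ∩ (H : Set W))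

/-- Semidefinite extension degree: the smallest `k` such that `S` has an `(𝒮₊ᵏ)^m`-lift
for some finite `m` (`⊤` if there is no such `k`). -/
noncomputable def sxdeg {V : Type*} [AddCommGroup V] [Module ℝ V] (S : Set V) : ℕ∞ :=
  sInf {c : ℕ∞ | ∃ k m : ℕ, c = (k : ℕ∞) ∧ HasLift (PSDTuple k m) S}

/-- Semidefinite extension complexity: the smallest `k` such that `S` has an `𝒮₊ᵏ`-lift. -/
noncomputable def sxc {V : Type*} [AddCommGroup V] [Module ℝ V] (S : Set V) : ℕ∞ :=
  sInf {c : ℕ∞ | ∃ k : ℕ, c = (k : ℕ∞) ∧ HasLift (PSDCone k) S}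

/-- Coefficient embedding of polynomials into the product space `(Fin n →₀ ℕ) → ℝ`;
used to express topological notions (closedness) for sets of polynomials. -/
noncomputable def coeffMap (n : ℕ) : MvPolynomial (Fin n) ℝ →ₗ[ℝ] ((Fin n →₀ ℕ) → ℝ) where
  toFun f := fun a => coeff a f
  map_add' := by intros; funext; simp
  map_smul' := by intros; funext; simp

/-- `Σ_{n,2d}`: sums of squares of polynomials, of degree at most `2d`, in `n` variables. -/
def SOSCone (n d : ℕ) : Set (MvPolynomial (Fin n) ℝ) :=
  {f | f.totalDegree ≤ 2 * d ∧
    ∃ (r : ℕ) (g : Fin r → MvPolynomial (Fin n) ℝ), f = ∑ i, g i ^ 2}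

/-- `P_{n,2d}(X)`: polynomials of degree at most `2d` that are nonnegative on `X`. -/
def PosCone (n d : ℕ) (X : Set (Fin n → ℝ)) : Set (MvPolynomial (Fin n) ℝ) :=
  {f | f.totalDegree ≤ 2 * d ∧ ∀ x ∈ X, 0 ≤ MvPolynomial.eval x f}

/-- The vector `v_{n,d}(x) = (x^α)_{|α| ≤ d}` of all monomials of degree at most `d`
evaluated at `x`, regarded inside the coordinate space `(Fin n →₀ ℕ) → ℝ`. -/
noncomputable def monVec (n d : ℕ) (x : Fin n → ℝ) : (Fin n →₀ ℕ) → ℝ :=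
  fun a => if (a.sum fun _ e => e) ≤ d then ∏ i, x i ^ a i else 0

/-- The convex conic hull: all finite nonnegative combinations of elements of `s`. -/
def coneHull {V : Type*} [AddCommGroup V] [Module ℝ V] (s : Set V) : Set V :=
  {y | ∃ (r : ℕ) (c : Fin r → ℝ) (v : Fin r → V),
    (∀ i, 0 ≤ c i) ∧ (∀ i, v i ∈ s) ∧ y = ∑ i, c i • v i}

/-- `P_{n,A}`: the cone of nonnegative polynomials whose support is contained in `A`. -/
def SuppCone (n : ℕ) (A : Finset (Fin n →₀ ℕ)) : Set (MvPolynomial (Fin n) ℝ) :=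
  {f | f.support ⊆ A ∧ ∀ x : Fin n → ℝ, 0 ≤ MvPolynomial.eval x f}

/-- `A ∈ 𝒜_n`: `A = {α(0),…,α(k),β}` where `α(0),…,α(k) ∈ (2ℤ₊)ⁿ` are the vertices of a
`k`-dimensional simplex (`1 ≤ k ≤ n`) and `β` lies in its relative interior. -/
def IsCircuit (n : ℕ) (A : Finset (Fin n →₀ ℕ)) : Prop :=
  ∃ (k : ℕ) (α : Fin (k + 1) → (Fin n →₀ ℕ)) (β : Fin n →₀ ℕ) (lam : Fin (k + 1) → ℝ),
    1 ≤ k ∧ k ≤ n ∧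
    (∀ i j, Even (α i j)) ∧
    AffineIndependent ℝ (fun i => ((fun j => (α i j : ℝ)) : Fin n → ℝ)) ∧
    (∀ i, 0 < lam i) ∧ (∑ i, lam i) = 1 ∧
    (∀ j, (β j : ℝ) = ∑ i, lam i * (α i j : ℝ)) ∧
    β ∉ Set.range α ∧
    A = insert β (Finset.image α Finset.univ)

/-- The SONC cone `C_{n,2d} = Σ_{A ∈ 𝒜_{n,2d}} P_{n,A}`. -/
def SONCCone (n d : ℕ) : Set (MvPolynomial (Fin n) ℝ) :=
  {f | ∃ (r : ℕ) (g : Fin r → MvPolynomial (Fin n) ℝ),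
    (∀ i, ∃ A : Finset (Fin n →₀ ℕ), IsCircuit n A ∧
      (∀ a ∈ A, (a.sum fun _ e => e) ≤ 2 * d) ∧ g i ∈ SuppCone n A) ∧
    f = ∑ i, g i}

/-- The nonnegative orthant `ℝ₊^m`. -/
def Orthant (m : ℕ) : Set (Fin m → ℝ) := {x | ∀ i, 0 ≤ x i}

theorem posSemidef_fin_two_iff {a b c : ℝ} :
    (!![a, b; b, c] : Matrix (Fin 2) (Fin 2) ℝ).PosSemidef ↔ 0 ≤ a ∧ 0 ≤ c ∧ b ^ 2 ≤ a * c := by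
  constructor
  · intro h
    refine ⟨by simpa using h.diag_nonneg (i := 0), by simpa using h.diag_nonneg (i := 1), ?_⟩
    have := h.det_nonneg
    rw [Matrix.det_fin_two_of] at this
    nlinarith
  · rintro ⟨ha, hc, hb⟩
    refine Matrix.PosSemidef.of_dotProduct_mulVec_nonneg ?_ fun x ↦ ?_
    · ext i j
      fin_cases i <;> fin_cases j <;> simp
    · simp [Matrix.mulVec, dotProduct, Fin.sum_univ_two]
      rcases ha.eq_or_lt with rfl | ha
      · have : b = 0 := by nlinarith [sq_nonneg b]
        subst this
        nlinarith [mul_nonneg hc (sq_nonneg (x 1))]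
      · have : 0 ≤ a * (x 0 * (a * x 0 + b * x 1) + x 1 * (b * x 0 + c * x 1)) := by
          nlinarith [sq_nonneg (a * x 0 + b * x 1),
            mul_nonneg (sub_nonneg.2 hb) (sq_nonneg (x 1))]
        exact nonneg_of_mul_nonneg_right this ha
open Multiset in

/-- `S` is the linear image of a set cut out by finitely many linear matrix inequalities of
size `2 × 2` in a finite-dimensional space. -/
def IsSOCRep {V : Type} [AddCommGroup V] [Module ℝ V] (S : Set V) : Prop :=
  ∃ (W : Type) (_ : AddCommGroup W) (_ : Module ℝ W) (_ : FiniteDimensional ℝ W)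
    (ι : Type) (_ : Finite ι) (l : ι → W →ₗ[ℝ] Matrix (Fin 2) (Fin 2) ℝ) (p : W →ₗ[ℝ] V),
    S = p '' {w | ∀ i, (l i w).PosSemidef}

namespace IsSOCRep

variable {V V' : Type} [AddCommGroup V] [Module ℝ V] [AddCommGroup V'] [Module ℝ V']

theorem image {S : Set V} (hS : IsSOCRep S) (f : V →ₗ[ℝ] V') : IsSOCRep (f '' S) := by
  obtain ⟨W, _, _, _, ι, _, l, p, rfl⟩ := hS
  exact ⟨W, _, _, ‹_›, ι, ‹_›, l, f ∘ₗ p, by rw [← Set.image_comp]; rfl⟩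

theorem preimage [FiniteDimensional ℝ V'] {S : Set V} (hS : IsSOCRep S) (f : V' →ₗ[ℝ] V) :
    IsSOCRep (f ⁻¹' S) := by
  obtain ⟨W, _, _, _, ι, _, l, p, rfl⟩ := hS
  let E : Submodule ℝ (V' × W) :=
    LinearMap.eqLocus (f ∘ₗ LinearMap.fst ℝ V' W) (p ∘ₗ LinearMap.snd ℝ V' W)
  refine ⟨E, _, _, inferInstance, ι, ‹_›,
    fun i ↦ l i ∘ₗ LinearMap.snd ℝ V' W ∘ₗ E.subtype, LinearMap.fst ℝ V' W ∘ₗ E.subtype, ?_⟩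
  ext v
  constructor
  · rintro ⟨w, hw, hwv⟩
    exact ⟨⟨(v, w), hwv.symm⟩, hw, rfl⟩
  · rintro ⟨⟨⟨v', w⟩, h⟩, hw, rfl⟩
    exact ⟨w, hw, h.symm⟩

theorem pi {κ : Type} [Finite κ] {X : κ → Type} [∀ a, AddCommGroup (X a)] [∀ a, Module ℝ (X a)]
    {S : ∀ a, Set (X a)} (hS : ∀ a, IsSOCRep (S a)) : IsSOCRep (Set.univ.pi S) := by
  choose W i₁ i₂ i₃ ι i₄ l p h using hS
  refine ⟨∀ a, W a, inferInstance, inferInstance, inferInstance, Σ a, ι a, inferInstance,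
    fun i ↦ l i.1 i.2 ∘ₗ LinearMap.proj i.1, LinearMap.pi fun a ↦ p a ∘ₗ LinearMap.proj a, ?_⟩
  ext x
  simp only [Set.mem_univ_pi]
  constructor
  · intro hx
    have : ∀ a, ∃ w, (∀ i, (l a i w).PosSemidef) ∧ p a w = x a := fun a ↦ by
      simpa [h a] using hx a
    choose w hw hwx using this
    exact ⟨w, fun i ↦ hw i.1 i.2, funext hwx⟩
  · rintro ⟨w, hw, rfl⟩ a
    rw [h a]
    exact ⟨w a, fun i ↦ hw ⟨a, i⟩, rfl⟩

theorem iInter [FiniteDimensional ℝ V] {κ : Type} [Finite κ] {S : κ → Set V}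
    (hS : ∀ a, IsSOCRep (S a)) : IsSOCRep (⋂ a, S a) := by
  convert (pi hS).preimage (LinearMap.pi fun _ ↦ LinearMap.id) using 1
  ext x
  simp

theorem inter [FiniteDimensional ℝ V] {S T : Set V} (hS : IsSOCRep S) (hT : IsSOCRep T) :
    IsSOCRep (S ∩ T) := by
  rw [Set.inter_eq_iInter]
  exact iInter fun b ↦ by cases b <;> assumption

/-- A finite Minkowski sum of representable sets is representable. -/
theorem sum {κ : Type} [Fintype κ] {S : κ → Set V} (hS : ∀ a, IsSOCRep (S a)) :
    IsSOCRep {v | ∃ g : κ → V, (∀ a, g a ∈ S a) ∧ v = ∑ a, g a} := by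
  convert (pi hS).image (∑ a, LinearMap.proj a) using 1
  ext v
  simp [eq_comm]

theorem setOf_le_mul [FiniteDimensional ℝ V] (u a b : V →ₗ[ℝ] ℝ) :
    IsSOCRep {v | 0 ≤ a v ∧ 0 ≤ b v ∧ u v ^ 2 ≤ a v * b v} := by
  refine ⟨V, _, _, ‹_›, Unit, inferInstance, fun _ ↦
    a.smulRight !![1, 0; 0, 0] + b.smulRight !![0, 0; 0, 1] + u.smulRight !![0, 1; 1, 0],
    LinearMap.id, ?_⟩
  ext v
  have : a v • !![1, 0; 0, 0] + b v • !![0, 0; 0, 1] + u v • !![0, 1; 1, 0] =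
      !![a v, u v; u v, b v] := by
    ext i j
    fin_cases i <;> fin_cases j <;> simp
  simp [posSemidef_fin_two_iff]

theorem setOf_nonneg [FiniteDimensional ℝ V] (u : V →ₗ[ℝ] ℝ) : IsSOCRep {v | 0 ≤ u v} := by
  convert setOf_le_mul 0 u u using 1
  ext v
  simp +contextual [mul_nonneg]

/-- The hypograph of the geometric mean of `2 ^ s` linear forms is representable. -/
theorem setOf_pow_le_prod {V : Type} [AddCommGroup V] [Module ℝ V] [FiniteDimensional ℝ V]
    (s : ℕ) (u : V →ₗ[ℝ] ℝ) (M : Multiset (V →ₗ[ℝ] ℝ)) (hM : M.card = 2 ^ s) :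
    IsSOCRep {v | 0 ≤ u v ∧ (∀ y ∈ M, 0 ≤ y v) ∧ u v ^ 2 ^ s ≤ (M.map fun y ↦ y v).prod} := by
  induction s generalizing V with
  | zero =>
    obtain ⟨y, rfl⟩ := Multiset.card_eq_one.1 (by simpa using hM)
    convert (setOf_nonneg u).inter ((setOf_nonneg y).inter (setOf_nonneg (y - u))) using 1
    ext v
    simp
  | succ s ih =>
    obtain ⟨M₁, M₂, rfl, h₁, h₂⟩ : ∃ M₁ M₂, M = M₁ + M₂ ∧ M₁.card = 2 ^ s ∧ M₂.card = 2 ^ s := by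
      induction M using Quotient.inductionOn with | _ l
      refine ⟨(l.take (2 ^ s) : List _), (l.drop (2 ^ s) : List _), ?_, ?_, ?_⟩
      · simp
      · simp at hM ⊢; omega
      · simp at hM ⊢; omega
    let F := LinearMap.fst ℝ V (ℝ × ℝ)
    let a : V × ℝ × ℝ →ₗ[ℝ] ℝ := LinearMap.fst ℝ ℝ ℝ ∘ₗ LinearMap.snd ℝ V (ℝ × ℝ)
    let b : V × ℝ × ℝ →ₗ[ℝ] ℝ := LinearMap.snd ℝ ℝ ℝ ∘ₗ LinearMap.snd ℝ V (ℝ × ℝ)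
    convert ((setOf_nonneg (u ∘ₗ F)).inter ((setOf_le_mul (u ∘ₗ F) a b).inter
      ((ih a (M₁.map (· ∘ₗ F)) (by simpa)).inter (ih b (M₂.map (· ∘ₗ F)) (by simpa))))).image F
      using 1
    ext v
    simp only [Set.mem_ofPred_eq, Multiset.map_add, Multiset.prod_add, Multiset.mem_add,
      Set.mem_image, Set.mem_inter_iff, Multiset.map_map, Multiset.mem_map,
      forall_exists_index, and_imp, forall_apply_eq_imp_iff₂]
    constructor
    · rintro ⟨hu, hy, hle⟩
      have hP₁ : 0 ≤ (M₁.map fun y ↦ y v).prod :=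
        Multiset.prod_nonneg (by simpa using fun y hyM ↦ hy y (.inl hyM))
      have hP₂ : 0 ≤ (M₂.map fun y ↦ y v).prod :=
        Multiset.prod_nonneg (by simpa using fun y hyM ↦ hy y (.inr hyM))
      have root : ∀ P : ℝ, 0 ≤ P → ∃ r : ℝ, 0 ≤ r ∧ r ^ 2 ^ s = P := fun P hP ↦
        ⟨P ^ ((2 ^ s : ℕ) : ℝ)⁻¹, by positivity, Real.rpow_inv_natCast_pow hP (by positivity)⟩
      obtain ⟨a', ha, ha'⟩ := root _ hP₁
      obtain ⟨b', hb, hb'⟩ := root _ hP₂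
      refine ⟨(v, a', b'), ⟨hu, ⟨ha, hb, ?_⟩, ⟨ha, fun y hyM ↦ hy y (.inl hyM), ha'.le⟩,
        hb, fun y hyM ↦ hy y (.inr hyM), hb'.le⟩, rfl⟩
      change u v ^ 2 ≤ a' * b'
      refine le_of_pow_le_pow_left₀ (n := 2 ^ s) (by positivity) (by positivity) ?_
      rw [mul_pow, ha', hb', ← pow_mul, ← pow_succ']
      exact hle
    · rintro ⟨⟨v, a', b'⟩, ⟨hu, ⟨ha, hb, hab⟩, ⟨-, hy₁, hle₁⟩, -, hy₂, hle₂⟩, rfl⟩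
      refine ⟨hu, fun y hy ↦ hy.elim (hy₁ y) (hy₂ y), ?_⟩
      calc u v ^ 2 ^ (s + 1) = (u v ^ 2) ^ 2 ^ s := by rw [← pow_mul, ← pow_succ']
        _ ≤ (a' * b') ^ 2 ^ s := pow_le_pow_left₀ (sq_nonneg _) hab _
        _ = a' ^ 2 ^ s * b' ^ 2 ^ s := mul_pow ..
        _ ≤ _ := mul_le_mul hle₁ hle₂ (pow_nonneg hb _) ((pow_nonneg ha _).trans hle₁)

/-- The hypograph of a geometric mean with rational weights `p i / q` is representable. -/
theorem setOf_pow_le_prod_pow [FiniteDimensional ℝ V] {ι : Type} [Fintype ι]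
    (u : V →ₗ[ℝ] ℝ) (y : ι → V →ₗ[ℝ] ℝ) {p : ι → ℕ} (hp : ∀ i, 0 < p i) {q : ℕ}
    (hq : ∑ i, p i = q) :
    IsSOCRep {v | 0 ≤ u v ∧ (∀ i, 0 ≤ y i v) ∧ u v ^ q ≤ ∏ i, y i v ^ p i} := by
  have hqs : q ≤ 2 ^ q := Nat.lt_two_pow_self.le
  convert setOf_pow_le_prod q u (∑ i, Multiset.replicate (p i) (y i) +
    Multiset.replicate (2 ^ q - q) u) (by simp [hq]; omega) using 1
  ext v
  have hprod : ((∑ i, Multiset.replicate (p i) (y i)).map fun y ↦ y v).prod =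
      ∏ i, y i v ^ p i := by
    rw [← Multiset.coe_mapAddMonoidHom, map_sum, Multiset.prod_sum]
    simp
  have hmem : ∀ P : (V →ₗ[ℝ] ℝ) → Prop, (∀ f ∈ ∑ i, Multiset.replicate (p i) (y i), P f) ↔
      ∀ i, P (y i) := fun P ↦ by
    simp only [Multiset.mem_sum, Multiset.mem_replicate]
    constructor
    · exact fun h i ↦ h _ ⟨i, Finset.mem_univ _, (hp i).ne', rfl⟩
    · rintro h _ ⟨i, -, -, rfl⟩
      exact h i
  simp only [Set.mem_ofPred_eq, Multiset.mem_add, or_imp, forall_and, hmem, Multiset.map_add,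
    Multiset.prod_add, hprod, Multiset.map_replicate, Multiset.prod_replicate]
  have hpow : u v ^ 2 ^ q = u v ^ q * u v ^ (2 ^ q - q) := by
    rw [← pow_add, Nat.add_sub_cancel' hqs]
  rw [hpow]
  constructor
  · rintro ⟨hu, hy, hle⟩
    exact ⟨hu, ⟨hy, fun f hf ↦ Multiset.eq_of_mem_replicate hf ▸ hu⟩,
      mul_le_mul_of_nonneg_right hle (by positivity)⟩
  · rintro ⟨hu, ⟨hy, -⟩, hle⟩
    refine ⟨hu, hy, ?_⟩
    rcases hu.eq_or_lt with h0 | h0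
    · rcases Nat.eq_zero_or_pos q with rfl | hq0
      · have : ∀ i, p i = 0 := by simpa using hq
        simp [this]
      · rw [← h0, zero_pow hq0.ne']
        exact Finset.prod_nonneg fun i _ ↦ pow_nonneg (hy i) _
    · exact le_of_mul_le_mul_right hle (by positivity)

theorem hasLift {S : Set V} (hS : IsSOCRep S) : ∃ m : ℕ, HasLift (PSDTuple 2 m) S := by
  obtain ⟨W, _, _, _, ι, _, l, p, rfl⟩ := hS
  obtain ⟨m, ⟨e⟩⟩ := Finite.exists_equiv_fin (ι ⊕ Fin (Module.finrank ℝ W))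
  let b := Module.finBasis ℝ W
  let g : (Fin m → Matrix (Fin 2) (Fin 2) ℝ) →ₗ[ℝ] W :=
    ∑ j, (Matrix.entryLinearMap ℝ ℝ 0 1 ∘ₗ LinearMap.proj (e (.inr j))).smulRight (b j)
  have hg : ∀ A, g A = ∑ j, A (e (.inr j)) 0 1 • b j := fun A ↦ by simp [g]
  let H : Submodule ℝ (Fin m → Matrix (Fin 2) (Fin 2) ℝ) :=
    ⨅ i, LinearMap.eqLocus (LinearMap.proj (e (.inl i))) (l i ∘ₗ g)
  have hH : ∀ A, A ∈ H ↔ ∀ i, A (e (.inl i)) = l i (g A) := fun A ↦ by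
    simp [H, Submodule.mem_iInf]
  refine ⟨m, H.toAffineSubspace, p ∘ₗ g, ?_⟩
  ext v
  constructor
  · rintro ⟨w, hw, rfl⟩
    let A : Fin m → Matrix (Fin 2) (Fin 2) ℝ := fun k ↦
      Sum.elim (fun i ↦ l i w) (fun j ↦ !![|b.repr w j|, b.repr w j; b.repr w j, |b.repr w j|])
        (e.symm k)
    have hgA : g A = w := by
      rw [hg]
      conv_rhs => rw [← b.sum_repr w]
      simp [A]
    refine ⟨A, ⟨fun k ↦ ?_, (hH A).2 fun i ↦ by simp [hgA, A]⟩, by simp [hgA]⟩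
    simp only [A]
    rcases e.symm k with i | j
    · exact hw i
    · simp [posSemidef_fin_two_iff, ← sq]
  · rintro ⟨A, ⟨hA, hAH⟩, rfl⟩
    refine ⟨g A, fun i ↦ ?_, rfl⟩
    rw [← (hH A).1 hAH i]
    exact hA _

end IsSOCRep


/-- Barycentric coordinates of a lattice point with respect to affinely independent lattice
points are rational, here written with a common denominator. -/
theorem exists_nat_weights {n : ℕ} {ι : Type*} [Fintype ι] {α : ι → Fin n →₀ ℕ} {β : Fin n →₀ ℕ}
    (hα : AffineIndependent ℝ (fun i => ((fun j => (α i j : ℝ)) : Fin n → ℝ))) {lam : ι → ℝ}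
    (hpos : ∀ i, 0 < lam i) (hsum : ∑ i, lam i = 1) (hβ : ∀ j, (β j : ℝ) = ∑ i, lam i * α i j) :
    ∃ p : ι → ℕ, (∀ i, 0 < p i) ∧ ∀ j, (∑ i, p i) * β j = ∑ i, p i * α i j := by
  obtain ⟨φ, hφ⟩ := LinearMap.exists_leftInverse_of_injective (Algebra.linearMap ℚ ℝ)
    (LinearMap.ker_eq_bot.2 (algebraMap ℚ ℝ).injective)
  have hφq : ∀ r : ℚ, φ r = r := fun r ↦ by simpa using LinearMap.congr_fun hφ r
  have hφmul : ∀ (x : ℝ) (m : ℕ), φ (x * m) = φ x * m := fun x m ↦ by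
    rw [mul_comm, ← nsmul_eq_mul, map_nsmul, nsmul_eq_mul, mul_comm]
  have hsum' : ∑ i, φ (lam i) = 1 := by
    rw [← map_sum, hsum]
    simpa using hφq 1
  have hβ' : ∀ j, (β j : ℚ) = ∑ i, φ (lam i) * α i j := fun j ↦ by
    have := congrArg φ (hβ j)
    rw [map_sum] at this
    simp only [hφmul] at this
    rw [← this]
    simpa using (hφq (β j)).symm
  have hlam : ∀ i, lam i = (φ (lam i) : ℝ) := fun i ↦ by
    have hs : ∑ i, (φ (lam i) : ℝ) = 1 := by exact_mod_cast hsum'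
    have hb : ∀ j, (β j : ℝ) = ∑ i, (φ (lam i) : ℝ) * α i j := fun j ↦ by exact_mod_cast hβ' j
    refine sub_eq_zero.1 (affineIndependent_iff.1 hα Finset.univ
      (fun i ↦ lam i - φ (lam i)) ?_ ?_ i (Finset.mem_univ _))
    · simp [Finset.sum_sub_distrib, hsum, hs]
    · ext j
      simp [sub_mul, Finset.sum_sub_distrib, ← hβ, ← hb]
  have hr : ∀ i, 0 < φ (lam i) := fun i ↦ by
    have := hpos i
    rw [hlam i] at this
    exact_mod_cast this
  let N := ∏ i, (φ (lam i)).den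
  have hN : 0 < N := Finset.prod_pos fun i _ ↦ Rat.den_pos _
  have hp : ∀ i, ∃ p : ℕ, (p : ℚ) = φ (lam i) * N := fun i ↦ by
    obtain ⟨m, hm⟩ : (φ (lam i)).den ∣ N := Finset.dvd_prod_of_mem _ (Finset.mem_univ i)
    refine ⟨(φ (lam i)).num.toNat * m, ?_⟩
    have h1 : ((φ (lam i)).num.toNat : ℚ) = (φ (lam i)).num := by
      exact_mod_cast Int.toNat_of_nonneg (Rat.num_pos.2 (hr i)).le
    rw [hm, Nat.cast_mul, Nat.cast_mul, h1, ← mul_assoc, Rat.mul_den_eq_num]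
  choose p hp using hp
  refine ⟨p, fun i ↦ ?_, fun j ↦ ?_⟩
  · have : (0 : ℚ) < p i := by
      rw [hp]
      exact mul_pos (hr i) (by exact_mod_cast hN)
    exact_mod_cast this
  · have : (∑ i, (p i : ℚ)) * β j = ∑ i, (p i : ℚ) * α i j := by
      simp only [hp, ← Finset.sum_mul, hsum', hβ', one_mul, Finset.mul_sum]
      exact Finset.sum_congr rfl fun i _ ↦ by ring
    exact_mod_cast this

/-- Up to a common positive factor, the monomials with affinely independent exponents can be
given arbitrary positive values at a point of the positive orthant. -/
theorem exists_pos_point_of_affineIndependent {n : ℕ} {ι : Type*} [Fintype ι]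
    {α : ι → Fin n →₀ ℕ}
    (hα : AffineIndependent ℝ (fun i => ((fun j => (α i j : ℝ)) : Fin n → ℝ)))
    {z : ι → ℝ} (hz : ∀ i, 0 < z i) :
    ∃ (t : ℝ) (x : Fin n → ℝ), 0 < t ∧ (∀ j, 0 < x j) ∧ ∀ i, t * ∏ j, x j ^ α i j = z i := by
  have hli : LinearIndependent ℝ (fun i ↦ ((fun j ↦ (α i j : ℝ), 1) : (Fin n → ℝ) × ℝ)) := by
    rw [Fintype.linearIndependent_iff]
    intro g hg i
    refine affineIndependent_iff.1 hα Finset.univ g ?_ ?_ i (Finset.mem_univ _)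
    · simpa [Prod.snd_sum] using congrArg Prod.snd hg
    · simpa [Prod.fst_sum] using congrArg Prod.fst hg
  obtain ⟨φ, hφ⟩ := LinearMap.exists_extend
    ((Module.Basis.span hli).constr ℝ fun i ↦ Real.log (z i))
  have hφ' : ∀ i, φ (fun j ↦ (α i j : ℝ), 1) = Real.log (z i) := fun i ↦ by
    have h := LinearMap.congr_fun hφ (Module.Basis.span hli i)
    rw [Module.Basis.constr_basis] at h
    simpa [Module.Basis.span_apply] using h
  refine ⟨Real.exp (φ (0, 1)), fun j ↦ Real.exp (φ (Pi.single j 1, 0)), Real.exp_pos _,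
    fun j ↦ Real.exp_pos _, fun i ↦ ?_⟩
  rw [← Real.exp_log (hz i), ← hφ' i]
  simp only [← Real.exp_nat_mul]
  rw [← Real.exp_sum, ← Real.exp_add]
  congr 1
  have : ((fun j ↦ (α i j : ℝ), 1) : (Fin n → ℝ) × ℝ) =
      (0, 1) + ∑ j, (α i j : ℝ) • (Pi.single j 1, 0) := by
    refine Prod.ext ?_ ?_
    · ext j
      simp [Prod.fst_sum, Finset.sum_apply, Pi.single_apply]
    · simp [Prod.snd_sum]
  rw [this, map_add, map_sum]
  simp only [map_smul, smul_eq_mul]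

theorem prod_pow_prod_pow_eq {n : ℕ} {ι : Type*} [Fintype ι] {α : ι → Fin n →₀ ℕ}
    {β : Fin n →₀ ℕ} {p : ι → ℕ} (hβ : ∀ j, (∑ i, p i) * β j = ∑ i, p i * α i j)
    (x : Fin n → ℝ) :
    (∏ j, x j ^ β j) ^ (∑ i, p i) = ∏ i, (∏ j, x j ^ α i j) ^ p i := by
  simp_rw [← Finset.prod_pow, ← pow_mul]
  rw [Finset.prod_comm]
  refine Finset.prod_congr rfl fun j _ ↦ ?_
  rw [Finset.prod_pow_eq_pow_sum, mul_comm, hβ]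
  simp_rw [mul_comm]

/-- Weighted arithmetic-geometric mean inequality with natural weights. -/
theorem prod_pow_le_arith_mean_pow {ι : Type*} [Fintype ι] {p : ι → ℕ} (hp : 0 < ∑ i, p i)
    {y : ι → ℝ} (hy : ∀ i, 0 ≤ y i) :
    ∏ i, y i ^ p i ≤ ((∑ i, p i * y i) / (∑ i, p i : ℕ)) ^ (∑ i, p i) := by
  have h := Real.geom_mean_le_arith_mean Finset.univ (fun i ↦ (p i : ℝ)) y
    (fun i _ ↦ Nat.cast_nonneg _) (by exact_mod_cast hp) fun i _ ↦ hy i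
  simp only [Real.rpow_natCast] at h
  rw [← Nat.cast_sum] at h
  have hP : 0 ≤ ∏ i, y i ^ p i := Finset.prod_nonneg fun i _ ↦ pow_nonneg (hy i) _
  calc _ = ((∏ i, y i ^ p i) ^ ((∑ i, p i : ℕ) : ℝ)⁻¹) ^ (∑ i, p i) :=
        (Real.rpow_inv_natCast_pow hP hp.ne').symm
    _ ≤ _ := pow_le_pow_left₀ (by positivity) h _

section CircuitPolynomial

variable {n : ℕ} {ι : Type} [Fintype ι] {α : ι → Fin n →₀ ℕ} {β : Fin n →₀ ℕ} {p : ι → ℕ}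
  {c : ι → ℝ} {b : ℝ}

theorem circuit_nonneg_of_pow_le (hα : ∀ i j, Even (α i j)) (hp : ∀ i, 0 < p i)
    (hp0 : 0 < ∑ i, p i) (hβ : ∀ j, (∑ i, p i) * β j = ∑ i, p i * α i j) {u : ℝ}
    (hc : ∀ i, 0 ≤ c i) (hub : -u ≤ b) (hbu : (∃ j, Odd (β j)) → b ≤ u)
    (hle : u ^ (∑ i, p i) ≤ ∏ i, ((∑ i, p i : ℕ) / p i * c i) ^ p i) (x : Fin n → ℝ) :
    0 ≤ ∑ i, c i * ∏ j, x j ^ α i j + b * ∏ j, x j ^ β j := by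
  have hX : ∀ i, 0 ≤ ∏ j, x j ^ α i j := fun i ↦ Finset.prod_nonneg fun j _ ↦ (hα i j).pow_nonneg _
  have hq : ((∑ i, p i : ℕ) : ℝ) ≠ 0 := by exact_mod_cast hp0.ne'
  have key : u * |∏ j, x j ^ β j| ≤ ∑ i, c i * ∏ j, x j ^ α i j := by
    refine le_of_pow_le_pow_left₀ hp0.ne'
      (Finset.sum_nonneg fun i _ ↦ mul_nonneg (hc i) (hX i)) ?_
    calc (u * |∏ j, x j ^ β j|) ^ (∑ i, p i)
        = u ^ (∑ i, p i) * ∏ i, (∏ j, x j ^ α i j) ^ p i := by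
          rw [mul_pow, ← abs_pow, prod_pow_prod_pow_eq hβ,
            abs_of_nonneg (Finset.prod_nonneg fun i _ ↦ pow_nonneg (hX i) _)]
      _ ≤ (∏ i, ((∑ i, p i : ℕ) / p i * c i) ^ p i) * ∏ i, (∏ j, x j ^ α i j) ^ p i :=
          mul_le_mul_of_nonneg_right hle (Finset.prod_nonneg fun i _ ↦ pow_nonneg (hX i) _)
      _ = ∏ i, ((∑ i, p i : ℕ) / p i * c i * ∏ j, x j ^ α i j) ^ p i := by
          simp only [mul_pow, ← Finset.prod_mul_distrib]
      _ ≤ _ := prod_pow_le_arith_mean_pow hp0 fun i ↦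
          mul_nonneg (mul_nonneg (by positivity) (hc i)) (hX i)
      _ = _ := by
          congr 1
          rw [Finset.sum_div]
          refine Finset.sum_congr rfl fun i _ ↦ ?_
          have : (p i : ℝ) ≠ 0 := by exact_mod_cast (hp i).ne'
          field_simp
  have hb : -(u * |∏ j, x j ^ β j|) ≤ b * ∏ j, x j ^ β j := by
    by_cases h : ∃ j, Odd (β j)
    · calc -(u * |∏ j, x j ^ β j|) ≤ -(|b| * |∏ j, x j ^ β j|) :=
            neg_le_neg (mul_le_mul_of_nonneg_right (abs_le.2 ⟨hub, hbu h⟩) (abs_nonneg _))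
        _ = -|b * ∏ j, x j ^ β j| := by rw [abs_mul]
        _ ≤ _ := neg_abs_le _
    · push Not at h
      have : 0 ≤ ∏ j, x j ^ β j :=
        Finset.prod_nonneg fun j _ ↦ (Nat.not_odd_iff_even.1 (h j)).pow_nonneg _
      rw [abs_of_nonneg this, ← neg_mul]
      exact mul_le_mul_of_nonneg_right hub this
  linarith

theorem circuit_sum_nonneg
    (hα : AffineIndependent ℝ (fun i => ((fun j => (α i j : ℝ)) : Fin n → ℝ)))
    (hp0 : 0 < ∑ i, p i) (hβ : ∀ j, (∑ i, p i) * β j = ∑ i, p i * α i j)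
    (hf : ∀ x : Fin n → ℝ, 0 ≤ ∑ i, c i * ∏ j, x j ^ α i j + b * ∏ j, x j ^ β j)
    {z : ι → ℝ} (hz : ∀ i, 0 < z i) {m : ℝ} (hm : 0 ≤ m)
    (hmz : m ^ (∑ i, p i) = ∏ i, z i ^ p i) : 0 ≤ ∑ i, c i * z i + b * m := by
  obtain ⟨t, x, ht, hx, htx⟩ := exists_pos_point_of_affineIndependent hα hz
  have hX : 0 ≤ ∏ j, x j ^ β j := Finset.prod_nonneg fun j _ ↦ pow_nonneg (hx j).le _
  have hmt : m = t * ∏ j, x j ^ β j := by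
    refine (pow_left_inj₀ hm (by positivity) hp0.ne').1 ?_
    rw [hmz, mul_pow, prod_pow_prod_pow_eq hβ, ← Finset.prod_pow_eq_pow_sum,
      ← Finset.prod_mul_distrib]
    simp only [← mul_pow, htx]
  have := mul_nonneg ht.le (hf x)
  rw [mul_add, Finset.mul_sum] at this
  simpa only [hmt, ← htx, mul_left_comm t] using this

theorem circuit_nonneg_neg_of_odd (hα : ∀ i j, Even (α i j)) (hβ : ∃ j, Odd (β j))
    (hf : ∀ x : Fin n → ℝ, 0 ≤ ∑ i, c i * ∏ j, x j ^ α i j + b * ∏ j, x j ^ β j)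
    (x : Fin n → ℝ) : 0 ≤ ∑ i, c i * ∏ j, x j ^ α i j + -b * ∏ j, x j ^ β j := by
  obtain ⟨k, hk⟩ := hβ
  have hflip : ∀ γ : Fin n →₀ ℕ, ∏ j, (Function.update (1 : Fin n → ℝ) k (-1) j * x j) ^ γ j =
      (-1) ^ γ k * ∏ j, x j ^ γ j := fun γ ↦ by
    simp_rw [mul_pow, Finset.prod_mul_distrib]
    rw [Finset.prod_eq_single k (fun j _ hj ↦ by simp [hj]) (by simp)]
    simp
  have := hf fun j ↦ Function.update (1 : Fin n → ℝ) k (-1) j * x j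
  simp only [hflip, (hα _ k).neg_one_pow, hk.neg_one_pow] at this
  simpa using this

theorem circuit_coeff_nonneg
    (hα : AffineIndependent ℝ (fun i => ((fun j => (α i j : ℝ)) : Fin n → ℝ)))
    (hp : ∀ i, 0 < p i) [Nontrivial ι] (hβ : ∀ j, (∑ i, p i) * β j = ∑ i, p i * α i j)
    (hf : ∀ x : Fin n → ℝ, 0 ≤ ∑ i, c i * ∏ j, x j ^ α i j + b * ∏ j, x j ^ β j) (i : ι) :
    0 ≤ c i := by
  classical
  have hlt : p i < ∑ i, p i := by
    obtain ⟨k, hk⟩ := exists_ne i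
    exact Finset.single_lt_sum hk (Finset.mem_univ _) (Finset.mem_univ _) (hp k)
      fun _ _ _ ↦ Nat.zero_le _
  obtain ⟨q, hq⟩ : ∃ q, ∑ i, p i = q + 1 := Nat.exists_eq_succ_of_ne_zero (by omega)
  have key : ∀ r : ℝ, 1 ≤ r → 0 ≤ c i * r + (|b| + ∑ k ∈ {i}ᶜ, |c k|) := fun r hr ↦ by
    have hr0 : 0 < r := by linarith
    have h := circuit_sum_nonneg hα (by omega) hβ hf (z := Function.update 1 i (r ^ (q + 1)))
      (m := r ^ p i) (fun k ↦ by
        rcases eq_or_ne k i with rfl | hk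
        · simpa using pow_pos hr0 _
        · simp [hk]) (by positivity) (by
        rw [Finset.prod_eq_single i (fun k _ hk ↦ by simp [hk]) (by simp), hq]
        simp [← pow_mul, mul_comm])
    rw [Fintype.sum_eq_add_sum_compl i] at h
    have h1 : ∑ k ∈ {i}ᶜ, c k * Function.update (1 : ι → ℝ) i (r ^ (q + 1)) k ≤
        r ^ q * ∑ k ∈ {i}ᶜ, |c k| := by
      rw [Finset.mul_sum]
      refine Finset.sum_le_sum fun k hk ↦ ?_
      have hk : k ≠ i := by simpa using hk
      rw [Function.update_of_ne hk, Pi.one_apply, mul_one]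
      exact (le_abs_self _).trans (le_mul_of_one_le_left (abs_nonneg _) (one_le_pow₀ hr))
    have h2 : b * r ^ p i ≤ r ^ q * |b| := by
      rw [mul_comm]
      exact (mul_le_mul_of_nonneg_left (le_abs_self b) (by positivity)).trans
        (mul_le_mul_of_nonneg_right (pow_le_pow_right₀ hr (by omega)) (abs_nonneg b))
    rw [Function.update_self] at h
    have h3 : 0 ≤ r ^ q * (c i * r + (|b| + ∑ k ∈ {i}ᶜ, |c k|)) := by
      have : c i * r ^ (q + 1) = r ^ q * (c i * r) := by ring
      rw [this] at h
      linarith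
    exact nonneg_of_mul_nonneg_right h3 (by positivity)
  by_contra! hc
  set C := |b| + ∑ k ∈ {i}ᶜ, |c k|
  have hC : 0 ≤ C := by positivity
  have := key (1 + C / -c i) (by have := div_nonneg hC (neg_pos.2 hc).le; linarith)
  have h' : c i * (1 + C / -c i) + C = c i := by
    have := hc.ne
    field_simp
    ring
  linarith

theorem pow_le_of_circuit_sum_nonneg (hp : ∀ i, 0 < p i) (hp0 : 0 < ∑ i, p i)
    (hc : ∀ i, 0 ≤ c i) {u : ℝ} (hu : 0 ≤ u)
    (h : ∀ (z : ι → ℝ) (m : ℝ), (∀ i, 0 < z i) → 0 ≤ m → m ^ (∑ i, p i) = ∏ i, z i ^ p i →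
      u * m ≤ ∑ i, c i * z i) :
    u ^ (∑ i, p i) ≤ ∏ i, ((∑ i, p i : ℕ) / p i * c i) ^ p i := by
  have hq : (0 : ℝ) < (∑ i, p i : ℕ) := by exact_mod_cast hp0
  have hp' : ∀ i, (0 : ℝ) < p i := fun i ↦ by exact_mod_cast hp i
  have key : ∀ ε : ℝ, 0 < ε →
      u ^ (∑ i, p i) ≤ ∏ i, ((∑ i, p i : ℕ) / p i * (c i + ε)) ^ p i := fun ε hε ↦ by
    let y : ι → ℝ := fun i ↦ (∑ i, p i : ℕ) / p i * (c i + ε)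
    have hy : ∀ i, 0 < y i := fun i ↦
      mul_pos (div_pos hq (hp' i)) (add_pos_of_nonneg_of_pos (hc i) hε)
    have hP : 0 < ∏ i, (y i)⁻¹ ^ p i := Finset.prod_pos fun i _ ↦ pow_pos (inv_pos.2 (hy i)) _
    let m := (∏ i, (y i)⁻¹ ^ p i) ^ ((∑ i, p i : ℕ) : ℝ)⁻¹
    have hm : m ^ (∑ i, p i) = ∏ i, (y i)⁻¹ ^ p i := Real.rpow_inv_natCast_pow hP.le hp0.ne'
    have hm0 : 0 ≤ m := Real.rpow_nonneg hP.le _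
    have h1 : u * m ≤ 1 := calc
      u * m ≤ ∑ i, c i * (y i)⁻¹ := h _ m (fun i ↦ inv_pos.2 (hy i)) hm0 hm
      _ ≤ ∑ i, (p i : ℝ) / (∑ i, p i : ℕ) := Finset.sum_le_sum fun i _ ↦ by
          rw [← div_eq_mul_inv, div_le_div_iff₀ (hy i) hq]
          have : p i * y i = (∑ i, p i : ℕ) * (c i + ε) := by
            simp only [y]
            field_simp [(hp' i).ne']
          rw [this]
          nlinarith
      _ = 1 := by rw [← Finset.sum_div, ← Nat.cast_sum, div_self hq.ne']
    have h2 := pow_le_one₀ (n := ∑ i, p i) (mul_nonneg hu hm0) h1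
    rw [mul_pow, hm] at h2
    simp only [inv_pow, Finset.prod_inv_distrib] at h2
    rwa [← div_eq_mul_inv, div_le_one (Finset.prod_pos fun i _ ↦ pow_pos (hy i) _)] at h2
  have hcont : Filter.Tendsto
      (fun ε : ℝ ↦ ∏ i, ((∑ i, p i : ℕ) / p i * (c i + ε)) ^ p i) (nhdsWithin 0 (Set.Ioi 0))
      (nhds (∏ i, ((∑ i, p i : ℕ) / p i * (c i + 0)) ^ p i)) :=
    (Continuous.tendsto (by fun_prop) 0).mono_left nhdsWithin_le_nhds
  simp only [add_zero] at hcont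
  exact ge_of_tendsto hcont (Filter.eventually_of_mem self_mem_nhdsWithin fun ε hε ↦ key ε hε)

/-- A circuit polynomial is nonnegative iff its outer coefficients are nonnegative and its inner
coefficient is bounded by the circuit number. -/
theorem circuit_nonneg_iff [Nontrivial ι] (hα : ∀ i j, Even (α i j))
    (hind : AffineIndependent ℝ (fun i => ((fun j => (α i j : ℝ)) : Fin n → ℝ)))
    (hp : ∀ i, 0 < p i) (hβ : ∀ j, (∑ i, p i) * β j = ∑ i, p i * α i j) :
    (∀ x : Fin n → ℝ, 0 ≤ ∑ i, c i * ∏ j, x j ^ α i j + b * ∏ j, x j ^ β j) ↔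
      ∃ u : ℝ, 0 ≤ u ∧ (∀ i, 0 ≤ c i) ∧ -u ≤ b ∧ ((∃ j, Odd (β j)) → b ≤ u) ∧
        u ^ (∑ i, p i) ≤ ∏ i, ((∑ i, p i : ℕ) / p i * c i) ^ p i := by
  have hp0 : 0 < ∑ i, p i := Finset.sum_pos (fun i _ ↦ hp i) Finset.univ_nonempty
  constructor
  · intro hf
    have hc := circuit_coeff_nonneg hind hp hβ hf
    have hs : ∀ z : ι → ℝ, (∀ i, 0 < z i) → 0 ≤ ∑ i, c i * z i := fun z hz ↦
      Finset.sum_nonneg fun i _ ↦ mul_nonneg (hc i) (hz i).le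
    by_cases hodd : ∃ j, Odd (β j)
    · refine ⟨|b|, abs_nonneg b, hc, neg_abs_le b, fun _ ↦ le_abs_self b,
        pow_le_of_circuit_sum_nonneg hp hp0 hc (abs_nonneg b) fun z m hz hm hmz ↦ ?_⟩
      have h1 := circuit_sum_nonneg hind hp0 hβ hf hz hm hmz
      have h2 := circuit_sum_nonneg hind hp0 hβ (circuit_nonneg_neg_of_odd hα hodd hf) hz hm hmz
      rcases abs_cases b with ⟨hb, -⟩ | ⟨hb, -⟩ <;> rw [hb] <;> linarith
    · refine ⟨max 0 (-b), le_max_left _ _, hc, neg_le.1 (le_max_right _ _),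
        fun h ↦ absurd h hodd,
        pow_le_of_circuit_sum_nonneg hp hp0 hc (le_max_left _ _) fun z m hz hm hmz ↦ ?_⟩
      have h1 := circuit_sum_nonneg hind hp0 hβ hf hz hm hmz
      have h2 := hs z hz
      rcases max_cases 0 (-b) with ⟨hb, -⟩ | ⟨hb, -⟩ <;> rw [hb] <;> linarith
  · rintro ⟨u, -, hc, hub, hbu, hle⟩
    exact circuit_nonneg_of_pow_le hα hp hp0 hβ hc hub hbu hle

end CircuitPolynomial

theorem isSOCRep_suppCone {n : ℕ} {A : Finset (Fin n →₀ ℕ)} (hA : IsCircuit n A) :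
    IsSOCRep (SuppCone n A) := by
  obtain ⟨k, α, β, lam, hk, -, hα, hind, hpos, hsum, hβ, hβα, rfl⟩ := hA
  obtain ⟨p, hp, hpβ⟩ := exists_nat_weights hind hpos hsum hβ
  have : Nontrivial (Fin (k + 1)) := Fin.nontrivial_iff_two_le.2 (by omega)
  have hinj : Function.Injective α := fun i j hij ↦ hind.injective (by simp [hij])
  let ι := Fin (k + 1)
  let Y : (ι → ℝ) × ℝ × ℝ →ₗ[ℝ] ι → ℝ := LinearMap.fst ℝ _ _
  let B : (ι → ℝ) × ℝ × ℝ →ₗ[ℝ] ℝ := LinearMap.fst ℝ _ _ ∘ₗ LinearMap.snd ℝ _ _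
  let U : (ι → ℝ) × ℝ × ℝ →ₗ[ℝ] ℝ := LinearMap.snd ℝ _ _ ∘ₗ LinearMap.snd ℝ _ _
  let y : ι → (ι → ℝ) × ℝ × ℝ →ₗ[ℝ] ℝ := fun i ↦
    (((∑ i, p i : ℕ) : ℝ) / p i) • LinearMap.proj i ∘ₗ Y
  let F : (ι → ℝ) × ℝ × ℝ →ₗ[ℝ] MvPolynomial (Fin n) ℝ :=
    ∑ i, monomial (α i) ∘ₗ LinearMap.proj i ∘ₗ Y + monomial β ∘ₗ B
  have hF : ∀ c b u, F (c, b, u) = ∑ i, monomial (α i) (c i) + monomial β b := fun c b u ↦ by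
    simp [F, Y, B]
  have heval : ∀ c b u x, eval x (F (c, b, u)) =
      ∑ i, c i * ∏ j, x j ^ α i j + b * ∏ j, x j ^ β j := fun c b u x ↦ by
    simp [hF, eval_monomial, Finsupp.prod_fintype]
    rfl
  have hodd : IsSOCRep {v | (∃ j, Odd (β j)) → B v ≤ U v} := by
    by_cases h : ∃ j, Odd (β j)
    · simpa [h] using IsSOCRep.setOf_nonneg (U - B)
    · simpa [h] using IsSOCRep.setOf_nonneg (0 : (ι → ℝ) × ℝ × ℝ →ₗ[ℝ] ℝ)
  convert ((IsSOCRep.setOf_pow_le_prod_pow U y hp rfl).inter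
    ((IsSOCRep.setOf_nonneg (U + B)).inter hodd)).image F using 1
  have hcone : ∀ c b u, (c, b, u) ∈ {v | 0 ≤ U v ∧ (∀ i, 0 ≤ y i v) ∧
        U v ^ (∑ i, p i) ≤ ∏ i, y i v ^ p i} ∩ ({v | 0 ≤ (U + B) v} ∩
          {v | (∃ j, Odd (β j)) → B v ≤ U v}) ↔
      0 ≤ u ∧ (∀ i, 0 ≤ c i) ∧ -u ≤ b ∧ ((∃ j, Odd (β j)) → b ≤ u) ∧
        u ^ (∑ i, p i) ≤ ∏ i, ((∑ i, p i : ℕ) / p i * c i) ^ p i := fun c b u ↦ by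
    have hw : ∀ i, (0 : ℝ) < ((∑ i, p i : ℕ) : ℝ) / p i := fun i ↦ by
      have h1 := hp i
      have h2 : 0 < ∑ i, p i := Finset.sum_pos (fun i _ ↦ hp i) Finset.univ_nonempty
      positivity
    have hy : ∀ i, 0 ≤ y i (c, b, u) ↔ 0 ≤ c i := fun i ↦ mul_nonneg_iff_of_pos_left (hw i)
    have hub : 0 ≤ (U + B) (c, b, u) ↔ -u ≤ b := neg_le_iff_add_nonneg'.symm
    change (0 ≤ u ∧ (∀ i, 0 ≤ y i (c, b, u)) ∧ _) ∧ 0 ≤ (U + B) (c, b, u) ∧ _ ↔ _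
    simp only [hy, hub]
    change (0 ≤ u ∧ (∀ i, 0 ≤ c i) ∧ u ^ (∑ i, p i) ≤ ∏ i, ((∑ i, p i : ℕ) / p i * c i) ^ p i) ∧
      -u ≤ b ∧ ((∃ j, Odd (β j)) → b ≤ u) ↔ _
    tauto
  ext f
  constructor
  · rintro ⟨hf, hnn⟩
    have hfF : ∀ u, f = F (fun i ↦ coeff (α i) f, coeff β f, u) := fun u ↦ by
      rw [hF]
      conv_lhs => rw [f.as_sum, Finset.sum_subset hf (by simp +contextual)]
      rw [Finset.sum_insert (by simpa using hβα), Finset.sum_image hinj.injOn, add_comm]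
    obtain ⟨u, hu⟩ := (circuit_nonneg_iff (c := fun i ↦ coeff (α i) f) (b := coeff β f)
      hα hind hp hpβ).1 fun x ↦ by rw [← heval _ _ 0, ← hfF]; exact hnn x
    exact ⟨_, (hcone _ _ u).2 hu, (hfF u).symm⟩
  · rintro ⟨⟨c, b, u⟩, h, rfl⟩
    refine ⟨?_, fun x ↦ ?_⟩
    · rw [hF]
      refine support_add.trans (Finset.union_subset ((support_sum).trans ?_) ?_)
      · refine Finset.biUnion_subset.2 fun i _ ↦ support_monomial_subset.trans ?_
        simp
      · exact support_monomial_subset.trans (by simp)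
    · rw [heval]
      exact (circuit_nonneg_iff hα hind hp hpβ).2 ⟨u, (hcone c b u).1 h⟩ x

theorem sum_mem_suppCone {n : ℕ} {A : Finset (Fin n →₀ ℕ)} {κ : Type*} {s : Finset κ}
    {g : κ → MvPolynomial (Fin n) ℝ} (hg : ∀ i ∈ s, g i ∈ SuppCone n A) :
    ∑ i ∈ s, g i ∈ SuppCone n A := by
  classical
  refine ⟨support_sum.trans (Finset.biUnion_subset.2 fun i hi ↦ (hg i hi).1), fun x ↦ ?_⟩
  rw [map_sum]
  exact Finset.sum_nonneg fun i hi ↦ (hg i hi).2 x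

theorem isSOCRep_soncCone (n d : ℕ) : IsSOCRep (SONCCone n d) := by
  let C : Set (Finset (Fin n →₀ ℕ)) :=
    {A | IsCircuit n A ∧ ∀ a ∈ A, (a.sum fun _ e => e) ≤ 2 * d}
  have hC : C.Finite := by
    have hD := Finsupp.finite_of_degree_le (σ := Fin n) (2 * d)
    refine (Finset.finite_toSet hD.toFinset.powerset).subset fun A hA ↦ ?_
    simp only [Finset.coe_powerset, Set.mem_preimage, Set.mem_powerset_iff]
    intro a ha
    rw [Finset.mem_coe, Set.Finite.mem_toFinset, Set.mem_ofPred_eq]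
    exact hA.2 a ha
  have := hC.fintype
  convert IsSOCRep.sum (S := fun A : C ↦ SuppCone n A.1) fun A ↦ isSOCRep_suppCone A.2.1 using 1
  ext f
  constructor
  · rintro ⟨r, g, hg, rfl⟩
    choose A hA hAd hgA using hg
    classical
    refine ⟨fun a ↦ ∑ i with (⟨A i, hA i, hAd i⟩ : C) = a, g i, fun a ↦ sum_mem_suppCone ?_,
      (Finset.sum_fiberwise _ _ _).symm⟩
    rintro i hi
    rw [← (Finset.mem_filter.1 hi).2]
    exact hgA i
  · rintro ⟨g, hg, rfl⟩
    let e := Fintype.equivFin C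
    exact ⟨Fintype.card C, g ∘ e.symm, fun i ↦ ⟨_, (e.symm i).2.1, (e.symm i).2.2, hg _⟩,
      (e.symm.sum_comp g).symm⟩

theorem eval_nonneg_of_mem_soncCone {n d : ℕ} {f : MvPolynomial (Fin n) ℝ}
    (hf : f ∈ SONCCone n d) (x : Fin n → ℝ) : 0 ≤ eval x f := by
  obtain ⟨r, g, hg, rfl⟩ := hf
  rw [map_sum]
  refine Finset.sum_nonneg fun i _ ↦ ?_
  obtain ⟨A, -, -, h⟩ := hg i
  exact h.2 x

theorem X_sub_C_sq_mem_soncCone {n d : ℕ} (hd : 1 ≤ d) (j : Fin n) (t : ℝ) :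
    (X j - C t) ^ 2 ∈ SONCCone n d := by
  classical
  let α : Fin 2 → Fin n →₀ ℕ := ![0, Finsupp.single j 2]
  have hA : insert (Finsupp.single j 1) (Finset.univ.image α) =
      {Finsupp.single j 1, 0, Finsupp.single j 2} := by
    simp [α, Fin.univ_succ]
  refine ⟨1, fun _ ↦ (X j - C t) ^ 2, fun _ ↦ ⟨insert (Finsupp.single j 1) (Finset.univ.image α),
    ⟨1, α, Finsupp.single j 1, fun _ ↦ 1 / 2, le_rfl, Fin.pos j, ?_, ?_, by norm_num,
      by norm_num, ?_, ?_, ?_⟩, ?_, ?_, fun x ↦ ?_⟩, by simp⟩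
  · intro i k
    fin_cases i
    · simp [α]
    · rcases eq_or_ne j k with rfl | h <;> simp [α, *]
  · have hne : (0 : Fin n → ℝ) ≠ Pi.single j 2 := fun h ↦ by simpa using congrFun h j
    have hα : (fun i k ↦ (α i k : ℝ)) = ![0, Pi.single j 2] := by
      funext i k
      fin_cases i
      · simp [α]
      · rcases eq_or_ne k j with rfl | h <;> simp [α, *]
    rw [hα]
    exact affineIndependent_of_ne ℝ hne
  · intro k
    rcases eq_or_ne j k with rfl | h <;> simp [α, *]
  · rintro ⟨i, hi⟩
    have := DFunLike.congr_fun hi j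
    fin_cases i <;> simp [α] at this
  · congr
  · rw [hA]
    simp
    omega
  · rw [hA]
    have : (X j - C t) ^ 2 = monomial (Finsupp.single j 2) 1 +
        monomial (Finsupp.single j 1) (-2 * t) + monomial 0 (t ^ 2) := by
      have h2 : monomial (Finsupp.single j 2) (1 : ℝ) = X j ^ 2 := (X_pow_eq_monomial ..).symm
      have h1 : monomial (Finsupp.single j 1) (-2 * t) = C (-2 * t) * X j :=
        (C_mul_X_eq_monomial ..).symm
      rw [h2, h1, ← C_apply]
      simp only [map_mul, map_neg, map_pow, map_ofNat]
      ring
    rw [this]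
    refine support_add.trans (Finset.union_subset (support_add.trans
      (Finset.union_subset ?_ ?_)) ?_)
    all_goals exact support_monomial_subset.trans (by simp)
  · rw [map_pow]
    exact sq_nonneg _

theorem not_hasLift_orthant {n d : ℕ} (hn : 1 ≤ n) (hd : 1 ≤ d) (m : ℕ) :
    ¬ HasLift (Orthant m) (SONCCone n d) := by
  rintro ⟨H, π, h⟩
  let j : Fin n := ⟨0, hn⟩
  have hlift : ∀ t : ℝ, ∃ y, (y ∈ Orthant m ∧ y ∈ H) ∧ π y = (X j - C t) ^ 2 := fun t ↦ by
    have := X_sub_C_sq_mem_soncCone hd j t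
    rwa [h] at this
  choose y hy hπ using hlift
  obtain ⟨s, t, hst, hz⟩ := Finite.exists_ne_map_eq_of_infinite fun (t : ℝ) i ↦ y t i = 0
  obtain ⟨ε, hε, hle⟩ : ∃ ε : ℝ, 0 < ε ∧ ∀ i, ε * y t i ≤ y s i := by
    have : ∀ i, ∀ᶠ ε : ℝ in nhdsWithin 0 (Set.Ioi 0), ε * y t i ≤ y s i := fun i ↦ by
      rcases ((hy s).1 i).eq_or_lt with h0 | h0
      · have : y t i = 0 := (congrFun hz i).mp h0.symm
        simp [this, ← h0]
      · have hc : Filter.Tendsto (fun ε : ℝ ↦ ε * y t i) (nhdsWithin 0 (Set.Ioi 0))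
            (nhds (0 * y t i)) :=
          (Continuous.tendsto (by fun_prop) 0).mono_left nhdsWithin_le_nhds
        rw [zero_mul] at hc
        exact (hc.eventually_lt_const h0).mono fun _ h ↦ h.le
    obtain ⟨ε, h1, h2⟩ := ((Filter.eventually_all.2 this).and self_mem_nhdsWithin).exists
    exact ⟨ε, h2, h1⟩
  have hmem : AffineMap.lineMap (y s) (y t) (-ε) ∈ Orthant m ∩ (H : Set (Fin m → ℝ)) := by
    refine ⟨fun i ↦ ?_, AffineMap.lineMap_mem _ (hy s).2 (hy t).2⟩
    have h1 := mul_nonneg hε.le ((hy s).1 i)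
    have h2 := hle i
    simp [AffineMap.lineMap_apply_module]
    linarith
  have hS : π (AffineMap.lineMap (y s) (y t) (-ε)) ∈ SONCCone n d := by
    rw [h]
    exact ⟨_, hmem, rfl⟩
  have hpos := eval_nonneg_of_mem_soncCone hS fun _ ↦ s
  have hneg : 0 < ε * (s - t) ^ 2 := mul_pos hε (sq_pos_of_ne_zero (sub_ne_zero.2 hst))
  simp [AffineMap.lineMap_apply_module, hπ, smul_eval] at hpos
  linarith

theorem HasLift.orthant_of_psdTuple_one {V : Type*} [AddCommGroup V] [Module ℝ V] {S : Set V}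
    {m : ℕ} (h : HasLift (PSDTuple 1 m) S) : HasLift (Orthant m) S := by
  obtain ⟨H, π, rfl⟩ := h
  let e : (Fin m → ℝ) →ₗ[ℝ] Fin m → Matrix (Fin 1) (Fin 1) ℝ :=
    LinearMap.pi fun i ↦ (LinearMap.proj i).smulRight 1
  have he : ∀ x, e x ∈ PSDTuple 1 m ↔ x ∈ Orthant m := fun x ↦ by
    refine forall_congr' fun i ↦ ⟨fun h ↦ by simpa [e] using h.diag_nonneg (i := 0), fun h ↦ ?_⟩
    exact Matrix.PosSemidef.one.smul h
  have hsurj : ∀ A, ∃ x, e x = A := fun A ↦ ⟨fun i ↦ A i 0 0, by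
    ext i a b
    fin_cases a
    fin_cases b
    simp [e]⟩
  refine ⟨H.comap e.toAffineMap, π ∘ₗ e, ?_⟩
  ext v
  constructor
  · rintro ⟨A, ⟨hA, hAH⟩, rfl⟩
    obtain ⟨x, rfl⟩ := hsurj A
    exact ⟨x, ⟨(he x).1 hA, hAH⟩, rfl⟩
  · rintro ⟨x, ⟨hx, hxH⟩, rfl⟩
    exact ⟨e x, ⟨(he x).2 hx, hxH⟩, rfl⟩

/-- Theorem 2.14: `sxdeg(C_{n,2d}) = 2`; the SONC cone has an `(𝒮₊²)^m`-lift for some `m`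
(a second-order cone extended formulation) but no `ℝ₊^m`-lift for any `m`. -/
theorem stmt_9 (n d : ℕ) (hn : 1 ≤ n) (hd : 1 ≤ d) :
    sxdeg (SONCCone n d) = (2 : ℕ∞) ∧
    (∃ m : ℕ, HasLift (PSDTuple 2 m) (SONCCone n d)) ∧
    (∀ m : ℕ, ¬ HasLift (Orthant m) (SONCCone n d)) := by
  obtain ⟨m, hm⟩ := (isSOCRep_soncCone n d).hasLift
  refine ⟨le_antisymm (sInf_le ⟨2, m, rfl, hm⟩) (le_sInf ?_), ⟨m, hm⟩, not_hasLift_orthant hn hd⟩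
  rintro _ ⟨k, m, rfl, hk⟩
  by_contra! hlt
  have hk2 : k < 2 := by exact_mod_cast hlt
  interval_cases k
  · obtain ⟨H, π, h⟩ := hk
    have hsub : (SONCCone n d).Subsingleton := by
      rw [h]
      exact Set.subsingleton_of_subsingleton.image π
    have h01 := congrArg (eval 0) (hsub (X_sub_C_sq_mem_soncCone hd ⟨0, hn⟩ 0)
      (X_sub_C_sq_mem_soncCone hd ⟨0, hn⟩ 1))
    simp at h01
  · exact not_hasLift_orthant hn hd m hk.orthant_of_psdTuple_one
end

section
/- For all n,d ∈ ℕ: Σ_{n,2d} + C_{n,2d} ≠ P_{n,2d} if and only if n ≥ 2, d ≥ 2 and (n,d) ≠ (2,2). -/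
open MvPolynomial

theorem eval_eq_sum_of_support_subset {n : ℕ} {A : Finset (Fin n →₀ ℕ)}
    {g : MvPolynomial (Fin n) ℝ} (hg : g.support ⊆ A) (u : Fin n → ℝ) :
    eval u g = ∑ a ∈ A, coeff a g * ∏ i, u i ^ a i := by
  rw [eval_eq']
  refine Finset.sum_subset hg fun a _ ha => ?_
  rw [notMem_support_iff.mp ha, zero_mul]

/-- The logarithmic derivatives of a nonnegative polynomial vanish at its zeros. -/
theorem sum_coeff_mul_exponent_eq_zero {n : ℕ} {A : Finset (Fin n →₀ ℕ)}
    {g : MvPolynomial (Fin n) ℝ} (hg : g ∈ SuppCone n A) {u : Fin n → ℝ}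
    (hu : eval u g = 0) (j : Fin n) :
    ∑ a ∈ A, coeff a g * (∏ i, u i ^ a i) * a j = 0 := by
  have key : ∀ t : ℝ, eval (fun i => u i * Pi.mulSingle (M := fun _ => ℝ) j t i) g =
      ∑ a ∈ A, coeff a g * (∏ i, u i ^ a i) * t ^ a j := by
    intro t
    rw [eval_eq_sum_of_support_subset hg.1]
    refine Finset.sum_congr rfl fun a _ => ?_
    have : ∏ i, (Pi.mulSingle (M := fun _ => ℝ) j t i) ^ a i = t ^ a j := by
      rw [Finset.prod_eq_single j]
      · simp
      · intro b _ hb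
        simp [Pi.mulSingle_eq_of_ne hb]
      · simp
    simp only [mul_pow, Finset.prod_mul_distrib, this]
    ring
  have hd : HasDerivAt (fun t : ℝ => ∑ a ∈ A, coeff a g * (∏ i, u i ^ a i) * t ^ a j)
      (∑ a ∈ A, coeff a g * (∏ i, u i ^ a i) * a j) 1 := by
    have := HasDerivAt.fun_sum (u := A)
      (A := fun a (t : ℝ) => coeff a g * (∏ i, u i ^ a i) * t ^ a j)
      (A' := fun a => coeff a g * (∏ i, u i ^ a i) * a j) (x := (1 : ℝ)) (fun a _ => by
        simpa using (hasDerivAt_pow (a j) (1 : ℝ)).const_mul (coeff a g * (∏ i, u i ^ a i)))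
    exact this
  refine IsLocalMin.hasDerivAt_eq_zero (Filter.Eventually.of_forall fun t => ?_) hd
  rw [← key, ← key]
  have h1 : (fun i => u i * Pi.mulSingle (M := fun _ => ℝ) j 1 i) = u := by
    funext i; simp
  rw [h1, hu]
  exact hg.2 _

/-- A nonnegative circuit polynomial whose zeros separate exponents is zero. -/
theorem SuppCone.eq_zero_of_isCircuit {n : ℕ} {A : Finset (Fin n →₀ ℕ)} (hA : IsCircuit n A)
    {g : MvPolynomial (Fin n) ℝ} (hg : g ∈ SuppCone n A) {Z : Set (Fin n → ℝ)}
    (hone : 1 ∈ Z)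
    (hsep : ∀ a b : Fin n →₀ ℕ, (∀ u ∈ Z, ∏ i, u i ^ a i = ∏ i, u i ^ b i) → a = b)
    (hz : ∀ u ∈ Z, eval u g = 0) : g = 0 := by
  obtain ⟨k, α, β, lam, -, -, -, hind, hlam, hlam1, hβ, hβα, rfl⟩ := hA
  have hinj : Function.Injective α := by
    intro i j hij
    apply hind.injective
    simp [hij]
  have hβi : β ∉ Finset.image α Finset.univ := by
    simpa using hβα
  have split : ∀ φ : (Fin n →₀ ℕ) → ℝ,
      ∑ a ∈ insert β (Finset.image α Finset.univ), φ a = φ β + ∑ i, φ (α i) := by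
    intro φ
    rw [Finset.sum_insert hβi, Finset.sum_image fun i _ j _ h => hinj h]
  have main : ∀ u ∈ Z, ∀ i, coeff (α i) g * (∏ l, u l ^ α i l) +
      coeff β g * (∏ l, u l ^ β l) * lam i = 0 := by
    intro u hu
    have h0 := hz u hu
    have h1 := sum_coeff_mul_exponent_eq_zero hg h0
    rw [eval_eq_sum_of_support_subset hg.1, split] at h0
    simp only [split] at h1
    rw [affineIndependent_iff] at hind
    intro i
    refine hind Finset.univ (fun i => coeff (α i) g * (∏ l, u l ^ α i l) +
      coeff β g * (∏ l, u l ^ β l) * lam i) ?_ ?_ i (Finset.mem_univ i)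
    · rw [Finset.sum_add_distrib, ← Finset.mul_sum, hlam1]
      linarith
    · funext j
      rw [Finset.sum_apply]
      simp only [Pi.smul_apply, smul_eq_mul, add_mul, Finset.sum_add_distrib, Pi.zero_apply]
      rw [← h1 j, hβ j, Finset.mul_sum, add_comm]
      congr 1
      exact Finset.sum_congr rfl fun i _ => by ring
  have hc : coeff β g = 0 := by
    by_contra hc
    refine hβα ⟨0, hsep _ _ fun u hu => ?_⟩
    have e1 := main 1 hone 0
    have e2 := main u hu 0
    simp only [Pi.one_apply, one_pow, Finset.prod_const_one, mul_one] at e1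
    have e3 : coeff β g * lam 0 * ((∏ l, u l ^ β l) - ∏ l, u l ^ α 0 l) = 0 := by
      linear_combination e2 - (∏ l, u l ^ α 0 l) * e1
    have := (mul_eq_zero.mp e3).resolve_left (mul_ne_zero hc (hlam 0).ne')
    linarith
  ext a
  by_contra ha
  have : a ∈ insert β (Finset.image α Finset.univ) := hg.1 (mem_support_iff.mpr ha)
  rw [Finset.mem_insert, Finset.mem_image] at this
  rcases this with rfl | ⟨i, -, rfl⟩
  · exact ha hc
  · have := main 1 hone i
    simp only [Pi.one_apply, one_pow, Finset.prod_const_one, mul_one, hc, zero_mul,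
      add_zero] at this
    exact ha this

theorem SOSCone.eval_nonneg {n d : ℕ} {f : MvPolynomial (Fin n) ℝ} (hf : f ∈ SOSCone n d)
    (x : Fin n → ℝ) : 0 ≤ eval x f := by
  obtain ⟨-, r, g, rfl⟩ := hf
  simp only [map_sum, map_pow]
  exact Finset.sum_nonneg fun i _ => sq_nonneg _

/-- If the zeros of `f` separate exponents, then `f` can only be in `Σ + C` by being
a sum of squares. -/
theorem mem_SOSCone_of_mem_add {n d : ℕ} {f : MvPolynomial (Fin n) ℝ}
    (hf : ∃ g ∈ SOSCone n d, ∃ h ∈ SONCCone n d, f = g + h) {Z : Set (Fin n → ℝ)}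
    (hone : 1 ∈ Z)
    (hsep : ∀ a b : Fin n →₀ ℕ, (∀ u ∈ Z, ∏ i, u i ^ a i = ∏ i, u i ^ b i) → a = b)
    (hz : ∀ u ∈ Z, eval u f = 0) : f ∈ SOSCone n d := by
  obtain ⟨g, hg, h, ⟨r, q, hq, rfl⟩, rfl⟩ := hf
  have hq0 : ∀ i, q i = 0 := by
    intro i
    obtain ⟨A, hA, -, hqA⟩ := hq i
    refine SuppCone.eq_zero_of_isCircuit hA hqA hone hsep fun u hu => ?_
    have h0 := hz u hu
    have hnn : ∀ j, 0 ≤ eval u (q j) := fun j => by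
      obtain ⟨_, _, _, h⟩ := hq j
      exact h.2 u
    rw [map_add, map_sum] at h0
    have h1 := SOSCone.eval_nonneg hg u
    have h2 := Finset.single_le_sum (f := fun j => eval u (q j)) (fun j _ => hnn j)
      (Finset.mem_univ i)
    exact le_antisymm (h2.trans (by linarith)) (hnn i)
  simpa [hq0] using hg

theorem totalDegree_le_of_mem_SONCCone {n d : ℕ} {f : MvPolynomial (Fin n) ℝ}
    (hf : f ∈ SONCCone n d) : f.totalDegree ≤ 2 * d := by
  obtain ⟨r, q, hq, rfl⟩ := hf
  refine totalDegree_finsetSum_le fun i _ => ?_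
  obtain ⟨A, -, hA, hqA⟩ := hq i
  exact Finset.sup_le fun a ha => hA a (hqA.1 ha)

theorem add_subset_PosCone (n d : ℕ) :
    {f | ∃ g ∈ SOSCone n d, ∃ h ∈ SONCCone n d, f = g + h} ⊆ PosCone n d Set.univ := by
  rintro _ ⟨g, hg, h, hh, rfl⟩
  refine ⟨(totalDegree_add _ _).trans (max_le hg.1 (totalDegree_le_of_mem_SONCCone hh)),
    fun x _ => ?_⟩
  obtain ⟨r, q, hq, rfl⟩ := hh
  rw [map_add, map_sum]
  refine add_nonneg (SOSCone.eval_nonneg hg x) (Finset.sum_nonneg fun i _ => ?_)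
  obtain ⟨_, _, _, h⟩ := hq i
  exact h.2 x

theorem add_eq_PosCone_of_forall_sos {n d : ℕ}
    (h : ∀ f ∈ PosCone n d Set.univ,
      ∃ (r : ℕ) (g : Fin r → MvPolynomial (Fin n) ℝ), f = ∑ i, g i ^ 2) :
    {f | ∃ g ∈ SOSCone n d, ∃ h ∈ SONCCone n d, f = g + h} = PosCone n d Set.univ :=
  (add_subset_PosCone n d).antisymm fun f hf =>
    ⟨f, ⟨hf.1, h f hf⟩, 0, ⟨0, Fin.elim0, fun i => i.elim0, by simp⟩, by simp⟩

theorem MvPolynomial.IsHomogeneous.eval_smul {σ : Type*} {φ : MvPolynomial σ ℝ} {m : ℕ}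
    (hφ : φ.IsHomogeneous m) (t : ℝ) (v : σ → ℝ) : eval (t • v) φ = t ^ m * eval v φ := by
  rw [eval_eq, eval_eq, Finset.mul_sum]
  refine Finset.sum_congr rfl fun a ha => ?_
  have hdeg : ∑ i ∈ a.support, a i = m := by
    have h : a.degree = m := by
      rw [Finsupp.degree_eq_weight_one]
      exact hφ (mem_support_iff.mp ha)
    exact h
  simp only [Pi.smul_apply, smul_eq_mul, mul_pow, Finset.prod_mul_distrib,
    Finset.prod_pow_eq_pow_sum, hdeg]
  ring

theorem Polynomial.degree_le_of_eval_le {p q : Polynomial ℝ} (h0 : ∀ x, 0 ≤ p.eval x)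
    (h : ∀ x, p.eval x ≤ q.eval x) : p.degree ≤ q.degree := by
  by_contra! hlt
  have ho := Polynomial.isLittleO_atTop_of_degree_lt q p hlt
  have hp : p ≠ 0 := Polynomial.ne_zero_of_degree_gt hlt
  obtain ⟨x, hx1, hx2⟩ := ((ho.bound (c := 1 / 2) (by norm_num)).and
    (Polynomial.eventually_atTop_not_isRoot p hp)).exists
  rw [Real.norm_of_nonneg (h0 x), Real.norm_of_nonneg ((h0 x).trans (h x))] at hx1
  exact hx2 (le_antisymm (by linarith [h x]) (h0 x))

theorem Polynomial.natDegree_le_of_sq_le {p : Polynomial ℝ} {K : ℝ} {d : ℕ}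
    (h : ∀ t, p.eval t ^ 2 ≤ K * (1 + t ^ 2) ^ d) : p.natDegree ≤ d := by
  have h1 : (p ^ 2).degree ≤ (Polynomial.C K * (1 + Polynomial.X ^ 2) ^ d).degree :=
    Polynomial.degree_le_of_eval_le (fun x => by simpa using sq_nonneg _)
      (fun x => by simpa using h x)
  have h2 := Polynomial.natDegree_le_natDegree h1
  have h3 : (Polynomial.C K * (1 + Polynomial.X ^ 2) ^ d).natDegree ≤ d * 2 := by
    compute_degree
  rw [Polynomial.natDegree_pow] at h2
  omega

theorem totalDegree_le_of_sq_le {σ : Type*} {g : MvPolynomial σ ℝ} {d : ℕ}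
    (h : ∀ v : σ → ℝ, ∃ K : ℝ, ∀ t : ℝ, eval (t • v) g ^ 2 ≤ K * (1 + t ^ 2) ^ d) :
    g.totalDegree ≤ d := by
  have hom : ∀ k, d < k → homogeneousComponent k g = 0 := by
    intro k hk
    rcases lt_or_ge g.totalDegree k with hlt | hle
    · exact homogeneousComponent_eq_zero _ _ hlt
    refine funext fun v => ?_
    obtain ⟨K, hK⟩ := h v
    set p : Polynomial ℝ := ∑ i ∈ Finset.range (g.totalDegree + 1),
      Polynomial.monomial i (eval v (homogeneousComponent i g)) with hp
    have hev : ∀ t, p.eval t = eval (t • v) g := by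
      intro t
      conv_rhs => rw [← sum_homogeneousComponent g, map_sum]
      rw [hp, Polynomial.eval_finsetSum]
      refine Finset.sum_congr rfl fun i _ => ?_
      rw [Polynomial.eval_monomial, (homogeneousComponent_isHomogeneous i g).eval_smul, mul_comm]
    have hdeg : p.natDegree ≤ d := Polynomial.natDegree_le_of_sq_le fun t => by
      rw [hev]; exact hK t
    have hc : p.coeff k = eval v (homogeneousComponent k g) := by
      rw [hp, Polynomial.finsetSum_coeff]
      simp [Polynomial.coeff_monomial, hle]
    rw [← hc, Polynomial.coeff_eq_zero_of_natDegree_lt (by omega), map_zero]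
  refine Finset.sup_le fun a ha => ?_
  by_contra! hlt
  have := congrArg (coeff a) (hom _ hlt)
  rw [coeff_homogeneousComponent, if_pos (by rfl), coeff_zero] at this
  exact mem_support_iff.mp ha this

theorem exists_coeff_two {f : MvPolynomial (Fin 2) ℝ} {k : ℕ} (hf : f.totalDegree ≤ k) :
    ∃ c : ℕ → ℕ → ℝ, (∀ i j, k < i + j → c i j = 0) ∧
      ∀ u, eval u f = ∑ i ∈ Finset.range (k + 1), ∑ j ∈ Finset.range (k + 1),
        c i j * (u 0 ^ i * u 1 ^ j) := by
  let e : ℕ × ℕ → Fin 2 →₀ ℕ := fun p => Finsupp.equivFunOnFinite.symm ![p.1, p.2]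
  have he : Function.Injective e := fun p q hpq => by
    have := Finsupp.equivFunOnFinite.symm.injective hpq
    exact Prod.ext (congrFun this 0) (congrFun this 1)
  have hdeg : ∀ p, (e p).degree = p.1 + p.2 := fun p => by
    simp [Finsupp.degree_eq_sum, Fin.sum_univ_two, e]
  have hsurj : ∀ a, a = e (a 0, a 1) := fun a => by
    ext i; fin_cases i <;> simp [e]
  refine ⟨fun i j => coeff (e (i, j)) f, fun i j hij => ?_, fun u => ?_⟩
  · refine coeff_eq_zero_of_totalDegree_lt (lt_of_le_of_lt hf ?_)
    have := hdeg (i, j)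
    exact lt_of_lt_of_eq hij this.symm
  · have hsub : f.support ⊆
        (Finset.range (k + 1) ×ˢ Finset.range (k + 1)).image e := by
      intro a ha
      refine Finset.mem_image.mpr ⟨(a 0, a 1), ?_, (hsurj a).symm⟩
      have h1 : a.degree ≤ k := (le_totalDegree ha).trans hf
      rw [hsurj a, hdeg] at h1
      simp only [Finset.mem_product, Finset.mem_range]
      simp only at h1
      omega
    rw [eval_eq_sum_of_support_subset hsub, Finset.sum_image fun p _ q _ h => he h,
      Finset.sum_product]
    simp [e, Fin.prod_univ_two]

theorem eval_eq_sum_three {f : MvPolynomial (Fin 3) ℝ} {k : ℕ} (hf : f.totalDegree ≤ k) :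
    ∃ c : ℕ → ℕ → ℕ → ℝ, (∀ i j l, k < i + j + l → c i j l = 0) ∧
      (∀ m, f.IsHomogeneous m → ∀ i j l, i + j + l ≠ m → c i j l = 0) ∧
      ∀ u, eval u f = ∑ i ∈ Finset.range (k + 1), ∑ j ∈ Finset.range (k + 1),
        ∑ l ∈ Finset.range (k + 1), c i j l * (u 0 ^ i * u 1 ^ j * u 2 ^ l) := by
  let e : ℕ × ℕ × ℕ → Fin 3 →₀ ℕ :=
    fun p => Finsupp.equivFunOnFinite.symm ![p.1, p.2.1, p.2.2]
  have he : Function.Injective e := fun p q hpq => by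
    have := Finsupp.equivFunOnFinite.symm.injective hpq
    exact Prod.ext (congrFun this 0) (Prod.ext (congrFun this 1) (congrFun this 2))
  have hdeg : ∀ p, (e p).degree = p.1 + p.2.1 + p.2.2 := fun p => by
    simp [Finsupp.degree_eq_sum, Fin.sum_univ_three, e]
  have hsurj : ∀ a, a = e (a 0, a 1, a 2) := fun a => by
    ext i; fin_cases i <;> simp [e]
  refine ⟨fun i j l => coeff (e (i, j, l)) f, fun i j l hij => ?_, fun m hm i j l hij => ?_,
    fun u => ?_⟩
  · refine coeff_eq_zero_of_totalDegree_lt (lt_of_le_of_lt hf ?_)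
    have := hdeg (i, j, l)
    exact lt_of_lt_of_eq hij this.symm
  · refine hm.coeff_eq_zero ?_
    rwa [hdeg]
  · have hsub : f.support ⊆
        (Finset.range (k + 1) ×ˢ Finset.range (k + 1) ×ˢ Finset.range (k + 1)).image e := by
      intro a ha
      refine Finset.mem_image.mpr ⟨(a 0, a 1, a 2), ?_, (hsurj a).symm⟩
      have h1 : a.degree ≤ k := (le_totalDegree ha).trans hf
      rw [hsurj a, hdeg] at h1
      simp only [Finset.mem_product, Finset.mem_range]
      simp only at h1
      omega
    rw [eval_eq_sum_of_support_subset hsub, Finset.sum_image fun p _ q _ h => he h,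
      Finset.sum_product]
    simp [e, Fin.prod_univ_three, Finset.sum_product]

theorem cubic_bounded {a b c d : ℝ}
    (h : ∀ t : ℝ, (a + b * t + c * t ^ 2 + d * t ^ 3) ^ 2 ≤ 1) : b = 0 ∧ c = 0 ∧ d = 0 := by
  set p : Polynomial ℝ := Polynomial.C a + Polynomial.C b * Polynomial.X
    + Polynomial.C c * Polynomial.X ^ 2 + Polynomial.C d * Polynomial.X ^ 3 with hp
  have hd : p.natDegree ≤ 0 := Polynomial.natDegree_le_of_sq_le (K := 1) fun t => by
    simpa [hp] using h t
  have h1 : ∀ k, 0 < k → p.coeff k = 0 := fun k hk =>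
    Polynomial.coeff_eq_zero_of_natDegree_lt (lt_of_le_of_lt hd hk)
  have e1 := h1 1 one_pos
  have e2 := h1 2 two_pos
  have e3 := h1 3 three_pos
  simp [hp, Polynomial.coeff_C] at e1 e2 e3
  exact ⟨e1, e2, e3⟩

/-- A polynomial whose square is below the Motzkin polynomial vanishes at the origin. -/
theorem eval_zero_of_sq_le_motzkin {g : MvPolynomial (Fin 2) ℝ}
    (h : ∀ u : Fin 2 → ℝ, eval u g ^ 2 ≤
      u 0 ^ 4 * u 1 ^ 2 + u 0 ^ 2 * u 1 ^ 4 + 1 - 3 * u 0 ^ 2 * u 1 ^ 2) :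
    eval 0 g = 0 := by
  have hdeg : g.totalDegree ≤ 3 := by
    refine totalDegree_le_of_sq_le fun v =>
      ⟨v 0 ^ 4 * v 1 ^ 2 + v 0 ^ 2 * v 1 ^ 4 + 1, fun t => (h (t • v)).trans ?_⟩
    have h1 : 1 ≤ (1 + t ^ 2) ^ 3 := one_le_pow₀ (by nlinarith [sq_nonneg t])
    have h2 : t ^ 6 ≤ (1 + t ^ 2) ^ 3 := by
      nlinarith [sq_nonneg t, pow_nonneg (sq_nonneg t) 2]
    have h3 : 0 ≤ v 0 ^ 4 * v 1 ^ 2 + v 0 ^ 2 * v 1 ^ 4 := by positivity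
    have h4 : 0 ≤ 3 * (t * v 0) ^ 2 * (t * v 1) ^ 2 := by positivity
    simp only [Pi.smul_apply, smul_eq_mul]
    nlinarith [mul_le_mul_of_nonneg_left h2 h3]
  obtain ⟨c, hc, hev⟩ := exists_coeff_two hdeg
  have hg : ∀ x y, eval ![x, y] g = c 0 0 + c 1 0 * x + c 2 0 * x ^ 2 + c 3 0 * x ^ 3
      + c 0 1 * y + c 0 2 * y ^ 2 + c 0 3 * y ^ 3
      + x * y * (c 1 1 + c 2 1 * x + c 1 2 * y) := by
    intro x y
    rw [hev]
    simp [Finset.sum_range_succ, hc]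
    ring
  have h' : ∀ x y, eval ![x, y] g ^ 2 ≤ x ^ 4 * y ^ 2 + x ^ 2 * y ^ 4 + 1 - 3 * x ^ 2 * y ^ 2 :=
    fun x y => h ![x, y]
  obtain ⟨a1, a2, a3⟩ := cubic_bounded (a := c 0 0) (b := c 1 0) (c := c 2 0) (d := c 3 0)
    fun t => by simpa [hg] using h' t 0
  obtain ⟨b1, b2, b3⟩ := cubic_bounded (a := c 0 0) (b := c 0 1) (c := c 0 2) (d := c 0 3)
    fun t => by simpa [hg] using h' 0 t
  have hz : ∀ x y : ℝ, x ^ 2 = 1 → y ^ 2 = 1 → eval ![x, y] g = 0 := by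
    intro x y hx hy
    have := h' x y
    rw [show x ^ 4 * y ^ 2 + x ^ 2 * y ^ 4 + 1 - 3 * x ^ 2 * y ^ 2 =
      (x ^ 2) ^ 2 * y ^ 2 + x ^ 2 * (y ^ 2) ^ 2 + 1 - 3 * x ^ 2 * y ^ 2 by ring, hx, hy] at this
    nlinarith [sq_nonneg (eval ![x, y] g)]
  have z1 := hz 1 1 (by norm_num) (by norm_num)
  have z2 := hz 1 (-1) (by norm_num) (by norm_num)
  have z3 := hz (-1) 1 (by norm_num) (by norm_num)
  have z4 := hz (-1) (-1) (by norm_num) (by norm_num)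
  rw [hg, a1, a2, a3, b1, b2, b3] at z1 z2 z3 z4
  have h0 : (0 : Fin 2 → ℝ) = ![0, 0] := by ext i; fin_cases i <;> rfl
  rw [h0, hg]
  linarith

/-- A polynomial whose square is below the Choi-Lam polynomial vanishes at the origin. -/
theorem eval_zero_of_sq_le_choiLam {g : MvPolynomial (Fin 3) ℝ}
    (h : ∀ u : Fin 3 → ℝ, eval u g ^ 2 ≤
      1 + u 0 ^ 2 * u 1 ^ 2 + u 1 ^ 2 * u 2 ^ 2 + u 2 ^ 2 * u 0 ^ 2 - 4 * u 0 * u 1 * u 2) :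
    eval 0 g = 0 := by
  have hdeg : g.totalDegree ≤ 2 := by
    refine totalDegree_le_of_sq_le fun v =>
      ⟨1 + v 0 ^ 2 * v 1 ^ 2 + v 1 ^ 2 * v 2 ^ 2 + v 2 ^ 2 * v 0 ^ 2 + 4 * |v 0 * v 1 * v 2|,
        fun t => (h (t • v)).trans ?_⟩
    have h1 : 1 ≤ (1 + t ^ 2) ^ 2 := one_le_pow₀ (by nlinarith [sq_nonneg t])
    have h2 : t ^ 4 ≤ (1 + t ^ 2) ^ 2 := by nlinarith [sq_nonneg t]
    have h3 : |t| ^ 3 ≤ (1 + t ^ 2) ^ 2 := by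
      rw [← sq_abs t]
      have := abs_nonneg t
      nlinarith [sq_nonneg (|t| ^ 2 - |t|), sq_nonneg |t|]
    have h4 : 0 ≤ v 0 ^ 2 * v 1 ^ 2 + v 1 ^ 2 * v 2 ^ 2 + v 2 ^ 2 * v 0 ^ 2 := by positivity
    have h5 : -(t ^ 3 * (v 0 * v 1 * v 2)) ≤ |t| ^ 3 * |v 0 * v 1 * v 2| := by
      rw [← abs_pow, ← abs_mul]
      exact neg_le_abs _
    have h6 := abs_nonneg (v 0 * v 1 * v 2)
    simp only [Pi.smul_apply, smul_eq_mul]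
    nlinarith [mul_le_mul_of_nonneg_left h2 h4, mul_le_mul_of_nonneg_right h3 h6]
  obtain ⟨c, hc, -, hev⟩ := eval_eq_sum_three hdeg
  have hg : ∀ x y z, eval ![x, y, z] g = c 0 0 0 + c 1 0 0 * x + c 2 0 0 * x ^ 2
      + c 0 1 0 * y + c 0 2 0 * y ^ 2 + c 0 0 1 * z + c 0 0 2 * z ^ 2
      + c 1 1 0 * (x * y) + c 0 1 1 * (y * z) + c 1 0 1 * (z * x) := by
    intro x y z
    rw [hev]
    simp [Finset.sum_range_succ, hc]
    ring
  have h' : ∀ x y z, eval ![x, y, z] g ^ 2 ≤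
      1 + x ^ 2 * y ^ 2 + y ^ 2 * z ^ 2 + z ^ 2 * x ^ 2 - 4 * x * y * z :=
    fun x y z => h ![x, y, z]
  obtain ⟨a1, a2, -⟩ := cubic_bounded (a := c 0 0 0) (b := c 1 0 0) (c := c 2 0 0) (d := 0)
    fun t => by simpa [hg] using h' t 0 0
  obtain ⟨b1, b2, -⟩ := cubic_bounded (a := c 0 0 0) (b := c 0 1 0) (c := c 0 2 0) (d := 0)
    fun t => by simpa [hg] using h' 0 t 0
  obtain ⟨d1, d2, -⟩ := cubic_bounded (a := c 0 0 0) (b := c 0 0 1) (c := c 0 0 2) (d := 0)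
    fun t => by simpa [hg] using h' 0 0 t
  have hz : ∀ x y z : ℝ, x ^ 2 = 1 → y ^ 2 = 1 → x * y = z → eval ![x, y, z] g = 0 := by
    rintro x y _ hx hy rfl
    have := h' x y (x * y)
    rw [show 1 + x ^ 2 * y ^ 2 + y ^ 2 * (x * y) ^ 2 + (x * y) ^ 2 * x ^ 2 - 4 * x * y * (x * y) =
      1 + x ^ 2 * y ^ 2 + x ^ 2 * (y ^ 2) ^ 2 + (x ^ 2) ^ 2 * y ^ 2 - 4 * (x ^ 2 * y ^ 2) by ring,
      hx, hy] at this
    nlinarith [sq_nonneg (eval ![x, y, x * y] g)]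
  have z1 := hz 1 1 1 (by norm_num) (by norm_num) (by norm_num)
  have z2 := hz 1 (-1) (-1) (by norm_num) (by norm_num) (by norm_num)
  have z3 := hz (-1) 1 (-1) (by norm_num) (by norm_num) (by norm_num)
  have z4 := hz (-1) (-1) 1 (by norm_num) (by norm_num) (by norm_num)
  rw [hg, a1, a2, b1, b2, d1, d2] at z1 z2 z3 z4
  have h0 : (0 : Fin 3 → ℝ) = ![0, 0, 0] := by ext i; fin_cases i <;> rfl
  rw [h0, hg]
  linarith

theorem prod_ite_three_pow {n : ℕ} (S : Finset (Fin n)) (a : Fin n →₀ ℕ) :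
    ∏ i, (if i ∈ S then (3 : ℝ) else 1) ^ a i = 3 ^ ∑ i ∈ S, a i := by
  simp [ite_pow, Finset.prod_ite_mem, Finset.prod_pow_eq_pow_sum]

theorem sum_eq_sum_of_prod_eq {n : ℕ} {S : Finset (Fin n)} {a b : Fin n →₀ ℕ}
    (h : ∏ i, (if i ∈ S then (3 : ℝ) else 1) ^ a i = ∏ i, (if i ∈ S then (3 : ℝ) else 1) ^ b i) :
    ∑ i ∈ S, a i = ∑ i ∈ S, b i := by
  rw [prod_ite_three_pow, prod_ite_three_pow] at h
  exact pow_right_injective₀ (by norm_num) (by norm_num) h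

theorem motzkin_nonneg (x y : ℝ) :
    0 ≤ x ^ 4 * y ^ 2 + x ^ 2 * y ^ 4 + 1 - 3 * x ^ 2 * y ^ 2 := by
  rcases eq_or_ne (x ^ 2 + y ^ 2) 0 with h | h
  · have hx : x = 0 := by nlinarith [sq_nonneg x, sq_nonneg y]
    simp [hx]
  · have hpos : 0 < x ^ 2 + y ^ 2 := lt_of_le_of_ne (by positivity) h.symm
    refine nonneg_of_mul_nonneg_right ?_ hpos
    have : (x ^ 2 + y ^ 2) * (x ^ 4 * y ^ 2 + x ^ 2 * y ^ 4 + 1 - 3 * x ^ 2 * y ^ 2) =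
      x ^ 2 * (1 - y ^ 2) ^ 2 + y ^ 2 * (1 - x ^ 2) ^ 2 + x ^ 2 * y ^ 2 * (x ^ 2 + y ^ 2 - 2) ^ 2 := by
      ring
    rw [this]
    positivity

theorem choiLam_nonneg (x y z : ℝ) :
    0 ≤ 1 + x ^ 2 * y ^ 2 + y ^ 2 * z ^ 2 + z ^ 2 * x ^ 2 - 4 * x * y * z := by
  have h : |x * y| * |z| ≥ x * y * z := by
    rw [← abs_mul]; exact le_abs_self _
  have h1 : 0 ≤ |x * y| * (1 - |z|) ^ 2 := by positivity
  have h2 : 2 * |x * y| ≤ x ^ 2 + y ^ 2 := by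
    rw [abs_mul, ← sq_abs x, ← sq_abs y]; nlinarith [sq_nonneg (|x| - |y|)]
  nlinarith [sq_nonneg (|x * y| - 1), sq_abs (x * y), sq_abs z,
    mul_le_mul_of_nonneg_left h2 (sq_nonneg z)]

theorem totalDegree_add_le_of_le {σ : Type*} {p q : MvPolynomial σ ℝ} {k : ℕ}
    (hp : p.totalDegree ≤ k) (hq : q.totalDegree ≤ k) : (p + q).totalDegree ≤ k :=
  (totalDegree_add _ _).trans (max_le hp hq)

theorem totalDegree_sub_le_of_le {σ : Type*} {p q : MvPolynomial σ ℝ} {k : ℕ}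
    (hp : p.totalDegree ≤ k) (hq : q.totalDegree ≤ k) : (p - q).totalDegree ≤ k :=
  (totalDegree_sub _ _).trans (max_le hp hq)

theorem totalDegree_mul_le_of_le {σ : Type*} {p q : MvPolynomial σ ℝ} {k l : ℕ}
    (hp : p.totalDegree ≤ k) (hq : q.totalDegree ≤ l) : (p * q).totalDegree ≤ k + l :=
  (totalDegree_mul _ _).trans (add_le_add hp hq)

theorem totalDegree_pow_le_of_le_one {σ : Type*} {p : MvPolynomial σ ℝ} (k : ℕ)
    (hp : p.totalDegree ≤ 1) : (p ^ k).totalDegree ≤ k :=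
  (totalDegree_pow _ _).trans (by nlinarith)

theorem totalDegree_C_sub_X_le {n : ℕ} (i : Fin n) :
    (C 2 - X i : MvPolynomial (Fin n) ℝ).totalDegree ≤ 1 :=
  totalDegree_sub_le_of_le (by simp) (by simp)

theorem sq_le_eval_of_eq_sum {σ : Type*} {r : ℕ} {f : MvPolynomial σ ℝ}
    {g : Fin r → MvPolynomial σ ℝ} (h : f = ∑ i, g i ^ 2) (u : σ → ℝ) (i : Fin r) :
    eval u (g i) ^ 2 ≤ eval u f := by
  rw [h, map_sum]
  simp only [map_pow]
  exact Finset.single_le_sum (f := fun i => eval u (g i) ^ 2) (fun _ _ => sq_nonneg _)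
    (Finset.mem_univ i)

theorem eval_bind_one {σ τ : Type*} (v : τ → ℝ) (L : σ → MvPolynomial τ ℝ)
    (g : MvPolynomial σ ℝ) : eval v (bind₁ L g) = eval (fun i => eval v (L i)) g := by
  simpa [aeval_eq_eval] using aeval_bind₁ (R := ℝ) v L g

theorem add_ne_PosCone_two {d : ℕ} (hd : 3 ≤ d) :
    {f | ∃ g ∈ SOSCone 2 d, ∃ h ∈ SONCCone 2 d, f = g + h} ≠ PosCone 2 d Set.univ := by
  intro heq
  set A : MvPolynomial (Fin 2) ℝ := C 2 - X 0 with hA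
  set B : MvPolynomial (Fin 2) ℝ := C 2 - X 1 with hB
  have dA : A.totalDegree ≤ 1 := totalDegree_C_sub_X_le 0
  have dB : B.totalDegree ≤ 1 := totalDegree_C_sub_X_le 1
  set f : MvPolynomial (Fin 2) ℝ :=
    A ^ 4 * B ^ 2 + A ^ 2 * B ^ 4 + C 1 - C 3 * (A ^ 2 * B ^ 2) with hf
  have hfe : ∀ u : Fin 2 → ℝ, eval u f = (2 - u 0) ^ 4 * (2 - u 1) ^ 2
      + (2 - u 0) ^ 2 * (2 - u 1) ^ 4 + 1 - 3 * (2 - u 0) ^ 2 * (2 - u 1) ^ 2 := by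
    intro u
    simp [hf, hA, hB]
    ring
  have hfd : f.totalDegree ≤ 6 := by
    refine totalDegree_sub_le_of_le (totalDegree_add_le_of_le (totalDegree_add_le_of_le
      (totalDegree_mul_le_of_le (k := 4) (l := 2) ?_ ?_)
      (totalDegree_mul_le_of_le (k := 2) (l := 4) ?_ ?_)) (by simp))
      (totalDegree_mul_le_of_le (k := 0) (l := 6) (by simp)
        ((totalDegree_mul_le_of_le (k := 2) (l := 2) ?_ ?_).trans (by norm_num)))
    all_goals exact totalDegree_pow_le_of_le_one _ ‹_›
  have hmem : f ∈ PosCone 2 d Set.univ :=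
    ⟨by omega, fun u _ => by rw [hfe]; exact motzkin_nonneg _ _⟩
  rw [← heq] at hmem
  obtain ⟨-, r, g, hg⟩ := mem_SOSCone_of_mem_add hmem (Z := {u | eval u f = 0})
    (by simp [hfe]; norm_num) (fun a b hab => by
      have key : ∀ j : Fin 2, a j = b j := fun j => by
        have := sum_eq_sum_of_prod_eq (S := {j}) (hab _ (by
          fin_cases j <;> simp [hfe] <;> norm_num))
        simpa using this
      exact Finsupp.ext key) (fun u hu => hu)
  have hg0 : ∀ i, eval (fun _ => 2) (g i) = 0 := fun i => by
    have := eval_zero_of_sq_le_motzkin (g := bind₁ (fun j => C 2 - X j) (g i)) (fun u => by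
      rw [eval_bind_one]
      refine (sq_le_eval_of_eq_sum hg _ i).trans_eq ?_
      simp [hfe])
    rw [eval_bind_one] at this
    simpa using this
  have h1 : eval (fun _ => 2) f = 1 := by simp [hfe]
  rw [hg, map_sum] at h1
  simp [hg0] at h1

theorem add_ne_PosCone_of_three_le {n d : ℕ} (hn : 3 ≤ n) (hd : 2 ≤ d) :
    {f | ∃ g ∈ SOSCone n d, ∃ h ∈ SONCCone n d, f = g + h} ≠ PosCone n d Set.univ := by
  intro heq
  obtain ⟨m, rfl⟩ : ∃ m, n = m + 3 := ⟨n - 3, by omega⟩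
  have h01 : (0 : Fin (m + 3)) ≠ 1 := by simp
  have h02 : (0 : Fin (m + 3)) ≠ 2 := by simp [Fin.ext_iff, Nat.mod_eq_of_lt (show 2 < m + 3 by omega)]
  have h12 : (1 : Fin (m + 3)) ≠ 2 := by simp [Fin.ext_iff, Nat.mod_eq_of_lt (show 2 < m + 3 by omega)]
  set A : MvPolynomial (Fin (m + 3)) ℝ := C 2 - X 0 with hA
  set B : MvPolynomial (Fin (m + 3)) ℝ := C 2 - X 1 with hB
  set D : MvPolynomial (Fin (m + 3)) ℝ := C 2 - X 2 with hD
  have dA : A.totalDegree ≤ 1 := totalDegree_C_sub_X_le 0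
  have dB : B.totalDegree ≤ 1 := totalDegree_C_sub_X_le 1
  have dD : D.totalDegree ≤ 1 := totalDegree_C_sub_X_le 2
  set f : MvPolynomial (Fin (m + 3)) ℝ :=
    C 1 + A ^ 2 * B ^ 2 + B ^ 2 * D ^ 2 + D ^ 2 * A ^ 2 - C 4 * (A * B * D) with hf
  have hfe : ∀ u : Fin (m + 3) → ℝ, eval u f = 1 + (2 - u 0) ^ 2 * (2 - u 1) ^ 2
      + (2 - u 1) ^ 2 * (2 - u 2) ^ 2 + (2 - u 2) ^ 2 * (2 - u 0) ^ 2
      - 4 * (2 - u 0) * (2 - u 1) * (2 - u 2) := by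
    intro u
    simp [hf, hA, hB, hD]
    ring
  have hfd : f.totalDegree ≤ 4 := by
    refine totalDegree_sub_le_of_le (totalDegree_add_le_of_le (totalDegree_add_le_of_le
      (totalDegree_add_le_of_le (by simp)
      (totalDegree_mul_le_of_le (k := 2) (l := 2) ?_ ?_))
      (totalDegree_mul_le_of_le (k := 2) (l := 2) ?_ ?_))
      (totalDegree_mul_le_of_le (k := 2) (l := 2) ?_ ?_))
      (totalDegree_mul_le_of_le (k := 0) (l := 4) (by simp)
        ((totalDegree_mul_le_of_le (totalDegree_mul_le_of_le dA dB) dD).trans (by norm_num)))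
    all_goals exact totalDegree_pow_le_of_le_one _ ‹_›
  have hmem : f ∈ PosCone (m + 3) d Set.univ :=
    ⟨by omega, fun u _ => by rw [hfe]; exact choiLam_nonneg _ _ _⟩
  rw [← heq] at hmem
  obtain ⟨-, r, g, hg⟩ := mem_SOSCone_of_mem_add hmem (Z := {u | eval u f = 0})
    (by simp [hfe]; norm_num) (fun a b hab => by
      have e1 := sum_eq_sum_of_prod_eq (S := {0, 1}) (hab _ (by
        simp [hfe, h02.symm, h12.symm]; norm_num))
      have e2 := sum_eq_sum_of_prod_eq (S := {1, 2}) (hab _ (by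
        simp [hfe, h01, h02]; norm_num))
      have e3 := sum_eq_sum_of_prod_eq (S := {0, 2}) (hab _ (by
        simp [hfe, h01.symm, h12]; norm_num))
      rw [Finset.sum_pair h01, Finset.sum_pair h01] at e1
      rw [Finset.sum_pair h12, Finset.sum_pair h12] at e2
      rw [Finset.sum_pair h02, Finset.sum_pair h02] at e3
      refine Finsupp.ext fun j => ?_
      rcases eq_or_ne j 0 with rfl | j0
      · omega
      rcases eq_or_ne j 1 with rfl | j1
      · omega
      rcases eq_or_ne j 2 with rfl | j2
      · omega
      have := sum_eq_sum_of_prod_eq (S := {j}) (hab _ (by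
        simp [hfe, j0.symm, j1.symm, j2.symm]; norm_num))
      simpa using this) (fun u hu => hu)
  let L : Fin (m + 3) → MvPolynomial (Fin 3) ℝ := fun j =>
    C 2 - (if j = 0 then X 0 else if j = 1 then X 1 else if j = 2 then X 2 else 0)
  have hg0 : ∀ i, eval (fun _ => 2) (g i) = 0 := fun i => by
    have := eval_zero_of_sq_le_choiLam (g := bind₁ L (g i)) (fun u => by
      rw [eval_bind_one]
      refine (sq_le_eval_of_eq_sum hg _ i).trans_eq ?_
      simp [hfe, L, h01.symm, h02.symm, h12.symm])
    rw [eval_bind_one] at this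
    convert this using 3
    funext j
    simp only [L]
    split_ifs <;> simp
  have h1 : eval (fun _ => 2) f = 1 := by simp [hfe]
  rw [hg, map_sum] at h1
  simp [hg0] at h1

theorem nonneg_of_nonneg_of_ne {φ : ℝ → ℝ} (hφ : Continuous φ) {a : ℝ}
    (h : ∀ x, x ≠ a → 0 ≤ φ x) (x : ℝ) : 0 ≤ φ x := by
  have hcl : IsClosed {x | 0 ≤ φ x} := isClosed_le continuous_const hφ
  have hsub : ({a}ᶜ : Set ℝ) ⊆ {x | 0 ≤ φ x} := fun y hy => h y hy
  have := hcl.closure_subset_iff.mpr hsub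
  rw [(dense_compl_singleton a).closure_eq] at this
  exact this (Set.mem_univ x)

/-- A nonnegative real polynomial in one variable is a sum of squares. -/
theorem Polynomial.exists_sum_sq_of_nonneg (p : Polynomial ℝ) (hp : ∀ x, 0 ≤ p.eval x) :
    ∃ (r : ℕ) (g : Fin r → Polynomial ℝ), p = ∑ i, g i ^ 2 := by
  induction hk : p.natDegree using Nat.strong_induction_on generalizing p with
  | _ k ih =>
  rcases Nat.eq_zero_or_pos k with rfl | hkpos
  · obtain ⟨c, rfl⟩ := Polynomial.natDegree_eq_zero.mp hk
    refine ⟨1, fun _ => Polynomial.C (Real.sqrt c), ?_⟩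
    have : 0 ≤ c := by simpa using hp 0
    simp [← map_pow, Real.sq_sqrt this]
  obtain ⟨a, ha⟩ := p.exists_forall_norm_le
  have hmin : ∀ x, p.eval a ≤ p.eval x := fun x => by
    have := ha x
    rwa [Real.norm_of_nonneg (hp a), Real.norm_of_nonneg (hp x)] at this
  set q := p - Polynomial.C (p.eval a) with hq
  have hqe : ∀ x, q.eval x = p.eval x - p.eval a := fun x => by simp [hq]
  have hqdeg : q.natDegree = k := by rw [hq, Polynomial.natDegree_sub_C, hk]
  have hq0 : q ≠ 0 := by
    rintro h
    rw [h, Polynomial.natDegree_zero] at hqdeg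
    omega
  have hroot : q.IsRoot a := by simp [Polynomial.IsRoot, hqe]
  have hder : q.derivative.IsRoot a :=
    IsLocalMin.hasDerivAt_eq_zero (f := fun x => q.eval x) (Filter.Eventually.of_forall fun x => by
      simpa [hqe] using hmin x) (q.hasDerivAt a)
  have hmult := (Polynomial.one_lt_rootMultiplicity_iff_isRoot hq0).mpr ⟨hroot, hder⟩
  obtain ⟨s, hs⟩ := (Polynomial.le_rootMultiplicity_iff hq0).mp (show 2 ≤ _ from hmult)
  have hs0 : s ≠ 0 := by rintro rfl; simp [hq0] at hs
  have hsdeg : s.natDegree < k := by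
    rw [← hqdeg, hs, Polynomial.natDegree_mul (pow_ne_zero _ (Polynomial.X_sub_C_ne_zero a)) hs0]
    simp
  have hsnn : ∀ x, 0 ≤ s.eval x := nonneg_of_nonneg_of_ne s.continuous (a := a) fun x hx => by
    have h1 : 0 ≤ (x - a) ^ 2 * s.eval x := by
      have : q.eval x = (x - a) ^ 2 * s.eval x := by rw [hs]; simp
      rw [← this, hqe]
      linarith [hmin x]
    exact nonneg_of_mul_nonneg_right h1 (by have := sub_ne_zero.mpr hx; positivity)
  obtain ⟨r, g, hg⟩ := ih _ hsdeg s hsnn rfl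
  refine ⟨r + 1, Fin.cons (Polynomial.C (Real.sqrt (p.eval a)))
    fun i => (Polynomial.X - Polynomial.C a) * g i, ?_⟩
  rw [Fin.sum_univ_succ]
  simp only [Fin.cons_zero, Fin.cons_succ, mul_pow, ← Finset.mul_sum, ← hg, ← hs, ← map_pow,
    Real.sq_sqrt (hp a)]
  rw [hq]
  ring

theorem add_eq_PosCone_one_left (d : ℕ) :
    {f | ∃ g ∈ SOSCone 1 d, ∃ h ∈ SONCCone 1 d, f = g + h} = PosCone 1 d Set.univ := by
  refine add_eq_PosCone_of_forall_sos fun f hf => ?_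
  set p : Polynomial ℝ := aeval (fun _ => Polynomial.X) f with hp
  have hpf : Polynomial.aeval (X 0 : MvPolynomial (Fin 1) ℝ) p = f := by
    have : (Polynomial.aeval (X 0 : MvPolynomial (Fin 1) ℝ)).comp
        (aeval fun _ : Fin 1 => (Polynomial.X : Polynomial ℝ)) = AlgHom.id ℝ _ := by
      ext i
      simp [Subsingleton.elim i 0]
    exact DFunLike.congr_fun this f
  obtain ⟨r, g, hg⟩ := p.exists_sum_sq_of_nonneg fun x => by
    have h1 : p.eval x = eval (fun _ => x) f := by
      have : (Polynomial.aeval x).comp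
        (aeval fun _ : Fin 1 => (Polynomial.X : Polynomial ℝ)) = aeval fun _ => x := by
        ext i
        simp
      simpa [aeval_eq_eval] using DFunLike.congr_fun this f
    rw [h1]
    exact hf.2 _ (Set.mem_univ _)
  refine ⟨r, fun i => Polynomial.aeval (X 0) (g i), ?_⟩
  rw [← hpf, hg]
  simp

theorem exists_sum_sq_of_posSemidef {σ ι : Type*} [Fintype ι] {Q : Matrix ι ι ℝ}
    (hQ : Q.PosSemidef) (v : ι → MvPolynomial σ ℝ) :
    ∃ (r : ℕ) (g : Fin r → MvPolynomial σ ℝ),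
      ∑ i, ∑ j, C (Q i j) * (v i * v j) = ∑ i, g i ^ 2 := by
  obtain ⟨m, B, rfl⟩ := Matrix.posSemidef_iff_eq_sum_vecMulVec.mp hQ
  refine ⟨m, fun k => ∑ i, C (B k i) * v i, ?_⟩
  simp only [Matrix.sum_apply, Matrix.vecMulVec_apply, star_trivial, map_sum, sq,
    Finset.sum_mul, map_mul]
  rw [Finset.sum_comm_cycle]
  refine Finset.sum_congr rfl fun k _ => ?_
  refine Finset.sum_congr rfl fun i _ => ?_
  rw [Finset.mul_sum]
  refine Finset.sum_congr rfl fun j _ => ?_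
  ring

theorem exists_quadraticForm_of_totalDegree_le_two {n : ℕ} {f : MvPolynomial (Fin n) ℝ}
    (hf : f.totalDegree ≤ 2) : ∃ M : Matrix (Option (Fin n)) (Option (Fin n)) ℝ,
      M.IsSymm ∧ f = ∑ i, ∑ j, C (M i j) * (i.elim 1 X * j.elim 1 X) := by
  classical
  have hmon : ∀ (a : Fin n →₀ ℕ) (c : ℝ), a.degree ≤ 2 →
      ∃ i j : Option (Fin n), monomial a c = C c * (i.elim 1 X * j.elim 1 X) := by
    intro a c ha
    rcases eq_or_ne a 0 with rfl | h0
    · exact ⟨none, none, by simp⟩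
    obtain ⟨i, hi⟩ := Finsupp.ne_iff.mp h0
    obtain ⟨b, rfl⟩ : ∃ b, a = Finsupp.single i 1 + b := 
      ⟨a - Finsupp.single i 1, (add_tsub_cancel_of_le
        (Finsupp.single_le_iff.mpr (Nat.one_le_iff_ne_zero.mpr hi))).symm⟩
    rw [map_add, Finsupp.degree_single] at ha
    rcases eq_or_ne b 0 with rfl | hb
    · exact ⟨some i, none, by simp [C_mul_X_eq_monomial]⟩
    obtain ⟨j, hj⟩ := Finsupp.ne_iff.mp hb
    obtain ⟨b, rfl⟩ : ∃ b', b = Finsupp.single j 1 + b' := 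
      ⟨b - Finsupp.single j 1, (add_tsub_cancel_of_le
        (Finsupp.single_le_iff.mpr (Nat.one_le_iff_ne_zero.mpr hj))).symm⟩
    rw [map_add, Finsupp.degree_single] at ha
    have hb0 : b = 0 := (Finsupp.degree_eq_zero_iff b).mp (by omega)
    subst hb0
    refine ⟨some i, some j, ?_⟩
    simp [X, monomial_mul, C_mul_monomial]
  have hmat : ∀ (c : ℝ) (i j : Option (Fin n)), ∃ M : Matrix (Option (Fin n)) (Option (Fin n)) ℝ,
      M.IsSymm ∧ C c * (i.elim 1 X * j.elim 1 X : MvPolynomial (Fin n) ℝ) =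
        ∑ i, ∑ j, C (M i j) * (i.elim 1 X * j.elim 1 X) := by
    intro c i j
    refine ⟨Matrix.single i j (c / 2) + Matrix.single j i (c / 2), ?_, ?_⟩
    · rw [Matrix.IsSymm, Matrix.transpose_add, Matrix.transpose_single, Matrix.transpose_single,
        add_comm]
    · simp only [Matrix.add_apply, map_add, add_mul, Finset.sum_add_distrib, Matrix.single_apply,
        apply_ite C, map_zero, ite_mul, zero_mul, ite_and, Finset.sum_ite_irrel,
        Finset.sum_const_zero, Finset.sum_ite_eq, Finset.mem_univ, if_true]
      rw [mul_comm (j.elim 1 X), ← add_mul, ← map_add, add_halves]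
  have hsum : ∀ s : Finset (Fin n →₀ ℕ), s ⊆ f.support →
      ∃ M : Matrix (Option (Fin n)) (Option (Fin n)) ℝ, M.IsSymm ∧
        ∑ a ∈ s, monomial a (coeff a f) =
          ∑ i, ∑ j, C (M i j) * (i.elim 1 X * j.elim 1 X) := by
    intro s
    induction s using Finset.induction_on with
    | empty => exact fun _ => ⟨0, Matrix.isSymm_zero, by simp⟩
    | insert a s ha ih =>
      intro hs
      obtain ⟨M, hM, hsM⟩ := ih ((Finset.subset_insert a s).trans hs)
      have hdeg : a.degree ≤ 2 := (le_totalDegree (hs (Finset.mem_insert_self a s))).trans hf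
      obtain ⟨i, j, hij⟩ := hmon a (coeff a f) hdeg
      obtain ⟨N, hN, hsN⟩ := hmat (coeff a f) i j
      refine ⟨N + M, hN.add hM, ?_⟩
      rw [Finset.sum_insert ha, hij, hsM, hsN]
      simp [add_mul, Finset.sum_add_distrib]
  obtain ⟨M, hM, h⟩ := hsum f.support subset_rfl
  exact ⟨M, hM, (support_sum_monomial_coeff f).symm.trans h⟩

theorem add_eq_PosCone_one_right (n : ℕ) :
    {f | ∃ g ∈ SOSCone n 1, ∃ h ∈ SONCCone n 1, f = g + h} = PosCone n 1 Set.univ := by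
  refine add_eq_PosCone_of_forall_sos fun f hf => ?_
  obtain ⟨M, hM, hfM⟩ := exists_quadraticForm_of_totalDegree_le_two hf.1
  have hev : ∀ x, eval x f = ∑ i, ∑ j, M i j * (i.elim 1 x * j.elim 1 x) := by
    intro x
    have : ∀ i : Option (Fin n), eval x (i.elim 1 X) = i.elim 1 x := by
      rintro (_ | i) <;> simp
    conv_lhs => rw [hfM]
    simp [map_sum]
  have hM' : M.PosSemidef := by
    refine Matrix.PosSemidef.of_dotProduct_mulVec_nonneg
      (by rwa [Matrix.IsHermitian, Matrix.conjTranspose_eq_transpose_of_trivial]) fun v => ?_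
    have hform : star v ⬝ᵥ M.mulVec v = ∑ i, ∑ j, M i j * (v i * v j) := by
      simp only [dotProduct, Matrix.mulVec, star_trivial, Finset.mul_sum]
      exact Finset.sum_congr rfl fun i _ => Finset.sum_congr rfl fun j _ => by ring
    rw [hform]
    let w : ℝ → Option (Fin n) → ℝ := fun t i => i.elim t (fun k => v (some k))
    have hw : v = w (v none) := by
      funext i; cases i <;> rfl
    rw [hw]
    refine nonneg_of_nonneg_of_ne (φ := fun t => ∑ i, ∑ j, M i j * (w t i * w t j)) (a := 0) ?_ ?_ _
    · have : ∀ i, Continuous fun t => w t i := by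
        rintro (_ | i)
        · exact continuous_id
        · exact continuous_const
      fun_prop
    · intro t ht
      have h0 : 0 ≤ t ^ 2 * eval (fun k => v (some k) / t) f :=
        mul_nonneg (sq_nonneg t) (hf.2 _ (Set.mem_univ _))
      refine h0.trans_eq ?_
      have : ∀ i : Option (Fin n), w t i = t * i.elim 1 fun k => v (some k) / t := by
        rintro (_ | i)
        · simp [w]
        · simp only [w, Option.elim_some]; field_simp
      simp only [hev, this, Finset.mul_sum]
      exact Finset.sum_congr rfl fun i _ => Finset.sum_congr rfl fun j _ => by ring
  rw [hfM]
  exact exists_sum_sq_of_posSemidef hM' _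

/-- The ternary quadratic form with coefficient vector `c`. -/
def ternaryQuad (c : Fin 6 → ℝ) (v : Fin 3 → ℝ) : ℝ :=
  c 0 * v 0 ^ 2 + c 1 * v 1 ^ 2 + c 2 * v 2 ^ 2 + c 3 * (v 0 * v 1) + c 4 * (v 0 * v 2)
    + c 5 * (v 1 * v 2)

/-- `F` dominates a positive multiple of the square of a nonzero quadratic form. -/
def HasSquareMinorant (F : (Fin 3 → ℝ) → ℝ) : Prop :=
  ∃ ρ : ℝ, 0 < ρ ∧ ∃ c : Fin 6 → ℝ, c ≠ 0 ∧ ∀ v, ρ * ternaryQuad c v ^ 2 ≤ F v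

theorem ternaryQuad_vec (c : Fin 6 → ℝ) (x y z : ℝ) : ternaryQuad c ![x, y, z] =
    c 0 * x ^ 2 + c 1 * y ^ 2 + c 2 * z ^ 2 + c 3 * (x * y) + c 4 * (x * z) + c 5 * (y * z) := by
  simp [ternaryQuad]

theorem vec_three_eta (v : Fin 3 → ℝ) : v = ![v 0, v 1, v 2] := by
  ext i; fin_cases i <;> rfl

theorem eq_zero_of_ternaryQuad_eq_zero {c : Fin 6 → ℝ} (h : ∀ v, ternaryQuad c v = 0) : c = 0 := by
  have h' := fun x y z => (ternaryQuad_vec c x y z).symm.trans (h ![x, y, z])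
  have h0 := h' 1 0 0
  have h1 := h' 0 1 0
  have h2 := h' 0 0 1
  have h3 := h' 1 1 0
  have h4 := h' 1 0 1
  have h5 := h' 0 1 1
  ext i
  fin_cases i <;> simp <;> linarith

theorem exists_ternaryQuad_comp (c : Fin 6 → ℝ) (B : (Fin 3 → ℝ) →ₗ[ℝ] (Fin 3 → ℝ)) :
    ∃ c', ∀ v, ternaryQuad c' v = ternaryQuad c (B v) := by
  have hB : ∀ v, B v = v 0 • B ![1, 0, 0] + v 1 • B ![0, 1, 0] + v 2 • B ![0, 0, 1] := by
    intro v
    rw [← map_smul, ← map_smul, ← map_smul, ← map_add, ← map_add]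
    congr 1
    ext i
    fin_cases i <;> simp
  set e := B ![1, 0, 0]
  set f := B ![0, 1, 0]
  set g := B ![0, 0, 1]
  refine ⟨![ternaryQuad c e, ternaryQuad c f, ternaryQuad c g,
    ternaryQuad c (e + f) - ternaryQuad c e - ternaryQuad c f,
    ternaryQuad c (e + g) - ternaryQuad c e - ternaryQuad c g,
    ternaryQuad c (f + g) - ternaryQuad c f - ternaryQuad c g], fun v => ?_⟩
  rw [hB v]
  simp [ternaryQuad]
  ring

theorem HasSquareMinorant.of_comp {F : (Fin 3 → ℝ) → ℝ} {A B : (Fin 3 → ℝ) →ₗ[ℝ] (Fin 3 → ℝ)}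
    (hAB : ∀ v, A (B v) = v) (hBA : ∀ v, B (A v) = v)
    (h : HasSquareMinorant fun v => F (A v)) : HasSquareMinorant F := by
  obtain ⟨ρ, hρ, c, hc, hF⟩ := h
  obtain ⟨c', hc'⟩ := exists_ternaryQuad_comp c B
  refine ⟨ρ, hρ, c', fun h0 => hc (eq_zero_of_ternaryQuad_eq_zero fun v => ?_), fun v => ?_⟩
  · rw [← hBA v, ← hc', h0]
    simp [ternaryQuad]
  · rw [hc']
    simpa [hAB] using hF (B v)

/-- A nonzero nonnegative ternary quartic form. -/
structure IsPsdQuartic (P : MvPolynomial (Fin 3) ℝ) : Prop where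
  hom : P.IsHomogeneous 4
  nonneg : ∀ v, 0 ≤ eval v P
  ne : ∃ v, eval v P ≠ 0

theorem IsPsdQuartic.exists_comp {P : MvPolynomial (Fin 3) ℝ} (hP : IsPsdQuartic P)
    {A B : (Fin 3 → ℝ) →ₗ[ℝ] (Fin 3 → ℝ)} (hAB : ∀ v, A (B v) = v) (hBA : ∀ v, B (A v) = v) :
    ∃ P', IsPsdQuartic P' ∧ (∀ v, eval v P' = eval (A v) P) ∧
      (HasSquareMinorant (fun v => eval v P') → HasSquareMinorant fun v => eval v P) := by
  let L : Fin 3 → MvPolynomial (Fin 3) ℝ := fun i => ∑ j, C (LinearMap.toMatrix' A i j) * X j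
  have hev : ∀ v, eval v (bind₁ L P) = eval (A v) P := by
    intro v
    rw [eval_bind_one]
    congr 2
    funext i
    rw [← LinearMap.toMatrix'_mulVec A v]
    simp [L, Matrix.mulVec, dotProduct]
  refine ⟨bind₁ L P, ⟨?_, fun v => ?_, ?_⟩, hev, fun h => ?_⟩
  · have := hP.hom.aeval (S := ℝ) L (n := 1) fun i =>
      IsHomogeneous.sum _ _ _ fun j _ => (isHomogeneous_X ℝ j).C_mul _
    simpa using this
  · rw [hev]; exact hP.nonneg _
  · obtain ⟨v, hv⟩ := hP.ne
    exact ⟨B v, by rwa [hev, hAB]⟩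
  · refine HasSquareMinorant.of_comp hAB hBA ?_
    simpa only [hev] using h

theorem IsPsdQuartic.exists_shear {P : MvPolynomial (Fin 3) ℝ} (hP : IsPsdQuartic P)
    (x₀ : ℝ) {β γ : ℝ} (h : β ^ 2 + γ ^ 2 ≠ 0) :
    ∃ P', IsPsdQuartic P' ∧
      (∀ x y z, eval ![x, y, z] P' = eval ![x + x₀ * y, β * y - γ * z, γ * y + β * z] P) ∧
      (HasSquareMinorant (fun v => eval v P') → HasSquareMinorant fun v => eval v P) := by
  let M : Matrix (Fin 3) (Fin 3) ℝ := !![1, x₀, 0; 0, β, -γ; 0, γ, β]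
  have hdet : IsUnit M.det := by
    rw [isUnit_iff_ne_zero]
    convert h using 1
    simp [M, Matrix.det_fin_three]
    ring
  obtain ⟨P', h1, h2, h3⟩ := hP.exists_comp (A := M.mulVecLin) (B := M⁻¹.mulVecLin)
    (fun v => by simp [Matrix.mulVec_mulVec, Matrix.mul_nonsing_inv M hdet])
    (fun v => by simp [Matrix.mulVec_mulVec, Matrix.nonsing_inv_mul M hdet])
  refine ⟨P', h1, fun x y z => ?_, h3⟩
  rw [h2]
  congr 2
  ext i
  fin_cases i <;> simp [M, Matrix.mulVec, dotProduct, Fin.sum_univ_three]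
  ring

theorem linear_coeff_eq_zero {a b c d : ℝ}
    (h : ∀ t : ℝ, 0 ≤ a * t + b * t ^ 2 + c * t ^ 3 + d * t ^ 4) : a = 0 := by
  have hd : HasDerivAt (fun t : ℝ => a * t + b * t ^ 2 + c * t ^ 3 + d * t ^ 4) a 0 := by
    have := ((((hasDerivAt_id (0 : ℝ)).const_mul a).add
      ((hasDerivAt_pow 2 (0 : ℝ)).const_mul b)).add
      ((hasDerivAt_pow 3 (0 : ℝ)).const_mul c)).add ((hasDerivAt_pow 4 (0 : ℝ)).const_mul d)
    exact this.congr_deriv (by simp)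
  refine IsLocalMin.hasDerivAt_eq_zero (Filter.Eventually.of_forall fun t => ?_) hd
  simpa using h t

theorem quadratic_nonneg {a b c : ℝ} (h : ∀ x : ℝ, 0 ≤ x ^ 2 * a + 2 * x * b + c) :
    0 ≤ a ∧ 0 ≤ c ∧ b ^ 2 ≤ a * c := by
  have hd := discrim_le_zero (a := a) (b := 2 * b) (c := c) fun x => by
    have := h x
    nlinarith
  have hc : 0 ≤ c := by simpa using h 0
  rw [discrim] at hd
  refine ⟨?_, hc, by nlinarith⟩
  by_contra! ha
  have hb : b ^ 2 ≤ 0 := by nlinarith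
  have hb0 : b = 0 := by nlinarith
  subst hb0
  have h1 := h (1 + c / (-a))
  have h2 : 0 ≤ c / (-a) := div_nonneg hc (by linarith)
  have ha' : a ≠ 0 := ha.ne
  have h3 : c / (-a) * a = -c := by field_simp
  nlinarith

/-- Coefficients of a nonnegative quartic form with a zero at the first unit vector. -/
theorem IsPsdQuartic.exists_coeff {P : MvPolynomial (Fin 3) ℝ} (hP : IsPsdQuartic P)
    (h0 : eval ![1, 0, 0] P = 0) : ∃ a b c p q r s t₀ t₁ t₂ t₃ t₄ : ℝ, ∀ x y z,
      eval ![x, y, z] P = x ^ 2 * (a * y ^ 2 + b * (y * z) + c * z ^ 2)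
        + 2 * x * (p * y ^ 3 + q * (y ^ 2 * z) + r * (y * z ^ 2) + s * z ^ 3)
        + (t₀ * y ^ 4 + t₁ * (y ^ 3 * z) + t₂ * (y ^ 2 * z ^ 2) + t₃ * (y * z ^ 3) + t₄ * z ^ 4) := by
  obtain ⟨k, -, hk, hev⟩ := eval_eq_sum_three hP.hom.totalDegree_le
  have hk' := hk 4 hP.hom
  have hF : ∀ x y z, eval ![x, y, z] P = k 4 0 0 * x ^ 4 + x ^ 3 * (k 3 1 0 * y + k 3 0 1 * z)
      + x ^ 2 * (k 2 2 0 * y ^ 2 + k 2 1 1 * (y * z) + k 2 0 2 * z ^ 2)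
      + x * (k 1 3 0 * y ^ 3 + k 1 2 1 * (y ^ 2 * z) + k 1 1 2 * (y * z ^ 2) + k 1 0 3 * z ^ 3)
      + (k 0 4 0 * y ^ 4 + k 0 3 1 * (y ^ 3 * z) + k 0 2 2 * (y ^ 2 * z ^ 2)
        + k 0 1 3 * (y * z ^ 3) + k 0 0 4 * z ^ 4) := by
    intro x y z
    rw [hev]
    simp [Finset.sum_range_succ, hk']
    ring
  have k4 : k 4 0 0 = 0 := by simpa [hF] using h0
  have k1 : k 3 1 0 = 0 := linear_coeff_eq_zero (b := k 2 2 0) (c := k 1 3 0) (d := k 0 4 0)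
    fun t => by simpa [hF, k4] using hP.nonneg ![1, t, 0]
  have k2 : k 3 0 1 = 0 := linear_coeff_eq_zero (b := k 2 0 2) (c := k 1 0 3) (d := k 0 0 4)
    fun t => by simpa [hF, k4] using hP.nonneg ![1, 0, t]
  refine ⟨k 2 2 0, k 2 1 1, k 2 0 2, k 1 3 0 / 2, k 1 2 1 / 2, k 1 1 2 / 2, k 1 0 3 / 2,
    k 0 4 0, k 0 3 1, k 0 2 2, k 0 1 3, k 0 0 4, fun x y z => ?_⟩
  rw [hF, k4, k1, k2]
  ring

/-- A continuous homogeneous function that is positive away from the origin is bounded below by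
a multiple of a power of the Euclidean norm. -/
theorem exists_pos_mul_sum_sq_pow_le {n k : ℕ} {D : (Fin n → ℝ) → ℝ} (hD : Continuous D)
    (hom : ∀ (t : ℝ) v, D (t • v) = t ^ (2 * k) * D v) (hpos : ∀ v, v ≠ 0 → 0 < D v) :
    ∃ ε, 0 < ε ∧ ∀ v, v ≠ 0 → ε * (∑ i, v i ^ 2) ^ k ≤ D v := by
  have hsum : ∀ v : Fin n → ℝ, v ≠ 0 → 0 < ∑ i, v i ^ 2 := by
    intro v hv
    obtain ⟨i, hi⟩ := Function.ne_iff.mp hv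
    have hi' : v i ≠ 0 := hi
    exact Finset.sum_pos' (fun j _ => sq_nonneg _) ⟨i, Finset.mem_univ i, by positivity⟩
  set S : Set (Fin n → ℝ) := {v | ∑ i, v i ^ 2 = 1} with hS
  have hScl : IsClosed S := isClosed_eq (by fun_prop) continuous_const
  have hSb : Bornology.IsBounded S := by
    refine (Metric.isBounded_closedBall (x := (0 : Fin n → ℝ)) (r := 1)).subset fun v hv => ?_
    rw [mem_closedBall_zero_iff, pi_norm_le_iff_of_nonneg zero_le_one]
    intro i
    have : v i ^ 2 ≤ 1 := by
      rw [← show ∑ i, v i ^ 2 = 1 from hv]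
      exact Finset.single_le_sum (f := fun i => v i ^ 2) (fun _ _ => sq_nonneg _)
        (Finset.mem_univ i)
    rw [Real.norm_eq_abs]
    exact abs_le_one_iff_mul_self_le_one.mpr (by nlinarith)
  have hScompact : IsCompact S := Metric.isCompact_of_isClosed_isBounded hScl hSb
  have hscale : ∀ v : Fin n → ℝ, v ≠ 0 → ∃ t > 0, ∃ u ∈ S, v = t • u ∧ t ^ 2 = ∑ i, v i ^ 2 := by
    intro v hv
    have h := hsum v hv
    refine ⟨Real.sqrt (∑ i, v i ^ 2), Real.sqrt_pos.mpr h,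
      (Real.sqrt (∑ i, v i ^ 2))⁻¹ • v, ?_, ?_, Real.sq_sqrt h.le⟩
    · simp only [hS, Set.mem_ofPred_eq, Pi.smul_apply, smul_eq_mul, mul_pow, ← Finset.mul_sum,
        inv_pow, Real.sq_sqrt h.le]
      exact inv_mul_cancel₀ h.ne'
    · rw [smul_smul, mul_inv_cancel₀ (Real.sqrt_pos.mpr h).ne', one_smul]
  rcases S.eq_empty_or_nonempty with hE | hne
  · refine ⟨1, one_pos, fun v hv => ?_⟩
    obtain ⟨t, -, u, hu, -⟩ := hscale v hv
    rw [hE] at hu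
    exact hu.elim
  obtain ⟨u, hu, hmin⟩ := hScompact.exists_isMinOn hne hD.continuousOn
  have hu0 : u ≠ 0 := by
    rintro rfl
    simp [hS] at hu
  refine ⟨D u, hpos u hu0, fun v hv => ?_⟩
  obtain ⟨t, ht, w, hw, hvw, ht2⟩ := hscale v hv
  rw [← ht2, ← pow_mul, hvw, hom, mul_comm]
  exact mul_le_mul_of_nonneg_left (hmin hw) (by positivity)

theorem exists_pos_mul_sq_add_sq_pow_le {k : ℕ} {D : ℝ → ℝ → ℝ}
    (hD : Continuous fun v : Fin 2 → ℝ => D (v 0) (v 1))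
    (hom : ∀ t y z : ℝ, D (t * y) (t * z) = t ^ (2 * k) * D y z)
    (hpos : ∀ y z, y ^ 2 + z ^ 2 ≠ 0 → 0 < D y z) :
    ∃ ε, 0 < ε ∧ ∀ y z, y ^ 2 + z ^ 2 ≠ 0 → ε * (y ^ 2 + z ^ 2) ^ k ≤ D y z := by
  have hne : ∀ v : Fin 2 → ℝ, v ≠ 0 ↔ v 0 ^ 2 + v 1 ^ 2 ≠ 0 := by
    intro v
    rw [not_iff_not]
    constructor
    · rintro rfl; simp
    · intro h
      ext i
      fin_cases i
      · simp; nlinarith [sq_nonneg (v 0), sq_nonneg (v 1)]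
      · simp; nlinarith [sq_nonneg (v 0), sq_nonneg (v 1)]
  obtain ⟨ε, hε, h⟩ := exists_pos_mul_sum_sq_pow_le hD (k := k) (fun t v => by simp [hom])
    (fun v hv => hpos _ _ ((hne v).mp hv))
  refine ⟨ε, hε, fun y z hyz => ?_⟩
  simpa [Fin.sum_univ_two] using h ![y, z] ((hne _).mpr (by simpa using hyz))

theorem hasSquareMinorant_of_le {P : MvPolynomial (Fin 3) ℝ} {ρ : ℝ} (hρ : 0 < ρ) (k : Fin 6 → ℝ)
    (hk : k ≠ 0) (h : ∀ x y z, ρ * (k 0 * x ^ 2 + k 1 * y ^ 2 + k 2 * z ^ 2 + k 3 * (x * y)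
      + k 4 * (x * z) + k 5 * (y * z)) ^ 2 ≤ eval ![x, y, z] P) :
    HasSquareMinorant fun v => eval v P := by
  refine ⟨ρ, hρ, k, hk, fun v => ?_⟩
  have hv : v = ![v 0, v 1, v 2] := vec_three_eta v
  have := h (v 0) (v 1) (v 2)
  rw [← hv] at this
  exact this

theorem IsPsdQuartic.eval_smul_vec {P : MvPolynomial (Fin 3) ℝ} (hP : IsPsdQuartic P)
    (t x y z : ℝ) : eval ![t * x, t * y, t * z] P = t ^ 4 * eval ![x, y, z] P := by
  rw [← hP.hom.eval_smul]
  congr 2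
  ext i
  fin_cases i <;> simp

theorem IsPsdQuartic.hasSquareMinorant_of_binary_zero {P : MvPolynomial (Fin 3) ℝ}
    (hP : IsPsdQuartic P) (hx : ∀ x y z, eval ![x, y, z] P = eval ![0, y, z] P)
    (h1 : eval ![0, 1, 0] P = 0) : HasSquareMinorant fun v => eval v P := by
  have h0 : eval ![1, 0, 0] P = 0 := by
    rw [hx]
    simpa using hP.eval_smul_vec 0 0 0 0
  obtain ⟨a, b, c, p, q, r, s, t₀, t₁, t₂, t₃, t₄, hF⟩ := hP.exists_coeff h0
  have hF' : ∀ x y z, eval ![x, y, z] P =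
      t₀ * y ^ 4 + t₁ * (y ^ 3 * z) + t₂ * (y ^ 2 * z ^ 2) + t₃ * (y * z ^ 3) + t₄ * z ^ 4 := by
    intro x y z
    rw [hx, hF]
    ring
  have e0 : t₀ = 0 := by simpa [hF'] using h1
  have e1 : t₁ = 0 := linear_coeff_eq_zero (b := t₂) (c := t₃) (d := t₄) fun t => by
    simpa [hF', e0] using hP.nonneg ![0, 1, t]
  subst e0 e1
  obtain ⟨h2, h4, h3⟩ := quadratic_nonneg (a := t₂) (b := t₃ / 2) (c := t₄) fun y => by
    have := hP.nonneg ![0, y, 1]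
    rw [hF'] at this
    linarith
  rcases h2.eq_or_lt with h2 | h2
  · subst h2
    have e3 : t₃ = 0 := by nlinarith
    subst e3
    have h4' : t₄ ≠ 0 := by
      rintro rfl
      obtain ⟨v, hv⟩ := hP.ne
      have e : v = ![v 0, v 1, v 2] := vec_three_eta v
      rw [e, hF'] at hv
      simp at hv
    refine hasSquareMinorant_of_le (ρ := t₄) (lt_of_le_of_ne h4 h4'.symm) ![0, 0, 1, 0, 0, 0]
      (fun h => by simpa using congrFun h 2) fun x y z => ?_
    rw [hF']
    simp
    apply le_of_eq
    ring
  · refine hasSquareMinorant_of_le (ρ := 1 / t₂) (by positivity) ![0, 0, t₃ / 2, 0, 0, t₂]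
      (fun h => h2.ne' (by simpa using congrFun h 5)) fun x y z => ?_
    rw [hF']
    simp
    rw [inv_mul_le_iff₀ h2]
    nlinarith [mul_le_mul_of_nonneg_right h3 (show 0 ≤ z ^ 4 by positivity)]

theorem IsPsdQuartic.hasSquareMinorant_of_binary {P : MvPolynomial (Fin 3) ℝ}
    (hP : IsPsdQuartic P) (hx : ∀ x y z, eval ![x, y, z] P = eval ![0, y, z] P) :
    HasSquareMinorant fun v => eval v P := by
  by_cases h : ∃ β γ : ℝ, β ^ 2 + γ ^ 2 ≠ 0 ∧ eval ![0, β, γ] P = 0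
  · obtain ⟨β, γ, hβγ, h0⟩ := h
    obtain ⟨P', hP', hev, himp⟩ := hP.exists_shear 0 hβγ
    refine himp (hP'.hasSquareMinorant_of_binary_zero (fun x y z => ?_) ?_)
    · rw [hev, hev, hx, hx (0 + 0 * y)]
    · rw [hev]
      simpa using h0
  · push Not at h
    obtain ⟨ε, hε, h'⟩ := exists_pos_mul_sq_add_sq_pow_le (k := 2)
      (D := fun y z => eval ![0, y, z] P)
      ((MvPolynomial.continuous_eval P).comp (by fun_prop))
      (fun t y z => by simpa using hP.eval_smul_vec t 0 y z)
      (fun y z hyz => lt_of_le_of_ne (hP.nonneg _) (h y z hyz).symm)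
    refine hasSquareMinorant_of_le hε ![0, 1, 1, 0, 0, 0]
      (fun h => by simpa using congrFun h 2) fun x y z => ?_
    rw [hx]
    by_cases hyz : y ^ 2 + z ^ 2 = 0
    · simpa [hyz] using hP.nonneg _
    · simpa using h' y z hyz

theorem IsPsdQuartic.hasSquareMinorant_of_sub_eq_zero {P : MvPolynomial (Fin 3) ℝ}
    (hP : IsPsdQuartic P) (h0 : eval ![1, 0, 0] P = 0)
    (h1 : eval ![1, 1, 0] P + eval ![-1, 1, 0] P = 2 * eval ![0, 1, 0] P) :
    HasSquareMinorant fun v => eval v P := by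
  obtain ⟨a, b, c, p, q, r, s, t₀, t₁, t₂, t₃, t₄, hF⟩ := hP.exists_coeff h0
  have hquad := fun y z => quadratic_nonneg fun x => (hP.nonneg _).trans_eq (hF x y z)
  have ha : a = 0 := by
    rw [hF, hF, hF] at h1
    linarith
  subst ha
  have hb : b = 0 := linear_coeff_eq_zero (b := c) (c := 0) (d := 0) fun t => by
    simpa using (hquad 1 t).1
  subst hb
  have hp : p = 0 := by
    simpa using (hquad 1 0).2.2
  subst hp
  have hc : 0 ≤ c := by simpa using (hquad 0 1).1
  rcases hc.eq_or_lt with hc | hc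
  · subst hc
    refine hP.hasSquareMinorant_of_binary fun x y z => ?_
    have h3 := (hquad y z).2.2
    have h3' : 0 * y ^ 3 + q * (y ^ 2 * z) + r * (y * z ^ 2) + s * z ^ 3 = 0 := by
      refine pow_eq_zero_iff (two_ne_zero) |>.mp (le_antisymm ?_ (sq_nonneg _))
      simpa using h3
    rw [hF, hF, h3']
    ring
  · have hg : ∀ y z, 0 ≤ c * (t₀ * y ^ 4 + t₁ * (y ^ 3 * z) + t₂ * (y ^ 2 * z ^ 2)
        + t₃ * (y * z ^ 3) + t₄ * z ^ 4) - (q * y ^ 2 + r * (y * z) + s * z ^ 2) ^ 2 := by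
      intro y z
      refine nonneg_of_nonneg_of_ne (a := 0) (φ := fun z => c * (t₀ * y ^ 4 + t₁ * (y ^ 3 * z)
        + t₂ * (y ^ 2 * z ^ 2) + t₃ * (y * z ^ 3) + t₄ * z ^ 4)
        - (q * y ^ 2 + r * (y * z) + s * z ^ 2) ^ 2) (by fun_prop) (fun z hz => ?_) z
      have h3 := (hquad y z).2.2
      have hz2 : 0 < z ^ 2 := by positivity
      refine le_of_mul_le_mul_left ?_ hz2
      linarith
    refine hasSquareMinorant_of_le (ρ := 1 / c) (by positivity) ![0, q, s, 0, c, r]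
      (fun h => hc.ne' (by simpa using congrFun h 4)) fun x y z => ?_
    rw [hF]
    simp
    rw [inv_mul_le_iff₀ hc]
    linarith [hg y z]

theorem IsPsdQuartic.hasSquareMinorant_of_second_difference {P : MvPolynomial (Fin 3) ℝ}
    (hP : IsPsdQuartic P) (h0 : eval ![1, 0, 0] P = 0) {β γ : ℝ} (hβγ : β ^ 2 + γ ^ 2 ≠ 0)
    (h1 : eval ![1, β, γ] P + eval ![-1, β, γ] P = 2 * eval ![0, β, γ] P) :
    HasSquareMinorant fun v => eval v P := by
  obtain ⟨P', hP', hev, himp⟩ := hP.exists_shear 0 hβγ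
  refine himp (hP'.hasSquareMinorant_of_sub_eq_zero ?_ ?_)
  · simpa [hev] using h0
  · simpa [hev] using h1

/-- A nonnegative binary quadratic form with a nontrivial zero is a multiple of the square of
the linear form vanishing there. -/
theorem exists_eq_mul_sq_of_zero {A B C β γ : ℝ} (hβγ : β ^ 2 + γ ^ 2 ≠ 0)
    (h : ∀ y z, 0 ≤ A * y ^ 2 + B * (y * z) + C * z ^ 2)
    (h0 : A * β ^ 2 + B * (β * γ) + C * γ ^ 2 = 0) :
    ∃ κ, 0 ≤ κ ∧ ∀ y z, A * y ^ 2 + B * (y * z) + C * z ^ 2 = κ * (γ * y - β * z) ^ 2 := by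
  have h1 : 2 * A * β + B * γ = 0 := linear_coeff_eq_zero (b := A) (c := 0) (d := 0) fun t => by
    linarith [h (β + t) γ]
  have h2 : B * β + 2 * C * γ = 0 := linear_coeff_eq_zero (b := C) (c := 0) (d := 0) fun t => by
    linarith [h β (γ + t)]
  have hA : 0 ≤ A := by simpa using h 1 0
  have hC : 0 ≤ C := by simpa using h 0 1
  refine ⟨(A + C) / (β ^ 2 + γ ^ 2), by positivity, fun y z => ?_⟩
  rw [div_mul_eq_mul_div, eq_div_iff hβγ]
  linear_combination (y ^ 2 * β / 2 - z ^ 2 * β / 2 + y * z * γ) * h1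
    + (-y ^ 2 * γ / 2 + z ^ 2 * γ / 2 + y * z * β) * h2

theorem exists_eq_linear_mul_of_zero {A B C β γ : ℝ} (hβγ : β ^ 2 + γ ^ 2 ≠ 0)
    (h0 : A * β ^ 2 + B * (β * γ) + C * γ ^ 2 = 0) :
    ∃ h₁ h₂ : ℝ, ∀ y z,
      A * y ^ 2 + B * (y * z) + C * z ^ 2 = (γ * y - β * z) * (h₁ * y + h₂ * z) := by
  by_cases hγ : γ = 0
  · subst hγ
    have hβ : β ≠ 0 := by rintro rfl; simp at hβγ
    have hA : A = 0 := by simpa [hβ] using h0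
    refine ⟨-B / β, -C / β, fun y z => ?_⟩
    field_simp
    rw [hA]
    ring
  · refine ⟨A / γ, (B + β * A / γ) / γ, fun y z => ?_⟩
    field_simp
    linear_combination z ^ 2 * h0

theorem binary_quadratic_le {a b c : ℝ} (ha : 0 ≤ a) (hc : 0 ≤ c) (y z : ℝ) :
    a * y ^ 2 + b * (y * z) + c * z ^ 2 ≤ (a + c + |b|) * (y ^ 2 + z ^ 2) := by
  have h1 : b * (y * z) ≤ |b| * (y ^ 2 + z ^ 2) :=
    calc b * (y * z) ≤ |b * (y * z)| := le_abs_self _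
      _ = |b| * |y * z| := abs_mul _ _
      _ ≤ _ := by
        gcongr
        rw [abs_le]
        constructor <;> nlinarith [sq_nonneg (y + z), sq_nonneg (y - z)]
  nlinarith [mul_nonneg ha (sq_nonneg z), mul_nonneg hc (sq_nonneg y)]

theorem IsPsdQuartic.hasSquareMinorant_of_two_zeros {P : MvPolynomial (Fin 3) ℝ}
    (hP : IsPsdQuartic P) (h0 : eval ![1, 0, 0] P = 0) (h1 : eval ![0, 1, 0] P = 0) :
    HasSquareMinorant fun v => eval v P := by
  obtain ⟨a, b, c, p, q, r, s, t₀, t₁, t₂, t₃, t₄, hF⟩ := hP.exists_coeff h0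
  have hquad := fun y z => quadratic_nonneg fun x => (hP.nonneg _).trans_eq (hF x y z)
  by_cases hzero : ∃ β γ : ℝ, β ^ 2 + γ ^ 2 ≠ 0 ∧ a * β ^ 2 + b * (β * γ) + c * γ ^ 2 = 0
  · obtain ⟨β, γ, hβγ, h⟩ := hzero
    refine hP.hasSquareMinorant_of_second_difference h0 hβγ ?_
    rw [hF, hF, hF]
    linear_combination 2 * h
  push Not at hzero
  have hpos : ∀ y z : ℝ, y ^ 2 + z ^ 2 ≠ 0 → 0 < a * y ^ 2 + b * (y * z) + c * z ^ 2 :=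
    fun y z h => lt_of_le_of_ne (hquad y z).1 (hzero y z h).symm
  have e0 : t₀ = 0 := by simpa [hF] using h1
  have e1 : t₁ = 0 := linear_coeff_eq_zero (b := t₂) (c := t₃) (d := t₄) fun t => by
    simpa [hF, e0] using hP.nonneg ![0, 1, t]
  have e2 : p = 0 := by simpa [e0] using (hquad 1 0).2.2
  subst e0 e1 e2
  have ha : 0 < a := by simpa using hpos 1 0
  have hc : 0 < c := by simpa using hpos 0 1
  have hD : ∀ y z, 0 ≤ (a * y ^ 2 + b * (y * z) + c * z ^ 2)
      * (t₂ * y ^ 2 + t₃ * (y * z) + t₄ * z ^ 2) - (q * y ^ 2 + r * (y * z) + s * z ^ 2) ^ 2 := by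
    intro y z
    refine nonneg_of_nonneg_of_ne (a := 0) (φ := fun z => (a * y ^ 2 + b * (y * z) + c * z ^ 2)
      * (t₂ * y ^ 2 + t₃ * (y * z) + t₄ * z ^ 2) - (q * y ^ 2 + r * (y * z) + s * z ^ 2) ^ 2)
      (by fun_prop) (fun z hz => ?_) z
    have h3 := (hquad y z).2.2
    have hz2 : 0 < z ^ 2 := by positivity
    refine le_of_mul_le_mul_left ?_ hz2
    linarith
  by_cases hDzero : ∃ β γ : ℝ, β ^ 2 + γ ^ 2 ≠ 0 ∧ (a * β ^ 2 + b * (β * γ) + c * γ ^ 2)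
      * (t₂ * β ^ 2 + t₃ * (β * γ) + t₄ * γ ^ 2) - (q * β ^ 2 + r * (β * γ) + s * γ ^ 2) ^ 2 = 0
  swap
  · push Not at hDzero
    obtain ⟨ε, hε, hle⟩ := exists_pos_mul_sq_add_sq_pow_le (k := 2)
      (D := fun y z => (a * y ^ 2 + b * (y * z) + c * z ^ 2)
        * (t₂ * y ^ 2 + t₃ * (y * z) + t₄ * z ^ 2) - (q * y ^ 2 + r * (y * z) + s * z ^ 2) ^ 2)
      (by fun_prop) (fun t y z => by ring)
      (fun y z hyz => lt_of_le_of_ne (hD y z) (hDzero y z hyz).symm)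
    have hM : 0 < a + c + |b| := by positivity
    refine hasSquareMinorant_of_le (ρ := ε / (a + c + |b|)) (by positivity) ![0, 0, 1, 0, 0, 0]
      (fun h => by simpa using congrFun h 2) fun x y z => ?_
    simp only [Matrix.cons_val, zero_mul, one_mul, zero_add, add_zero]
    by_cases hyz : y ^ 2 + z ^ 2 = 0
    · have hz : z = 0 := by nlinarith [sq_nonneg y, sq_nonneg z]
      simpa [hz] using hP.nonneg _
    refine le_of_mul_le_mul_left ?_ (hpos y z hyz)
    have hle' := hle y z hyz
    have hM' := binary_quadratic_le (b := b) ha.le hc.le y z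
    calc _ ≤ ((a + c + |b|) * (y ^ 2 + z ^ 2)) * (ε / (a + c + |b|) * (z ^ 2) ^ 2) := by gcongr
      _ = ε * z ^ 2 * (y ^ 2 + z ^ 2) * z ^ 2 := by field_simp
      _ ≤ ε * z ^ 2 * (y ^ 2 + z ^ 2) * (y ^ 2 + z ^ 2) := by
        gcongr
        linarith [sq_nonneg y]
      _ = z ^ 2 * (ε * (y ^ 2 + z ^ 2) ^ 2) := by ring
      _ ≤ z ^ 2 * _ := mul_le_mul_of_nonneg_left hle' (sq_nonneg z)
      _ ≤ _ := by
        rw [hF]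
        linarith [sq_nonneg (x * (a * y ^ 2 + b * (y * z) + c * z ^ 2)
          + z * (q * y ^ 2 + r * (y * z) + s * z ^ 2))]
  obtain ⟨β, γ, hβγ, hDβγ⟩ := hDzero
  have hφ := hpos β γ hβγ
  obtain ⟨α, hα⟩ : ∃ α, q * β ^ 2 + r * (β * γ) + s * γ ^ 2
      + α * (a * β ^ 2 + b * (β * γ) + c * γ ^ 2) = 0 :=
    ⟨-(q * β ^ 2 + r * (β * γ) + s * γ ^ 2) / (a * β ^ 2 + b * (β * γ) + c * γ ^ 2), by
      rw [div_mul_cancel₀ _ hφ.ne']; ring⟩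
  have hD' : ∀ y z, ((q + α * a) * y ^ 2 + (r + α * b) * (y * z) + (s + α * c) * z ^ 2) ^ 2 ≤
      (a * y ^ 2 + b * (y * z) + c * z ^ 2) * ((t₂ + 2 * α * q + α ^ 2 * a) * y ^ 2
        + (t₃ + 2 * α * r + α ^ 2 * b) * (y * z) + (t₄ + 2 * α * s + α ^ 2 * c) * z ^ 2) := by
    intro y z
    linarith [hD y z]
  obtain ⟨κ, hκ, hg⟩ := exists_eq_mul_sq_of_zero (A := t₂ + 2 * α * q + α ^ 2 * a)
    (B := t₃ + 2 * α * r + α ^ 2 * b) (C := t₄ + 2 * α * s + α ^ 2 * c) hβγ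
    (fun y z => by
      by_cases hyz : y ^ 2 + z ^ 2 = 0
      · have hz : z = 0 := by nlinarith [sq_nonneg y, sq_nonneg z]
        have hy : y = 0 := by nlinarith [sq_nonneg y, sq_nonneg z]
        simp [hy, hz]
      · exact nonneg_of_mul_nonneg_right ((sq_nonneg _).trans (hD' y z)) (hpos y z hyz))
    (by
      refine (mul_eq_zero.mp ?_).resolve_left hφ.ne'
      linear_combination hDβγ + (q * β ^ 2 + r * (β * γ) + s * γ ^ 2
      + α * (a * β ^ 2 + b * (β * γ) + c * γ ^ 2)) * hα)
  obtain ⟨h₁, h₂, hl⟩ := exists_eq_linear_mul_of_zero (A := q + α * a) (B := r + α * b)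
    (C := s + α * c) hβγ (by linear_combination hα)
  have hP' : ∀ x y z, eval ![x, y, z] P = (a * y ^ 2 + b * (y * z) + c * z ^ 2) * (x - α * z) ^ 2
      + 2 * (x - α * z) * z * ((γ * y - β * z) * (h₁ * y + h₂ * z))
      + z ^ 2 * (κ * (γ * y - β * z) ^ 2) := by
    intro x y z
    rw [hF, ← hl, ← hg]
    ring
  simp only [hg, hl] at hD'
  rcases hκ.eq_or_lt with hκ | hκ
  · subst hκ
    obtain ⟨δ, hδ, hle⟩ := exists_pos_mul_sq_add_sq_pow_le (k := 1)
      (D := fun y z => a * y ^ 2 + b * (y * z) + c * z ^ 2)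
      (by fun_prop) (fun t y z => by ring) hpos
    refine hasSquareMinorant_of_le hδ ![0, 0, -α, 0, 1, 0]
      (fun h => by simpa using congrFun h 4) fun x y z => ?_
    have hl0 : (γ * y - β * z) * (h₁ * y + h₂ * z) = 0 := by
      refine pow_eq_zero_iff two_ne_zero |>.mp (le_antisymm ?_ (sq_nonneg _))
      simpa using hD' y z
    rw [hP', hl0]
    simp only [Matrix.cons_val, zero_mul, one_mul, zero_add, add_zero, mul_zero]
    by_cases hyz : y ^ 2 + z ^ 2 = 0
    · have hz : z = 0 := by nlinarith [sq_nonneg y, sq_nonneg z]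
      have hy : y = 0 := by nlinarith [sq_nonneg y, sq_nonneg z]
      simp [hy, hz]
    calc δ * (-α * z ^ 2 + x * z) ^ 2 = δ * z ^ 2 * (x - α * z) ^ 2 := by ring
      _ ≤ δ * (y ^ 2 + z ^ 2) ^ 1 * (x - α * z) ^ 2 := by
        gcongr
        linarith [sq_nonneg y]
      _ ≤ _ := mul_le_mul_of_nonneg_right (hle y z hyz) (sq_nonneg _)
  · have hh : ∀ y z, 0 ≤ κ * (a * y ^ 2 + b * (y * z) + c * z ^ 2) - (h₁ * y + h₂ * z) ^ 2 := by
      intro y z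
      have key := nonneg_of_nonneg_of_ne (a := -(γ * y - β * z) / (β ^ 2 + γ ^ 2))
        (φ := fun t => κ * (a * (y + t * γ) ^ 2 + b * ((y + t * γ) * (z - t * β))
          + c * (z - t * β) ^ 2) - (h₁ * (y + t * γ) + h₂ * (z - t * β)) ^ 2)
        (by fun_prop) (fun t ht => ?_) 0
      · simpa using key
      · have hw : γ * (y + t * γ) - β * (z - t * β) ≠ 0 := by
          intro hw
          apply ht
          rw [eq_div_iff hβγ]
          linear_combination hw
        have := hD' (y + t * γ) (z - t * β)
        refine le_of_mul_le_mul_left ?_ (show 0 < (γ * (y + t * γ) - β * (z - t * β)) ^ 2 by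
          positivity)
        linarith
    refine hasSquareMinorant_of_le (ρ := 1 / κ) (by positivity)
      ![0, 0, -κ * β - α * h₂, h₁, h₂, κ * γ - α * h₁] (fun h => hβγ ?_) fun x y z => ?_
    · have k1 : h₁ = 0 := by simpa using congrFun h 3
      have k2 : h₂ = 0 := by simpa using congrFun h 4
      have k3 : β = 0 := by simpa [k2, hκ.ne'] using congrFun h 2
      have k4 : γ = 0 := by simpa [k1, hκ.ne'] using congrFun h 5
      simp [k3, k4]
    · rw [hP', one_div, inv_mul_le_iff₀ hκ]
      simp only [Matrix.cons_val, zero_mul, zero_add]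
      linarith [mul_nonneg (sq_nonneg (x - α * z)) (hh y z)]

theorem IsPsdQuartic.hasSquareMinorant_of_zero {P : MvPolynomial (Fin 3) ℝ}
    (hP : IsPsdQuartic P) (h0 : eval ![1, 0, 0] P = 0) :
    HasSquareMinorant fun v => eval v P := by
  obtain ⟨a, b, c, p, q, r, s, t₀, t₁, t₂, t₃, t₄, hF⟩ := hP.exists_coeff h0
  have hquad := fun y z => quadratic_nonneg fun x => (hP.nonneg _).trans_eq (hF x y z)
  by_cases hzero : ∃ β γ : ℝ, β ^ 2 + γ ^ 2 ≠ 0 ∧ a * β ^ 2 + b * (β * γ) + c * γ ^ 2 = 0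
  · obtain ⟨β, γ, hβγ, h⟩ := hzero
    refine hP.hasSquareMinorant_of_second_difference h0 hβγ ?_
    rw [hF, hF, hF]
    linear_combination 2 * h
  push Not at hzero
  have hpos : ∀ y z : ℝ, y ^ 2 + z ^ 2 ≠ 0 → 0 < a * y ^ 2 + b * (y * z) + c * z ^ 2 :=
    fun y z h => lt_of_le_of_ne (hquad y z).1 (hzero y z h).symm
  have ha : 0 < a := by simpa using hpos 1 0
  have hc : 0 < c := by simpa using hpos 0 1
  by_cases hDzero : ∃ β γ : ℝ, β ^ 2 + γ ^ 2 ≠ 0 ∧ (a * β ^ 2 + b * (β * γ) + c * γ ^ 2)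
      * (t₀ * β ^ 4 + t₁ * (β ^ 3 * γ) + t₂ * (β ^ 2 * γ ^ 2) + t₃ * (β * γ ^ 3) + t₄ * γ ^ 4)
      - (p * β ^ 3 + q * (β ^ 2 * γ) + r * (β * γ ^ 2) + s * γ ^ 3) ^ 2 = 0
  · obtain ⟨β, γ, hβγ, hD⟩ := hDzero
    have hφ := hpos β γ hβγ
    obtain ⟨x₀, hx₀⟩ : ∃ x₀, x₀ * (a * β ^ 2 + b * (β * γ) + c * γ ^ 2)
        + (p * β ^ 3 + q * (β ^ 2 * γ) + r * (β * γ ^ 2) + s * γ ^ 3) = 0 :=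
      ⟨-(p * β ^ 3 + q * (β ^ 2 * γ) + r * (β * γ ^ 2) + s * γ ^ 3)
        / (a * β ^ 2 + b * (β * γ) + c * γ ^ 2), by rw [div_mul_cancel₀ _ hφ.ne']; ring⟩
    obtain ⟨P', hP', hev, himp⟩ := hP.exists_shear x₀ hβγ
    refine himp (hP'.hasSquareMinorant_of_two_zeros ?_ ?_)
    · simpa [hev] using h0
    · rw [hev]
      simp only [zero_add, mul_one, mul_zero, sub_zero, add_zero]
      refine (mul_eq_zero.mp ?_).resolve_left hφ.ne'
      rw [hF]
      linear_combination hD + (x₀ * (a * β ^ 2 + b * (β * γ) + c * γ ^ 2)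
        + (p * β ^ 3 + q * (β ^ 2 * γ) + r * (β * γ ^ 2) + s * γ ^ 3)) * hx₀
  · push Not at hDzero
    obtain ⟨ε, hε, hle⟩ := exists_pos_mul_sq_add_sq_pow_le (k := 3)
      (D := fun y z => (a * y ^ 2 + b * (y * z) + c * z ^ 2)
      * (t₀ * y ^ 4 + t₁ * (y ^ 3 * z) + t₂ * (y ^ 2 * z ^ 2) + t₃ * (y * z ^ 3) + t₄ * z ^ 4)
      - (p * y ^ 3 + q * (y ^ 2 * z) + r * (y * z ^ 2) + s * z ^ 3) ^ 2)
      (by fun_prop) (fun t y z => by ring)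
      (fun y z hyz => lt_of_le_of_ne (sub_nonneg.mpr (hquad y z).2.2) (hDzero y z hyz).symm)
    have hM : 0 < a + c + |b| := by positivity
    refine hasSquareMinorant_of_le (ρ := ε / (a + c + |b|)) (by positivity) ![0, 1, 1, 0, 0, 0]
      (fun h => by simpa using congrFun h 2) fun x y z => ?_
    simp only [Matrix.cons_val, zero_mul, one_mul, zero_add, add_zero]
    by_cases hyz : y ^ 2 + z ^ 2 = 0
    · simpa [hyz] using hP.nonneg _
    refine le_of_mul_le_mul_left ?_ (hpos y z hyz)
    have hle' := hle y z hyz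
    have hM' := binary_quadratic_le (b := b) ha.le hc.le y z
    calc _ ≤ ((a + c + |b|) * (y ^ 2 + z ^ 2)) * (ε / (a + c + |b|) * (y ^ 2 + z ^ 2) ^ 2) := by
          gcongr
      _ = ε * (y ^ 2 + z ^ 2) ^ 3 := by field_simp
      _ ≤ _ := hle'
      _ ≤ _ := by
        rw [hF]
        linarith [sq_nonneg (x * (a * y ^ 2 + b * (y * z) + c * z ^ 2)
          + (p * y ^ 3 + q * (y ^ 2 * z) + r * (y * z ^ 2) + s * z ^ 3))]

/-- A nonzero nonnegative ternary quartic form dominates the square of a nonzero quadratic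
form. -/
theorem IsPsdQuartic.hasSquareMinorant {P : MvPolynomial (Fin 3) ℝ} (hP : IsPsdQuartic P) :
    HasSquareMinorant fun v => eval v P := by
  by_cases h : ∃ v, v ≠ 0 ∧ eval v P = 0
  · obtain ⟨v, hv, h0⟩ := h
    have he : (![1, 0, 0] : Fin 3 → ℝ) ≠ 0 := fun h => by simpa using congrFun h 0
    obtain ⟨A, hA⟩ := SeparatingDual.exists_continuousLinearEquiv_apply_eq (R := ℝ) he hv
    obtain ⟨P', hP', hev, himp⟩ := hP.exists_comp (A := A.toLinearEquiv.toLinearMap)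
      (B := A.symm.toLinearEquiv.toLinearMap) (fun v => by simp) (fun v => by simp)
    refine himp (hP'.hasSquareMinorant_of_zero ?_)
    rw [hev]
    simpa [hA] using h0
  · push Not at h
    obtain ⟨ε, hε, hle⟩ := exists_pos_mul_sum_sq_pow_le (k := 2)
      (MvPolynomial.continuous_eval P) (fun t v => hP.hom.eval_smul t v)
      (fun v hv => lt_of_le_of_ne (hP.nonneg v) (h v hv).symm)
    refine hasSquareMinorant_of_le hε ![1, 1, 1, 0, 0, 0]
      (fun h => by simpa using congrFun h 2) fun x y z => ?_
    by_cases hv : (![x, y, z] : Fin 3 → ℝ) = 0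
    · have h1 := congrFun hv 0
      have h2 := congrFun hv 1
      have h3 := congrFun hv 2
      simp at h1 h2 h3
      subst h1 h2 h3
      simpa using hP.nonneg _
    · simpa [Fin.sum_univ_three] using hle _ hv

/-- The vector of monomials of degree at most two in two variables, ordered as the coefficients
of `ternaryQuad`. -/
def quadVec (x : Fin 2 → ℝ) : Fin 6 → ℝ :=
  ![x 0 ^ 2, x 1 ^ 2, 1, x 0 * x 1, x 0, x 1]

theorem ternaryQuad_eq_sum_quadVec (c : Fin 6 → ℝ) (x : Fin 2 → ℝ) :
    ternaryQuad c ![x 0, x 1, 1] = ∑ i, c i * quadVec x i := by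
  simp [ternaryQuad_vec, quadVec, Fin.sum_univ_six]

theorem IsPsdQuartic.exists_homogenization {R : MvPolynomial (Fin 2) ℝ} (hdeg : R.totalDegree ≤ 4)
    (hR : ∀ x, 0 ≤ eval x R) (hne : R ≠ 0) :
    ∃ P, IsPsdQuartic P ∧ ∀ x : Fin 2 → ℝ, eval ![x 0, x 1, 1] P = eval x R := by
  obtain ⟨c, hc, hev⟩ := exists_coeff_two hdeg
  let P : MvPolynomial (Fin 3) ℝ := ∑ i ∈ Finset.range 5, ∑ j ∈ Finset.range 5,
    C (c i j) * (X 0 ^ i * X 1 ^ j * X 2 ^ (4 - i - j))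
  have hP : P.IsHomogeneous 4 := by
    refine IsHomogeneous.sum _ _ _ fun i _ => IsHomogeneous.sum _ _ _ fun j _ => ?_
    rcases lt_or_ge 4 (i + j) with h | h
    · rw [hc i j h, C_0, zero_mul]
      exact isHomogeneous_zero _ _ _
    · refine IsHomogeneous.C_mul ?_ _
      have := ((isHomogeneous_X_pow (R := ℝ) (0 : Fin 3) i).mul
        (isHomogeneous_X_pow (1 : Fin 3) j)).mul (isHomogeneous_X_pow (2 : Fin 3) (4 - i - j))
      rwa [show i + j + (4 - i - j) = 4 by omega] at this
  have heP : ∀ x : Fin 2 → ℝ, eval ![x 0, x 1, 1] P = eval x R := by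
    intro x
    rw [hev]
    simp [P]
  have hnn : ∀ x y z, 0 ≤ eval ![x, y, z] P := by
    intro x y z
    refine nonneg_of_nonneg_of_ne (a := 0) (φ := fun z => eval ![x, y, z] P)
      ((MvPolynomial.continuous_eval P).comp (by fun_prop)) (fun z hz => ?_) z
    have hv : (![x, y, z] : Fin 3 → ℝ) = z • ![x / z, y / z, 1] := by
      ext i
      fin_cases i <;> simp <;> field_simp
    simp only [hv]
    rw [hP.eval_smul]
    have := heP ![x / z, y / z]
    simp only [Matrix.cons_val] at this
    rw [this]
    have := hR ![x / z, y / z]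
    positivity
  refine ⟨P, ⟨hP, fun v => ?_, ?_⟩, heP⟩
  · have hv : v = ![v 0, v 1, v 2] := vec_three_eta v
    rw [hv]
    exact hnn _ _ _
  · by_contra! h
    refine hne (MvPolynomial.funext fun x => ?_)
    rw [← heP, h, map_zero]

theorem exists_sq_quadVec_le {R : MvPolynomial (Fin 2) ℝ} (hdeg : R.totalDegree ≤ 4)
    (hR : ∀ x, 0 ≤ eval x R) (hne : R ≠ 0) :
    ∃ ρ : ℝ, 0 < ρ ∧ ∃ c : Fin 6 → ℝ, c ≠ 0 ∧
      ∀ x, ρ * (∑ i, c i * quadVec x i) ^ 2 ≤ eval x R := by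
  obtain ⟨P, hP, hev⟩ := IsPsdQuartic.exists_homogenization hdeg hR hne
  obtain ⟨ρ, hρ, c, hc, hle⟩ := hP.hasSquareMinorant
  refine ⟨ρ, hρ, c, hc, fun x => ?_⟩
  rw [← hev, ← ternaryQuad_eq_sum_quadVec]
  exact hle _

theorem exists_pos_mul_sum_sq_le_quadVec : ∃ ε : ℝ, 0 < ε ∧ ∃ p : Fin 6 → Fin 2 → ℝ,
    ∀ c : Fin 6 → ℝ, ε * ∑ i, c i ^ 2 ≤ ∑ k, (∑ i, c i * quadVec (p k) i) ^ 2 := by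
  let p : Fin 6 → Fin 2 → ℝ := ![![0, 0], ![1, 0], ![-1, 0], ![0, 1], ![0, -1], ![1, 1]]
  obtain ⟨ε, hε, h⟩ := exists_pos_mul_sum_sq_pow_le (k := 1)
    (D := fun c : Fin 6 → ℝ => ∑ k, (∑ i, c i * quadVec (p k) i) ^ 2) (by fun_prop)
    (fun t c => by
      simp only [Pi.smul_apply, smul_eq_mul, mul_assoc, ← Finset.mul_sum, mul_pow, mul_one])
    (fun c hc => by
      refine lt_of_le_of_ne (Finset.sum_nonneg fun _ _ => sq_nonneg _) fun h0 => hc ?_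
      have h' := (Finset.sum_eq_zero_iff_of_nonneg fun _ _ => sq_nonneg _).mp h0.symm
      have e := fun k => pow_eq_zero_iff two_ne_zero |>.mp (h' k (Finset.mem_univ k))
      have e0 := e 0
      have e1 := e 1
      have e2 := e 2
      have e3 := e 3
      have e4 := e 4
      have e5 := e 5
      simp [quadVec, Fin.sum_univ_six, p] at e0 e1 e2 e3 e4 e5
      ext i
      fin_cases i <;> simp <;> linarith)
  refine ⟨ε, hε, p, fun c => ?_⟩
  by_cases hc : c = 0
  · simp [hc]
  · simpa using h c hc

/-- Among the Gram matrices of sums of squares below a polynomial there is one of maximal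
trace. -/
theorem exists_posSemidef_maximal_trace {F : (Fin 2 → ℝ) → ℝ} (hF : ∀ x, 0 ≤ F x) :
    ∃ Q : Matrix (Fin 6) (Fin 6) ℝ, Q.PosSemidef ∧
      (∀ x, ∑ i, ∑ j, Q i j * (quadVec x i * quadVec x j) ≤ F x) ∧
      ∀ Q' : Matrix (Fin 6) (Fin 6) ℝ, Q'.PosSemidef →
        (∀ x, ∑ i, ∑ j, Q' i j * (quadVec x i * quadVec x j) ≤ F x) → Q'.trace ≤ Q.trace := by
  obtain ⟨ε, hε, p, hp⟩ := exists_pos_mul_sum_sq_le_quadVec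
  set K : Set (Matrix (Fin 6) (Fin 6) ℝ) := {Q | Q.PosSemidef ∧
    ∀ x, ∑ i, ∑ j, Q i j * (quadVec x i * quadVec x j) ≤ F x} with hK
  set T := (∑ k, F (p k)) / ε
  have hbound : K ⊆ Set.univ.pi fun _ => Set.univ.pi fun _ => Set.Icc (-T) T := by
    rintro Q ⟨hQ, hQF⟩ i - j -
    obtain ⟨m, B, rfl⟩ := Matrix.posSemidef_iff_eq_sum_vecMulVec.mp hQ
    have hval : ∀ u : Fin 6 → ℝ, ∑ i, ∑ j, (∑ l, Matrix.vecMulVec (B l) (star (B l))) i j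
        * (u i * u j) = ∑ l, (∑ i, B l i * u i) ^ 2 := by
      intro u
      have hsq : ∀ l, (∑ i, B l i * u i) ^ 2 = ∑ i, ∑ j, B l i * B l j * (u i * u j) := by
        intro l
        rw [sq, Finset.sum_mul_sum]
        exact Finset.sum_congr rfl fun i _ => Finset.sum_congr rfl fun j _ => by ring
      simp only [Matrix.sum_apply, Matrix.vecMulVec_apply, star_trivial, hsq, Finset.sum_mul]
      symm
      rw [Finset.sum_comm]
      exact Finset.sum_congr rfl fun i _ => Finset.sum_comm
    have htrace : ∑ l, ∑ i, B l i ^ 2 ≤ T := by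
      rw [le_div_iff₀ hε, mul_comm, Finset.mul_sum]
      calc ∑ l, ε * ∑ i, B l i ^ 2 ≤ ∑ l, ∑ k, (∑ i, B l i * quadVec (p k) i) ^ 2 :=
            Finset.sum_le_sum fun l _ => hp (B l)
        _ = ∑ k, ∑ l, (∑ i, B l i * quadVec (p k) i) ^ 2 := Finset.sum_comm
        _ ≤ ∑ k, F (p k) := Finset.sum_le_sum fun k _ => (hval _).symm.trans_le (hQF (p k))
    rw [Set.mem_Icc, ← abs_le]
    refine le_trans ?_ htrace
    simp only [Matrix.sum_apply, Matrix.vecMulVec_apply, star_trivial]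
    refine (Finset.abs_sum_le_sum_abs _ _).trans (Finset.sum_le_sum fun l _ => ?_)
    have hi := Finset.single_le_sum (f := fun i => B l i ^ 2) (fun _ _ => sq_nonneg _)
      (Finset.mem_univ i)
    have hj := Finset.single_le_sum (f := fun i => B l i ^ 2) (fun _ _ => sq_nonneg _)
      (Finset.mem_univ j)
    rw [abs_le]
    constructor <;> nlinarith [sq_nonneg (B l i + B l j), sq_nonneg (B l i - B l j)]
  have hclosed : IsClosed K := by
    have : K = {Q | Q.transpose = Q} ∩ (⋂ u : Fin 6 → ℝ, {Q | 0 ≤ u ⬝ᵥ Q.mulVec u}) ∩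
        ⋂ x, {Q | ∑ i, ∑ j, Q i j * (quadVec x i * quadVec x j) ≤ F x} := by
      ext Q
      simp [hK, Matrix.posSemidef_iff_dotProduct_mulVec, Matrix.IsHermitian,
        Matrix.conjTranspose_eq_transpose_of_trivial]
    rw [this]
    refine ((isClosed_eq (by fun_prop) continuous_id).inter
      (isClosed_iInter fun u => isClosed_le continuous_const (by fun_prop))).inter
      (isClosed_iInter fun x => isClosed_le ?_ continuous_const)
    fun_prop
  have hcompact : IsCompact K := IsCompact.of_isClosed_subset
    (isCompact_univ_pi fun _ => isCompact_univ_pi fun _ => isCompact_Icc) hclosed hbound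
  obtain ⟨Q, hQ, hmax⟩ := hcompact.exists_isMaxOn (f := Matrix.trace)
    ⟨0, Matrix.PosSemidef.zero, fun x => by simpa using hF x⟩
    (Continuous.continuousOn (by fun_prop))
  exact ⟨Q, hQ.1, hQ.2, fun Q' h1 h2 => hmax ⟨h1, h2⟩⟩

/-- Hilbert's theorem: nonnegative bivariate quartics are sums of squares. -/
theorem add_eq_PosCone_two_two :
    {f | ∃ g ∈ SOSCone 2 2, ∃ h ∈ SONCCone 2 2, f = g + h} = PosCone 2 2 Set.univ := by
  refine add_eq_PosCone_of_forall_sos fun f hf => ?_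
  obtain ⟨Q, hQ, hle, hmax⟩ := exists_posSemidef_maximal_trace (F := fun x => eval x f)
    fun x => hf.2 x (Set.mem_univ x)
  let m : Fin 6 → MvPolynomial (Fin 2) ℝ := ![X 0 ^ 2, X 1 ^ 2, 1, X 0 * X 1, X 0, X 1]
  have hm : ∀ x i, eval x (m i) = quadVec x i := by
    intro x i
    fin_cases i <;> simp [m, quadVec]
  have hmd : ∀ i, (m i).totalDegree ≤ 2 := by
    intro i
    fin_cases i
    · exact totalDegree_pow_le_of_le_one 2 (by simp)
    · exact totalDegree_pow_le_of_le_one 2 (by simp)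
    · simp [m]
    · exact totalDegree_mul_le_of_le (k := 1) (l := 1) (by simp) (by simp)
    · simp [m]
    · simp [m]
  set S := ∑ i, ∑ j, C (Q i j) * (m i * m j) with hS
  have hSev : ∀ x, eval x S = ∑ i, ∑ j, Q i j * (quadVec x i * quadVec x j) := by
    intro x
    simp [hS, hm]
  obtain ⟨r, g, hg⟩ := exists_sum_sq_of_posSemidef hQ m
  by_cases hfS : f - S = 0
  · exact ⟨r, g, (sub_eq_zero.mp hfS).trans hg⟩
  exfalso
  have hSdeg : S.totalDegree ≤ 4 := by
    refine totalDegree_finsetSum_le fun i _ => totalDegree_finsetSum_le fun j _ => ?_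
    exact totalDegree_mul_le_of_le (k := 0) (l := 4) (by simp)
      (totalDegree_mul_le_of_le (hmd i) (hmd j))
  obtain ⟨ρ, hρ, c, hc, hR⟩ := exists_sq_quadVec_le (totalDegree_sub_le_of_le hf.1 hSdeg)
    (fun x => by rw [map_sub, hSev]; exact sub_nonneg.mpr (hle x)) hfS
  have h := hmax (Q + ρ • Matrix.vecMulVec c (star c))
    (hQ.add ((Matrix.posSemidef_vecMulVec_self_star c).smul hρ.le)) fun x => by
      have h1 := hR x
      rw [map_sub, hSev] at h1
      refine le_trans (le_of_eq ?_) (le_sub_iff_add_le'.mp h1)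
      rw [sq, Finset.sum_mul_sum, Finset.mul_sum, ← Finset.sum_add_distrib]
      refine Finset.sum_congr rfl fun i _ => ?_
      rw [Finset.mul_sum, ← Finset.sum_add_distrib]
      refine Finset.sum_congr rfl fun j _ => ?_
      simp [Matrix.vecMulVec_apply]
      ring
  have hpos : 0 < c ⬝ᵥ star c := by
    rw [star_trivial]
    refine lt_of_le_of_ne (Finset.sum_nonneg fun i _ => mul_self_nonneg _) fun h0 => hc ?_
    exact dotProduct_self_eq_zero.mp h0.symm
  rw [Matrix.trace_add, Matrix.trace_smul, Matrix.trace_vecMulVec, smul_eq_mul] at h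
  nlinarith [mul_pos hρ hpos]

/-- Corollary 2.15: `Σ_{n,2d} + C_{n,2d} ≠ P_{n,2d}` iff `n,d ≥ 2` and `(n,d) ≠ (2,2)`. -/
theorem stmt_10 (n d : ℕ) (hn : 1 ≤ n) (hd : 1 ≤ d) :
    {f | ∃ g ∈ SOSCone n d, ∃ h ∈ SONCCone n d, f = g + h} ≠ PosCone n d Set.univ ↔
    (2 ≤ n ∧ 2 ≤ d ∧ (n, d) ≠ (2, 2)) := by
  constructor
  · refine fun h => ⟨?_, ?_, ?_⟩
    · by_contra! hn'
      obtain rfl : n = 1 := by omega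
      exact h (add_eq_PosCone_one_left d)
    · by_contra! hd'
      obtain rfl : d = 1 := by omega
      exact h (add_eq_PosCone_one_right n)
    · rintro ⟨⟩
      exact h add_eq_PosCone_two_two
  · rintro ⟨hn', hd', hne⟩
    rcases hn'.eq_or_lt with rfl | hn'
    · exact add_ne_PosCone_two (lt_of_le_of_ne hd' fun h => hne (by rw [← h]))
    · exact add_ne_PosCone_of_three_le hn' hd'
end

section
/- (Key lemma) For all k,m ∈ ℕ there exists N ∈ ℕ with the following property: if S is a finite set with |S| ≥ k, and for every k-element subset T of S there is a tuple A_T ∈ (𝒮₊ᵏ)^m and for every s ∈ S there is a tuple B_s ∈ (𝒮₊ᵏ)^m, such that ⟨A_T, B_s⟩ = 0 holds if and only if s ∈ T, then |S| < N. -/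
open MvPolynomial

/-- Off-diagonal Ramsey theorem for `(k + 1)`-uniform hypergraphs, with target size `f a` for the
colour `a`, deduced from the diagonal one for `k`-uniform hypergraphs. -/
theorem ramsey_off_diagonal_succ {κ : Type} [Fintype κ] {k : ℕ}
    (ih : ∀ r : ℕ, ∃ N : ℕ, ∀ (ι : Type) (S : Finset ι) (c : Finset ι → κ), N ≤ S.card →
      ∃ W ⊆ S, W.card = r ∧ ∃ a, ∀ T ⊆ W, T.card = k → c T = a)
    (n : ℕ) (f : κ → ℕ) (hf : ∑ a, f a = n) :
    ∃ N : ℕ, ∀ (ι : Type) (S : Finset ι) (c : Finset ι → κ), N ≤ S.card →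
      ∃ a, ∃ W ⊆ S, W.card = f a ∧ ∀ T ⊆ W, T.card = k + 1 → c T = a := by
  classical
  induction n using Nat.strong_induction_on generalizing f with
  | _ n ihn =>
  by_cases h0 : ∃ a, f a = 0
  · obtain ⟨a, ha⟩ := h0
    refine ⟨0, fun ι S c _ => ⟨a, ∅, Finset.empty_subset _, by simp [ha], fun T hT hT' => ?_⟩⟩
    simp [Finset.subset_empty.mp hT] at hT'
  push Not at h0
  have hdec (a : κ) : ∑ b, Function.update f a (f a - 1) b < n := by
    rw [← hf]
    refine Finset.sum_lt_sum (fun b _ => ?_) ⟨a, Finset.mem_univ a, ?_⟩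
    · rcases eq_or_ne b a with rfl | hb <;> simp [*]
    · have := h0 a
      simp only [Function.update_self]
      omega
  choose M hM using fun a => ihn _ (hdec a) _ rfl
  obtain ⟨N, hN⟩ := ih (Finset.univ.sup M)
  refine ⟨N + 1, fun ι S c hS => ?_⟩
  obtain ⟨x, hx⟩ := Finset.card_pos.mp (show 0 < S.card by omega)
  obtain ⟨R, hRS, hRcard, a, hR⟩ := hN ι (S.erase x) (fun T => c (insert x T)) (by
    rw [Finset.card_erase_of_mem hx]; omega)
  obtain ⟨b, W, hWR, hWcard, hW⟩ := hM a ι R c (hRcard ▸ Finset.le_sup (Finset.mem_univ a))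
  have hWS : W ⊆ S.erase x := hWR.trans hRS
  by_cases hb : b = a
  · subst hb
    have hxW : x ∉ W := fun h => by simpa using hWS h
    refine ⟨b, insert x W, Finset.insert_subset hx (hWS.trans (Finset.erase_subset _ _)), ?_, ?_⟩
    · have := h0 b
      rw [Finset.card_insert_of_notMem hxW, hWcard, Function.update_self]
      omega
    · intro T hT hTcard
      by_cases hxT : x ∈ T
      · rw [← Finset.insert_erase hxT]
        refine hR _ ((Finset.subset_insert_iff.mp hT).trans hWR) ?_
        rw [Finset.card_erase_of_mem hxT]
        omega
      · exact hW T ((Finset.subset_insert_iff_of_notMem hxT).mp hT) hTcard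
  · exact ⟨b, W, hWS.trans (Finset.erase_subset _ _), by simpa [hb] using hWcard, hW⟩

/-- Ramsey's theorem for `k`-uniform hypergraphs with finitely many colours. -/
theorem ramsey_hypergraph {κ : Type} [Fintype κ] (k r : ℕ) :
    ∃ N : ℕ, ∀ (ι : Type) (S : Finset ι) (c : Finset ι → κ), N ≤ S.card →
      ∃ W ⊆ S, W.card = r ∧ ∃ a, ∀ T ⊆ W, T.card = k → c T = a := by
  induction k generalizing r with
  | zero =>
    refine ⟨r, fun ι S c hS => ?_⟩
    obtain ⟨W, hWS, hW⟩ := Finset.exists_subset_card_eq hS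
    exact ⟨W, hWS, hW, c ∅, fun T _ hT => by rw [Finset.card_eq_zero.mp hT]⟩
  | succ k ih =>
    obtain ⟨N, hN⟩ := ramsey_off_diagonal_succ ih _ (fun _ : κ => r) rfl
    refine ⟨N, fun ι S c hS => ?_⟩
    obtain ⟨a, W, hWS, hW, hc⟩ := hN ι S c hS
    exact ⟨W, hWS, hW, a, hc⟩

/-- Among more than `dim V` subspaces of `V`, if all sums omitting exactly one of the subspaces
have the same dimension, then each subspace is contained in the sum of the others. -/
theorem le_sup_erase_of_finrank_eq {K V ι : Type*} [DivisionRing K] [AddCommGroup V] [Module K V]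
    [FiniteDimensional K V] [DecidableEq ι] (U : ι → Submodule K V) (W : Finset ι)
    (hW : Module.finrank K V < W.card) (r : ℕ)
    (hr : ∀ w ∈ W, Module.finrank K ↥((W.erase w).sup U) = r) {w : ι} (hw : w ∈ W) :
    U w ≤ (W.erase w).sup U := by
  obtain ⟨v, hv, hvU⟩ : ∃ v ∈ W, U v ≤ (W.erase v).sup U := by
    by_contra! h
    have hcard : ∀ T ⊆ W, T.card ≤ Module.finrank K ↥(T.sup U) := by
      intro T
      induction T using Finset.induction_on with
      | empty => simp
      | insert x T hx ih =>
        intro hT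
        have hle : T.sup U ≤ (W.erase x).sup U := Finset.sup_mono fun y hy =>
          Finset.mem_erase.mpr ⟨fun e => hx (e ▸ hy), hT (Finset.mem_insert_of_mem hy)⟩
        have hlt : T.sup U < (insert x T).sup U := by
          rw [Finset.sup_insert, right_lt_sup]
          exact fun hU => h x (hT (Finset.mem_insert_self x T)) (hU.trans hle)
        rw [Finset.card_insert_of_notMem hx]
        exact (Nat.succ_le_succ (ih ((Finset.subset_insert x T).trans hT))).trans
          (Submodule.finrank_lt_finrank_of_lt hlt)
    exact hW.not_ge ((hcard W subset_rfl).trans (Submodule.finrank_le _))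
  have hsup : (W.erase v).sup U = W.sup U := by
    conv_rhs => rw [← Finset.insert_erase hv, Finset.sup_insert]
    exact (sup_eq_right.mpr hvU).symm
  have heq : (W.erase w).sup U = W.sup U :=
    Submodule.eq_of_le_of_finrank_eq (Finset.sup_mono (Finset.erase_subset w W))
      (by rw [hr w hw, ← hr v hv, hsup])
  exact heq ▸ Finset.le_sup hw

namespace Matrix.PosSemidef

open scoped MatrixOrder

variable {n : Type*} [Fintype n] {A B : Matrix n n ℝ}

theorem trace_mul_nonneg (hA : A.PosSemidef) (hB : B.PosSemidef) : 0 ≤ (A * B).trace := by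
  classical
  obtain ⟨Y, rfl⟩ := CStarAlgebra.nonneg_iff_eq_star_mul_self.mp hB.nonneg
  rw [← mul_assoc, trace_mul_comm, ← mul_assoc]
  exact (hA.mul_mul_conjTranspose_same Y).trace_nonneg

theorem trace_mul_eq_zero_iff (hA : A.PosSemidef) (hB : B.PosSemidef) :
    (A * B).trace = 0 ↔ A * B = 0 := by
  classical
  refine ⟨fun h => ?_, fun h => by rw [h, trace_zero]⟩
  obtain ⟨X, rfl⟩ := CStarAlgebra.nonneg_iff_eq_star_mul_self.mp hA.nonneg
  obtain ⟨Y, rfl⟩ := CStarAlgebra.nonneg_iff_eq_star_mul_self.mp hB.nonneg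
  simp only [star_eq_conjTranspose] at h ⊢
  have hXY : X * Yᴴ = 0 := by
    rw [← trace_conjTranspose_mul_self_eq_zero_iff, conjTranspose_mul, conjTranspose_conjTranspose,
      ← h, ← mul_assoc (Xᴴ * X), trace_mul_comm _ Y]
    simp only [mul_assoc]
  rw [mul_assoc, ← mul_assoc X, hXY, zero_mul, mul_zero]

end Matrix.PosSemidef

theorem Matrix.range_mulVecLin_le_ker_iff {R l m n : Type*} [CommSemiring R] [Fintype m]
    [Fintype n] {A : Matrix l m R} {B : Matrix m n R} :
    LinearMap.range B.mulVecLin ≤ LinearMap.ker A.mulVecLin ↔ A * B = 0 := by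
  classical
  rw [LinearMap.range_le_ker_iff, ← Matrix.mulVecLin_mul]
  refine ⟨fun h => Matrix.ext_of_mulVec_single fun i => ?_, fun h => by simp [h]⟩
  rw [Matrix.zero_mulVec]
  exact LinearMap.congr_fun h (Pi.single i 1)

theorem sum_inner_eq_zero_iff {k m : ℕ} {A B : Fin m → Matrix (Fin k) (Fin k) ℝ}
    (hA : A ∈ PSDTuple k m) (hB : B ∈ PSDTuple k m) :
    ∑ i, ∑ p, ∑ q, A i p q * B i p q = 0 ↔
      ∀ i, LinearMap.range (B i).mulVecLin ≤ LinearMap.ker (A i).mulVecLin := by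
  have htr (i : Fin m) : ∑ p, ∑ q, A i p q * B i p q = (A i * B i).trace := by
    simp only [Matrix.trace, Matrix.diag_apply, Matrix.mul_apply]
    refine Finset.sum_congr rfl fun p _ => Finset.sum_congr rfl fun q _ => ?_
    rw [← (hB i).isHermitian.apply p q, star_trivial]
  simp only [htr]
  rw [Finset.sum_eq_zero_iff_of_nonneg fun i _ => (hA i).trace_mul_nonneg (hB i)]
  simp only [Finset.mem_univ, true_imp_iff, Matrix.range_mulVecLin_le_ker_iff]
  exact forall_congr' fun i => (hA i).trace_mul_eq_zero_iff (hB i)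

/-- Key lemma (Lemma 4.3): for all `k, m` there is `N` (e.g. the Ramsey number
`R_k(k+1;(k+1)^m)`) such that no set `S` with `|S| ≥ max(k, N)` admits tuples
`A_T ∈ (𝒮₊ᵏ)^m` (for `k`-subsets `T ⊆ S`) and `B_s ∈ (𝒮₊ᵏ)^m` (for `s ∈ S`) with
`⟨A_T, B_s⟩ = 0 ⟺ s ∈ T`. -/
theorem stmt_11 (k m : ℕ) (hk : 1 ≤ k) (hm : 1 ≤ m) :
    ∃ N : ℕ, ∀ (ι : Type) (S : Finset ι)
      (A : Finset ι → Fin m → Matrix (Fin k) (Fin k) ℝ)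
      (B : ι → Fin m → Matrix (Fin k) (Fin k) ℝ),
      k ≤ S.card →
      (∀ T ⊆ S, T.card = k → ∀ i, (A T i).PosSemidef) →
      (∀ s ∈ S, ∀ i, (B s i).PosSemidef) →
      (∀ T ⊆ S, T.card = k → ∀ s ∈ S,
        ((∑ i, ∑ p, ∑ q, A T i p q * B s i p q) = 0 ↔ s ∈ T)) →
      S.card < N := by
  classical
  obtain ⟨N, hN⟩ := ramsey_hypergraph (κ := Fin m → Fin (k + 1)) k (k + 1)
  refine ⟨N, fun ι S A B _ hA hB h => ?_⟩
  by_contra! hS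
  let U (i : Fin m) (s : ι) : Submodule ℝ (Fin k → ℝ) := LinearMap.range (B s i).mulVecLin
  have hdim (V : Submodule ℝ (Fin k → ℝ)) : Module.finrank ℝ V < k + 1 :=
    Nat.lt_succ_of_le ((Submodule.finrank_le V).trans (by simp))
  obtain ⟨W, hWS, hWcard, a, ha⟩ :=
    hN ι S (fun T i => ⟨Module.finrank ℝ ↥(T.sup (U i)), hdim _⟩) hS
  obtain ⟨w, hw⟩ := Finset.card_pos.mp (show 0 < W.card by omega)
  have hcard {v : ι} (hv : v ∈ W) : (W.erase v).card = k := by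
    rw [Finset.card_erase_of_mem hv, hWcard, Nat.add_sub_cancel]
  have hTS : W.erase w ⊆ S := (Finset.erase_subset w W).trans hWS
  refine Finset.notMem_erase w W ((h _ hTS (hcard hw) w (hWS hw)).mp ?_)
  refine (sum_inner_eq_zero_iff (hA _ hTS (hcard hw)) (hB w (hWS hw))).mpr fun i => ?_
  refine (le_sup_erase_of_finrank_eq (U i) W (by simp [hWcard]) (a i) (fun v hv => ?_) hw).trans
    (Finset.sup_le fun s hs => ?_)
  · exact congrArg Fin.val (congrFun (ha _ (Finset.erase_subset v W) (hcard hv)) i)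
  · exact (sum_inner_eq_zero_iff (hA _ hTS (hcard hw)) (hB s (hTS hs))).mp
      ((h _ hTS (hcard hw) s (hTS hs)).mpr hs) i
end

section
/- Let n,d ∈ ℕ, let k = C(n+d,n), and let N ∈ ℕ with N ≥ k. Then the set of all tuples (x¹,…,x^N) ∈ (ℝⁿ)^N such that {v_{n,d}(x¹),…,v_{n,d}(x^N)} is a set of N distinct vectors in general linear position (i.e. every subset of it of cardinality at most k is linearly independent) is dense in (ℝⁿ)^N with respect to the Euclidean topology. -/
open MvPolynomial

theorem sum_multichoose_range (n d : ℕ) :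
    ∑ i ∈ Finset.range (d + 1), n.multichoose i = (n + 1).multichoose d := by
  induction d with
  | zero => simp
  | succ d ih => rw [Finset.sum_range_succ, ih, Nat.multichoose_succ_succ, add_comm]

theorem finrank_restrictTotalDegree (n d : ℕ) :
    Module.finrank ℝ (restrictTotalDegree (Fin n) ℝ d) = (n + d).choose n := by
  have hset : {a : Fin n →₀ ℕ | a.degree ≤ d} =
      ((Finset.range (d + 1)).biUnion fun i => Finset.finsuppAntidiag Finset.univ i :
        Finset (Fin n →₀ ℕ)) := by
    ext a
    simp [Finset.mem_finsuppAntidiag, Finsupp.degree_eq_sum]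
  have hdisj : ((Finset.range (d + 1) : Finset ℕ) : Set ℕ).PairwiseDisjoint
      fun i => Finset.finsuppAntidiag (Finset.univ : Finset (Fin n)) i := by
    intro i _ j _ hij
    rw [Function.onFun, Finset.disjoint_left]
    intro a hi hj
    exact hij ((Finset.mem_finsuppAntidiag.1 hi).1.symm.trans (Finset.mem_finsuppAntidiag.1 hj).1)
  have hbasis := Module.finrank_eq_nat_card_basis
    (basisRestrictSupport ℝ {a : Fin n →₀ ℕ | a.degree ≤ d})
  rw [show restrictTotalDegree (Fin n) ℝ d =
    restrictSupport ℝ {a : Fin n →₀ ℕ | a.degree ≤ d} from rfl, hbasis, hset,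
    Nat.card_coe_set_eq, Set.ncard_coe_finset, Finset.card_biUnion hdisj]
  simp only [Finset.card_finsuppAntidiag_nat_eq_multichoose, Finset.card_univ, Fintype.card_fin]
  rw [sum_multichoose_range, Nat.multichoose_eq, show n + 1 + d - 1 = n + d by omega,
    Nat.choose_symm_add]

/-- Fewer than `C(n+d,n)` points lie on a common hypersurface of degree at most `d`. -/
theorem exists_ne_zero_totalDegree_le_eval_eq_zero {ι : Type*} (n d : ℕ) (x : ι → Fin n → ℝ)
    (J : Finset ι) (hJ : J.card < (n + d).choose n) :
    ∃ p : MvPolynomial (Fin n) ℝ, p ≠ 0 ∧ p.totalDegree ≤ d ∧ ∀ j ∈ J, eval (x j) p = 0 := by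
  let f : restrictTotalDegree (Fin n) ℝ d →ₗ[ℝ] (J → ℝ) :=
    LinearMap.pi fun j => (aeval (x j)).toLinearMap ∘ₗ Submodule.subtype _
  have hf : LinearMap.ker f ≠ ⊥ := f.ker_ne_bot_of_finrank_lt <| by
    simpa [finrank_restrictTotalDegree] using hJ
  obtain ⟨p, hp, hp0⟩ := (Submodule.ne_bot_iff _).1 hf
  refine ⟨p, by simpa using hp0, (mem_restrictTotalDegree _ _ _).1 p.2, fun j hj => ?_⟩
  simpa [f, coe_aeval_eq_eval] using congrFun (LinearMap.mem_ker.1 hp) ⟨j, hj⟩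

/-- Evaluation of a polynomial of degree at most `d` is a linear functional of `monVec`. -/
theorem eval_eq_sum_coeff_mul_monVec {n d : ℕ} {p : MvPolynomial (Fin n) ℝ}
    (hp : p.totalDegree ≤ d) (x : Fin n → ℝ) :
    eval x p = ∑ a ∈ p.support, coeff a p * monVec n d x a := by
  rw [eval_eq']
  refine Finset.sum_congr rfl fun a ha => ?_
  rw [monVec, if_pos ((le_totalDegree ha).trans hp)]

theorem eval_eq_zero_of_monVec_mem_span {n d : ℕ} {p : MvPolynomial (Fin n) ℝ}
    (hp : p.totalDegree ≤ d) {s : Set (Fin n → ℝ)} (hs : ∀ z ∈ s, eval z p = 0)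
    {y : Fin n → ℝ} (hy : monVec n d y ∈ Submodule.span ℝ (monVec n d '' s)) :
    eval y p = 0 := by
  let φ : ((Fin n →₀ ℕ) → ℝ) →ₗ[ℝ] ℝ := ∑ a ∈ p.support, coeff a p • LinearMap.proj a
  have hφ (z : Fin n → ℝ) : φ (monVec n d z) = eval z p := by
    simp [φ, eval_eq_sum_coeff_mul_monVec hp]
  have hle : Submodule.span ℝ (monVec n d '' s) ≤ LinearMap.ker φ := by
    rw [Submodule.span_le]
    rintro _ ⟨z, hz, rfl⟩
    simp [hφ, hs z hz]
  rw [← hφ]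
  exact hle hy

theorem exists_mem_eval_ne_zero_of_isOpen {n : ℕ} {U : Set (Fin n → ℝ)} (hU : IsOpen U)
    (hne : U.Nonempty) {p : MvPolynomial (Fin n) ℝ} (hp : p ≠ 0) : ∃ y ∈ U, eval y p ≠ 0 := by
  obtain ⟨c, hc⟩ := hne
  obtain ⟨ε, hε, hball⟩ := Metric.isOpen_iff.1 hU c hc
  by_contra! h
  refine hp (funext_set (fun i => Metric.ball (c i) ε) (fun i => ?_) fun y hy => ?_)
  · rw [Real.ball_eq_Ioo]
    exact Set.Ioo_infinite (by linarith)
  · rw [map_zero]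
    exact h y (hball (by rwa [ball_pi _ hε]))

theorem exists_mem_monVec_notMem_span {ι : Type*} {n d : ℕ} (x : ι → Fin n → ℝ) (S : Finset ι)
    {U : Set (Fin n → ℝ)} (hU : IsOpen U) (hne : U.Nonempty) :
    ∃ y ∈ U, ∀ J ⊆ S, J.card < (n + d).choose n →
      monVec n d y ∉ Submodule.span ℝ (monVec n d '' (x '' J)) := by
  classical
  choose! p hp0 hpd hpx using
    exists_ne_zero_totalDegree_le_eval_eq_zero n d x
  obtain ⟨y, hyU, hy⟩ := exists_mem_eval_ne_zero_of_isOpen hU hne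
    (p := ∏ J ∈ S.powerset with J.card < (n + d).choose n, p J)
    (Finset.prod_ne_zero_iff.2 fun J hJ => hp0 J (Finset.mem_filter.1 hJ).2)
  rw [map_prod, Finset.prod_ne_zero_iff] at hy
  refine ⟨y, hyU, fun J hJS hJ hmem => hy J (by simp [hJS, hJ]) ?_⟩
  exact eval_eq_zero_of_monVec_mem_span (hpd J hJ) (by simpa using hpx J hJ) hmem

theorem exists_mem_linearIndepOn_monVec {ι : Type*} {n d : ℕ} {U : ι → Set (Fin n → ℝ)}
    (hU : ∀ i, IsOpen (U i)) (hne : ∀ i, (U i).Nonempty) (S : Finset ι) :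
    ∃ x : ι → Fin n → ℝ, (∀ i, x i ∈ U i) ∧ ∀ I ⊆ S, I.card ≤ (n + d).choose n →
      LinearIndepOn ℝ (fun i => monVec n d (x i)) (I : Set ι) := by
  classical
  induction S using Finset.induction_on with
  | empty =>
    choose x hx using hne
    refine ⟨x, hx, fun I hI _ => ?_⟩
    rw [Finset.subset_empty.1 hI, Finset.coe_empty]
    exact linearIndepOn_empty _ _
  | insert a S ha ih =>
    obtain ⟨x, hxU, hx⟩ := ih
    obtain ⟨y, hyU, hy⟩ := exists_mem_monVec_notMem_span (d := d) x S (hU a) (hne a)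
    refine ⟨Function.update x a y, fun i => ?_, fun I hI hcard => ?_⟩
    · obtain rfl | h := eq_or_ne i a
      · simpa using hyU
      · simpa [h] using hxU i
    have hsub : I.erase a ⊆ S := by rwa [← Finset.subset_insert_iff]
    have heq : Set.EqOn (fun i => monVec n d (x i))
        (fun i => monVec n d (Function.update x a y i)) (I.erase a : Finset ι) := by
      intro i hi
      simp [Function.update_of_ne (Finset.ne_of_mem_erase hi)]
    have herase := (hx _ hsub ((Finset.card_erase_le).trans hcard)).congr heq
    by_cases haI : a ∈ I
    · rw [← Finset.insert_erase haI, Finset.coe_insert]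
      refine herase.insert ?_
      rw [← heq.image_eq]
      simpa [Set.image_image] using
        hy _ hsub ((Finset.card_erase_lt_of_mem haI).trans_le hcard)
    · rwa [Finset.erase_eq_of_notMem haI] at herase

/-- Lemma 5.1(a): the tuples `(x¹,…,x^N)` for which `{v_{n,d}(x¹),…,v_{n,d}(x^N)}` is a set
of `N` distinct vectors in general linear position (every subset of cardinality at most
`k = C(n+d,n)` is linearly independent) form a dense subset of `(ℝⁿ)^N`. -/
theorem stmt_14 (n d N : ℕ) (hn : 1 ≤ n) (hd : 1 ≤ d)
    (hN : Nat.choose (n + d) n ≤ N) :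
    Dense {x : Fin N → Fin n → ℝ |
      Function.Injective (fun i => monVec n d (x i)) ∧
      ∀ I : Finset (Fin N), I.card ≤ Nat.choose (n + d) n →
        LinearIndependent ℝ (fun i : I => monVec n d (x (i : Fin N)))} := by
  refine dense_iff_inter_open.2 fun V hV ⟨c, hc⟩ => ?_
  obtain ⟨U, hU, hUV⟩ := isOpen_pi_iff'.1 hV c hc
  obtain ⟨x, hxU, hx⟩ := exists_mem_linearIndepOn_monVec (d := d) (fun i => (hU i).1)
    (fun i => ⟨c i, (hU i).2⟩) Finset.univ
  refine ⟨x, hUV fun i _ => hxU i, fun i j hij => ?_, fun I hI => hx I I.subset_univ hI⟩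
  have htwo : 2 ≤ (n + d).choose n := by
    calc 2 ≤ (n + 1).choose n := by rw [Nat.choose_succ_self_right]; omega
      _ ≤ (n + d).choose n := Nat.choose_le_choose n (by omega)
  exact (hx {i, j} (Finset.subset_univ _) (Finset.card_le_two.trans htwo)).injOn
    (by simp) (by simp) hij
end

section
/- Let C_1,…,C_r ⊆ ℝⁿ be sets each of which has an ((𝒮₊ᵏ)^{m_i})-lift (i = 1,…,r). Then the sum C_1 + ⋯ + C_r = {u_1 + ⋯ + u_r : u_i ∈ C_i} has an ((𝒮₊ᵏ)^{m})-lift with m = m_1 + ⋯ + m_r. In particular, sxdeg(C_1 + ⋯ + C_r) ≤ max{sxdeg(C_i) : i = 1,…,r}. -/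
open MvPolynomial

/-- A lift transfers along a linear section of a linear map that respects the cones. -/
theorem HasLift.of_retraction {W W' V : Type*} [AddCommGroup W] [Module ℝ W]
    [AddCommGroup W'] [Module ℝ W'] [AddCommGroup V] [Module ℝ V]
    {K : Set W} {K' : Set W'} {S : Set V} (h : HasLift K S)
    (f : W →ₗ[ℝ] W') (g : W' →ₗ[ℝ] W) (hgf : ∀ w, g (f w) = w)
    (hf : ∀ w ∈ K, f w ∈ K') (hg : ∀ w ∈ K', g w ∈ K) : HasLift K' S := by
  obtain ⟨H, p, rfl⟩ := h
  refine ⟨H.map f.toAffineMap, p ∘ₗ g, ?_⟩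
  ext y
  constructor
  · rintro ⟨w, ⟨hwK, hwH⟩, rfl⟩
    exact ⟨f w, ⟨hf w hwK, w, hwH, rfl⟩, by simp [hgf]⟩
  · rintro ⟨_, ⟨hxK, w, hwH, rfl⟩, rfl⟩
    have hwK : g (f w) ∈ K := hg _ hxK
    rw [hgf] at hwK
    exact ⟨w, ⟨hwK, hwH⟩, by simp [hgf]⟩

/-- Padding with zero blocks enlarges the size of the semidefinite blocks of a lift. -/
theorem HasLift.psdTuple_mono {V : Type*} [AddCommGroup V] [Module ℝ V] {k l m : ℕ}
    {S : Set V} (hkl : k ≤ l) (h : HasLift (PSDTuple k m) S) : HasLift (PSDTuple l m) S := by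
  let E : Matrix (Fin l) (Fin k) ℝ := (1 : Matrix (Fin l) (Fin l) ℝ).submatrix id (Fin.castLE hkl)
  have hE : E.transpose * E = 1 := by
    ext a b
    simp [E, Matrix.mul_apply, Matrix.one_apply]
  let f : (Fin m → Matrix (Fin k) (Fin k) ℝ) →ₗ[ℝ] (Fin m → Matrix (Fin l) (Fin l) ℝ) :=
    { toFun := fun A i => E * A i * E.transpose
      map_add' := fun A B => by funext i; simp [Matrix.mul_add, Matrix.add_mul]
      map_smul' := fun c A => by funext i; simp }
  let g : (Fin m → Matrix (Fin l) (Fin l) ℝ) →ₗ[ℝ] (Fin m → Matrix (Fin k) (Fin k) ℝ) :=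
    { toFun := fun A i => E.transpose * A i * E
      map_add' := fun A B => by funext i; simp [Matrix.mul_add, Matrix.add_mul]
      map_smul' := fun c A => by funext i; simp }
  refine h.of_retraction f g (fun A => ?_) (fun A hA i => ?_) (fun A hA i => ?_)
  · funext i
    calc E.transpose * (E * A i * E.transpose) * E
        = (E.transpose * E) * A i * (E.transpose * E) := by simp only [Matrix.mul_assoc]
      _ = A i := by simp [hE]
  · simpa [f, Matrix.conjTranspose_eq_transpose_of_trivial] using
      (hA i).mul_mul_conjTranspose_same E
  · simpa [g, Matrix.conjTranspose_eq_transpose_of_trivial] using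
      (hA i).conjTranspose_mul_mul_same E

/-- Lifts of the summands over tuples of semidefinite cones combine to a lift of the sum. -/
theorem HasLift.psdTuple_sum {V : Type*} [AddCommGroup V] [Module ℝ V] {k r : ℕ}
    {C : Fin r → Set V} {m : Fin r → ℕ} (h : ∀ i, HasLift (PSDTuple k (m i)) (C i)) :
    HasLift (PSDTuple k (∑ i, m i))
      {y | ∃ u : Fin r → V, (∀ i, u i ∈ C i) ∧ y = ∑ i, u i} := by
  choose H p hC using h
  let q (i : Fin r) : (Fin (∑ i, m i) → Matrix (Fin k) (Fin k) ℝ) →ₗ[ℝ]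
      (Fin (m i) → Matrix (Fin k) (Fin k) ℝ) :=
    LinearMap.funLeft ℝ _ fun j => finSigmaFinEquiv ⟨i, j⟩
  refine ⟨⨅ i, (H i).comap (q i).toAffineMap, ∑ i, p i ∘ₗ q i, ?_⟩
  ext y
  constructor
  · rintro ⟨u, hu, rfl⟩
    have hu' (i : Fin r) : ∃ A, (A ∈ PSDTuple k (m i) ∧ A ∈ H i) ∧ p i A = u i := by
      have hui := hu i
      rw [hC i] at hui
      exact hui
    choose A hA hpA using hu'
    let B : Fin (∑ i, m i) → Matrix (Fin k) (Fin k) ℝ :=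
      fun t => A (finSigmaFinEquiv.symm t).1 (finSigmaFinEquiv.symm t).2
    have hB (i : Fin r) : q i B = A i := by
      funext j
      simp only [q, B, LinearMap.funLeft_apply]
      rw [Equiv.symm_apply_apply]
    refine ⟨B, ⟨fun t => (hA _).1 _, ?_⟩, ?_⟩
    · simp only [SetLike.mem_coe, AffineSubspace.mem_iInf_iff, AffineSubspace.mem_comap,
        LinearMap.coe_toAffineMap]
      intro i
      rw [hB]
      exact (hA i).2
    · simp [hB, hpA]
  · rintro ⟨B, ⟨hBK, hBH⟩, rfl⟩
    simp only [SetLike.mem_coe, AffineSubspace.mem_iInf_iff, AffineSubspace.mem_comap,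
      LinearMap.coe_toAffineMap] at hBH
    refine ⟨fun i => p i (q i B), fun i => ?_, by simp⟩
    rw [hC i]
    exact ⟨q i B, ⟨fun j => hBK _, hBH i⟩, rfl⟩

/-- A finite bound on the semidefinite extension degree yields a lift of that block size. -/
theorem exists_hasLift_of_sxdeg_le {V : Type*} [AddCommGroup V] [Module ℝ V] {S : Set V} {k : ℕ}
    (h : sxdeg S ≤ k) : ∃ m, HasLift (PSDTuple k m) S := by
  have hne : {c : ℕ∞ | ∃ k m : ℕ, c = (k : ℕ∞) ∧ HasLift (PSDTuple k m) S}.Nonempty := by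
    by_contra hne
    rw [Set.not_nonempty_iff_eq_empty] at hne
    rw [sxdeg, hne, sInf_empty] at h
    exact ENat.natCast_ne_top k (top_le_iff.mp h)
  obtain ⟨l, m, hl, hS⟩ := csInf_mem hne
  refine ⟨m, hS.psdTuple_mono ?_⟩
  rw [sxdeg, hl] at h
  exact_mod_cast h

/-- Lemma 5.2: if each `Cᵢ ⊆ ℝⁿ` has an `(𝒮₊ᵏ)^{mᵢ}`-lift, then `C₁ + ⋯ + C_r` has an
`(𝒮₊ᵏ)^{m₁+⋯+m_r}`-lift; in particular `sxdeg(C₁+⋯+C_r) ≤ max_i sxdeg(Cᵢ)`. -/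
theorem stmt_16 :
    (∀ (n k r : ℕ) (C : Fin r → Set (Fin n → ℝ)) (m : Fin r → ℕ),
      (∀ i, HasLift (PSDTuple k (m i)) (C i)) →
      HasLift (PSDTuple k (∑ i, m i))
        {y | ∃ u : Fin r → Fin n → ℝ, (∀ i, u i ∈ C i) ∧ y = ∑ i, u i}) ∧
    (∀ (n r : ℕ) (C : Fin r → Set (Fin n → ℝ)),
      sxdeg {y | ∃ u : Fin r → Fin n → ℝ, (∀ i, u i ∈ C i) ∧ y = ∑ i, u i} ≤
        Finset.univ.sup fun i => sxdeg (C i)) := by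
  refine ⟨fun n k r C m h => HasLift.psdTuple_sum h, fun n r C => ?_⟩
  by_cases htop : (Finset.univ.sup fun i => sxdeg (C i)) = ⊤
  · exact le_top.trans_eq htop.symm
  obtain ⟨k, hk⟩ := ENat.ne_top_iff_exists.mp htop
  have hle (i : Fin r) : sxdeg (C i) ≤ k :=
    (Finset.le_sup (f := fun i => sxdeg (C i)) (Finset.mem_univ i)).trans_eq hk.symm
  choose m hm using fun i => exists_hasLift_of_sxdeg_le (hle i)
  rw [← hk]
  exact sInf_le ⟨k, _, rfl, HasLift.psdTuple_sum hm⟩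
end
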